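/- arXiv:2107.10819 — 3 statements merged into one kernel-verified Lean document; each statement's English description precedes it below -/
import Mathlib

section
/- Let n ≥ 1. For every complete flag F in ℂⁿ there exists a unique complete flag F′ in standard form such that F = g·F′ for some g ∈ B_{n−1}. Equivalently, the map sending a complete flag in standard form to its B_{n−1}-orbit is a bijection from the set of complete flags in standard form onto the set of B_{n−1}-orbits of complete flags in ℂⁿ. -/
open scoped BigOperators

noncomputable section

/-- Membership in the subgroup `B_{n-1}` of `GL(n, ℂ)`: invertible upper triangular matrices
`g` with `g ₙₙ = 1` and `g ᵢₙ = 0` for `i < n` (indices `0, …, n-1`; the last index plays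
the role of `n`). -/
def memB (n : ℕ) (g : Matrix (Fin n) (Fin n) ℂ) : Prop :=
  IsUnit g ∧
  (∀ i j : Fin n, (j : ℕ) < (i : ℕ) → g i j = 0) ∧
  (∀ i : Fin n, (i : ℕ) + 1 = n → g i i = 1) ∧
  (∀ i j : Fin n, (j : ℕ) + 1 = n → (i : ℕ) + 1 ≠ n → g i j = 0)

/-- A complete flag `V₁ ⊂ V₂ ⊂ ⋯ ⊂ Vₙ = ℂⁿ` in `ℂⁿ` (so `V i` has dimension `i + 1`
for the 0-indexed `i : Fin n`). -/
structure CompleteFlag (n : ℕ) where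
  V : Fin n → Submodule ℂ (Fin n → ℂ)
  mono : ∀ i j : Fin n, i ≤ j → V i ≤ V j
  dimV : ∀ i : Fin n, Module.finrank ℂ (V i) = (i : ℕ) + 1

/-- Two complete flags lie in the same `B_{n-1}`-orbit:
`F = g · F'` for some `g ∈ B_{n-1}`. -/
def flagRel (n : ℕ) (F F' : CompleteFlag n) : Prop :=
  ∃ g : Matrix (Fin n) (Fin n) ℂ, memB n g ∧
    ∀ i, (F'.V i).map (Matrix.toLin' g) = F.V i

/-- The standard basis vector `e_{j+1}` of `ℂⁿ` (for the 0-indexed `j : Fin n`). -/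
def stdVec (n : ℕ) (j : Fin n) : Fin n → ℂ := Pi.single j 1

/-- The hat vector `ê_{j+1} = e_{j+1} + e_n` of `ℂⁿ` (for the 0-indexed `j : Fin n`,
meaningful when `j + 1 < n`). -/
def hatVec (n : ℕ) (j : Fin n) : Fin n → ℂ :=
  Pi.single j 1 + Pi.single (⟨n - 1, by have := j.isLt; omega⟩ : Fin n) 1

/-- A complete flag in `ℂⁿ` is in standard form. -/
def IsStdFlag (n : ℕ) (F : CompleteFlag n) : Prop :=
  ∃ (v : Fin n → (Fin n → ℂ)) (j : Fin n → Fin n) (ishat : Fin n → Bool),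
    (∀ i : Fin n, F.V i = Submodule.span ℂ {w | ∃ k : Fin n, k ≤ i ∧ w = v k}) ∧
    (∀ i : Fin n,
      (ishat i = true → ((j i : ℕ) + 1 < n ∧ v i = hatVec n (j i))) ∧
      (ishat i = false → v i = stdVec n (j i))) ∧
    (∃ i : Fin n, ishat i = false ∧ (j i : ℕ) + 1 = n) ∧
    (∀ i k : Fin n, ishat i = false → (j i : ℕ) + 1 = n → i < k → ishat k = false) ∧
    (∀ i k : Fin n, i < k → ishat i = true → ishat k = true → j k < j i)


/-- The `B`-stable subspaces: `NN (2r) = E_r`, `NN (2r+1) = E_r + ⟨e_n⟩`. -/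
def NN (n t : ℕ) : Submodule ℂ (Fin n → ℂ) where
  carrier := {w | ∀ m : Fin n,
    (((m : ℕ) + 1 ≠ n ∧ t / 2 ≤ (m : ℕ)) ∨ ((m : ℕ) + 1 = n ∧ t % 2 = 0)) → w m = 0}
  zero_mem' := by intro m _; rfl
  add_mem' := by
    intro a b ha hb m hm
    simp [ha m hm, hb m hm]
  smul_mem' := by
    intro c a ha m hm
    simp [ha m hm]

theorem mem_NN {n t : ℕ} {w : Fin n → ℂ} : w ∈ NN n t ↔ ∀ m : Fin n,
    (((m : ℕ) + 1 ≠ n ∧ t / 2 ≤ (m : ℕ)) ∨ ((m : ℕ) + 1 = n ∧ t % 2 = 0)) → w m = 0 := Iff.rfl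

/-- The span of the previous steps of a flag. -/
def WW {n : ℕ} (F : CompleteFlag n) (i : Fin n) : Submodule ℂ (Fin n → ℂ) :=
  ⨆ k : Fin n, ⨆ _ : k < i, F.V k

theorem le_WW {n : ℕ} (F : CompleteFlag n) {k i : Fin n} (h : k < i) : F.V k ≤ WW F i :=
  le_iSup₂_of_le k h le_rfl

theorem WW_le {n : ℕ} (F : CompleteFlag n) (i : Fin n) : WW F i ≤ F.V i :=
  iSup₂_le fun k h => F.mono k i h.le

theorem finrank_WW {n : ℕ} (F : CompleteFlag n) (i : Fin n) :
    Module.finrank ℂ (WW F i) = (i : ℕ) := by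
  by_cases h0 : (i : ℕ) = 0
  · have : WW F i = ⊥ := by
      rw [eq_bot_iff]
      refine iSup₂_le fun k h => ?_
      have : (k : ℕ) < i := h
      omega
    rw [this, h0]; simp
  · have hi := i.isLt
    let k : Fin n := ⟨i - 1, by omega⟩
    have : WW F i = F.V k := by
      apply le_antisymm
      · refine iSup₂_le fun m h => F.mono m k ?_
        have : (m : ℕ) < i := h
        show (m : ℕ) ≤ i - 1
        omega
      · apply le_WW
        show (i : ℕ) - 1 < i
        omega
    rw [this, F.dimV]
    show (i : ℕ) - 1 + 1 = i
    omega

/-- `V_i \ V_{i-1}` meets `NN t`. -/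
def att {n : ℕ} (F : CompleteFlag n) (i : Fin n) (t : ℕ) : Prop :=
  ∃ w ∈ F.V i, w ∉ WW F i ∧ w ∈ NN n t

theorem memB_NN {n : ℕ} {g : Matrix (Fin n) (Fin n) ℂ} (hg : memB n g) (t : ℕ)
    {w : Fin n → ℂ} (hw : w ∈ NN n t) : Matrix.toLin' g w ∈ NN n t := by
  obtain ⟨_, h1, _, h3⟩ := hg
  rw [mem_NN] at hw ⊢
  intro m hm
  rw [Matrix.toLin'_apply]
  show ∑ p, g m p * w p = 0
  apply Finset.sum_eq_zero
  intro p _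
  rcases lt_or_ge (p : ℕ) (m : ℕ) with h | h
  · rw [h1 m p h, zero_mul]
  · have hp := p.isLt
    rcases hm with hm | hm
    · by_cases hpl : (p : ℕ) + 1 = n
      · rw [h3 m p hpl hm.1, zero_mul]
      · rw [hw p (Or.inl ⟨hpl, by omega⟩), mul_zero]
    · rw [hw p (Or.inr ⟨by omega, hm.2⟩), mul_zero]

theorem unit_inj {n : ℕ} {g : Matrix (Fin n) (Fin n) ℂ} (hg : IsUnit g) :
    Function.Injective (Matrix.toLin' g) := by
  have := Matrix.mulVec_injective_iff_isUnit.2 hg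
  intro a b h
  exact this (by simpa [Matrix.toLin'_apply] using h)

theorem map_NN {n : ℕ} {g : Matrix (Fin n) (Fin n) ℂ} (hg : memB n g) (t : ℕ) :
    (NN n t).map (Matrix.toLin' g) = NN n t := by
  apply Submodule.eq_of_le_of_finrank_eq
  · rintro _ ⟨w, hw, rfl⟩
    exact memB_NN hg t hw
  · exact (Submodule.equivMapOfInjective _ (unit_inj hg.1) _).finrank_eq.symm

theorem att_iff {n : ℕ} {F F' : CompleteFlag n} (h : flagRel n F F') (i : Fin n) (t : ℕ) :
    att F i t ↔ att F' i t := by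
  obtain ⟨g, hg, hV⟩ := h
  have inj := unit_inj hg.1
  have hW : (WW F' i).map (Matrix.toLin' g) = WW F i := by
    simp only [WW, Submodule.map_iSup, hV]
  constructor
  · rintro ⟨w, hw, hw2, hw3⟩
    rw [← hV] at hw
    rw [← hW] at hw2
    rw [← map_NN hg] at hw3
    obtain ⟨u, hu, rfl⟩ := hw
    obtain ⟨u', hu', h⟩ := hw3
    have := inj h
    subst this
    exact ⟨u', hu, fun h => hw2 ⟨u', h, rfl⟩, hu'⟩
  · rintro ⟨w, hw, hw2, hw3⟩
    refine ⟨Matrix.toLin' g w, ?_, ?_, memB_NN hg t hw3⟩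
    · rw [← hV]; exact ⟨w, hw, rfl⟩
    · rw [← hW]
      rintro ⟨u, hu, h⟩
      have := inj h
      subst this
      exact hw2 hu

/-- The numerical code of a vector in a standard form. -/
def codeOf (n : ℕ) (j : Fin n) (b : Bool) : ℕ :=
  if (j : ℕ) + 1 = n then 1 else 2 * ((j : ℕ) + 1) + (if b = true then 1 else 0)

theorem hatVec_apply {n : ℕ} (l : Fin n) (hl : (l : ℕ) + 1 = n) (j m : Fin n) :
    hatVec n j m = (if m = j then 1 else 0) + (if m = l then 1 else 0) := by
  have : (⟨n - 1, by have := j.isLt; omega⟩ : Fin n) = l := by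
    apply Fin.ext; show n - 1 = l; omega
  unfold hatVec
  rw [this]
  simp [Pi.single_apply]

theorem stdVec_apply {n : ℕ} (j m : Fin n) :
    stdVec n j m = (if m = j then 1 else 0) := by
  simp [stdVec, Pi.single_apply]

theorem std_code {n : ℕ} (F : CompleteFlag n) (v : Fin n → (Fin n → ℂ)) (j : Fin n → Fin n)
    (ishat : Fin n → Bool)
    (hV : ∀ i : Fin n, F.V i = Submodule.span ℂ {w | ∃ k : Fin n, k ≤ i ∧ w = v k})
    (hv : ∀ i : Fin n,
      (ishat i = true → ((j i : ℕ) + 1 < n ∧ v i = hatVec n (j i))) ∧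
      (ishat i = false → v i = stdVec n (j i)))
    (ha : ∃ i : Fin n, ishat i = false ∧ (j i : ℕ) + 1 = n)
    (hb : ∀ i k : Fin n, ishat i = false → (j i : ℕ) + 1 = n → i < k → ishat k = false)
    (hc : ∀ i k : Fin n, i < k → ishat i = true → ishat k = true → j k < j i) (i : Fin n) :
    IsLeast {t | att F i t} (codeOf n (j i) (ishat i)) := by
  obtain ⟨p, hp, hpl⟩ := ha
  obtain ⟨l, hl⟩ : ∃ l, l = j p := ⟨_, rfl⟩
  rw [← hl] at hpl
  have lne : ∀ m : Fin n, (m : ℕ) + 1 = n ↔ m = l := by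
    intro m; rw [Fin.ext_iff]; omega
  have hval : ∀ k m, v k m = (if m = j k then 1 else 0) +
      (if ishat k = true ∧ m = l then 1 else 0) := by
    intro k m
    cases hk : ishat k
    · rw [(hv k).2 hk, stdVec_apply]; simp
    · rw [((hv k).1 hk).2, hatVec_apply l hpl]; simp
  have hjl : ∀ k, ishat k = true → j k ≠ l := by
    intro k hk h
    have := ((hv k).1 hk).1
    rw [h] at this; omega
  have hsurj : Function.Surjective j := by
    intro m
    by_contra hm
    push Not at hm
    have hml : m ≠ l := by rintro rfl; exact hm p hl.symm
    have htop : F.V l = ⊤ := by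
      apply Submodule.eq_top_of_finrank_eq
      rw [F.dimV, hpl]; simp
    have : F.V l ≤ LinearMap.ker (LinearMap.proj m : (Fin n → ℂ) →ₗ[ℂ] ℂ) := by
      rw [hV, Submodule.span_le]
      rintro _ ⟨k, _, rfl⟩
      simp [hval, hml, (hm k).symm]
    have h1 : (Pi.single m 1 : Fin n → ℂ) ∈ F.V l := by rw [htop]; trivial
    have := this h1
    simp at this
  have hinj : Function.Injective j := Finite.injective_iff_surjective.2 hsurj
  -- generic argument with a functional
  have key : ∀ L : (Fin n → ℂ) →ₗ[ℂ] ℂ, (∀ k < i, L (v k) = 0) → L (v i) ≠ 0 →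
      v i ∉ WW F i ∧ ∀ w ∈ F.V i, L w = 0 → w ∈ WW F i := by
    intro L h1 h2
    constructor
    · intro h
      apply h2
      have : WW F i ≤ LinearMap.ker L := by
        refine iSup₂_le fun k hk => ?_
        rw [hV, Submodule.span_le]
        rintro _ ⟨q, hq, rfl⟩
        exact h1 q (lt_of_le_of_lt hq hk)
      exact this h
    · intro w hw hLw
      have h3 : F.V i ≤ WW F i ⊔ Submodule.span ℂ {v i} := by
        rw [hV, Submodule.span_le]
        rintro _ ⟨q, hq, rfl⟩
        rcases hq.eq_or_lt with rfl | hq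
        · exact Submodule.mem_sup_right (Submodule.mem_span_singleton_self _)
        · apply Submodule.mem_sup_left
          apply le_WW F hq
          rw [hV]
          exact Submodule.subset_span ⟨q, le_rfl, rfl⟩
      obtain ⟨x, hx, y, hy, rfl⟩ := Submodule.mem_sup.1 (h3 hw)
      obtain ⟨c, rfl⟩ := Submodule.mem_span_singleton.1 hy
      have : WW F i ≤ LinearMap.ker L := by
        refine iSup₂_le fun k hk => ?_
        rw [hV, Submodule.span_le]
        rintro _ ⟨q, hq, rfl⟩
        exact h1 q (lt_of_le_of_lt hq hk)
      have hLx : L x = 0 := this hx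
      have hc0 : c = 0 := by
        simpa [hLx, h2] using hLw
      simpa [hc0] using hx
  have hviV : v i ∈ F.V i := by
    rw [hV]; exact Submodule.subset_span ⟨i, le_rfl, rfl⟩
  -- the two functionals
  have keyA : j i ≠ l → v i ∉ WW F i ∧ ∀ w ∈ F.V i, w (j i) = 0 → w ∈ WW F i := by
    intro hjil
    apply key (LinearMap.proj (j i))
    · intro k hk
      have : j i ≠ j k := fun h => hk.ne (hinj h).symm
      simp [hval, this, hjil]
    · simp [hval, hjil]
  have keyB : (j i = l ∨ ishat i = true) → v i ∉ WW F i ∧ ∀ w ∈ F.V i,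
      w l = 0 → (∀ k < i, ishat k = true → w (j k) = 0) → w ∈ WW F i := by
    intro hor
    have := key (LinearMap.proj l -
      ∑ k ∈ Finset.univ.filter (fun k => k < i ∧ ishat k = true), LinearMap.proj (j k)) ?_ ?_
    · refine ⟨this.1, fun w hw h1 h2 => this.2 w hw ?_⟩
      simp only [LinearMap.sub_apply, LinearMap.proj_apply, LinearMap.sum_apply, h1, zero_sub,
        neg_eq_zero]
      apply Finset.sum_eq_zero
      intro k hk
      simp only [Finset.mem_filter] at hk
      exact h2 k hk.2.1 hk.2.2
    · intro k hk
      have hkl : l ≠ j k := by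
        intro h
        have hkp : k = p := hinj (h.symm.trans hl)
        subst hkp
        rcases hor with h' | h'
        · exact hk.ne (hinj (h.symm.trans h'.symm))
        · have := hb k i hp (by rw [← hl]; exact hpl) hk
          rw [this] at h'; simp at h'
      have hsum : ∑ q ∈ Finset.univ.filter (fun q => q < i ∧ ishat q = true), v k (j q)
          = ∑ q ∈ Finset.univ.filter (fun q => q < i ∧ ishat q = true), if q = k then 1 else 0 := by
        apply Finset.sum_congr rfl
        intro q hq
        simp only [Finset.mem_filter] at hq
        rw [hval]
        simp [hjl q hq.2.2, hinj.eq_iff]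
      simp only [LinearMap.sub_apply, LinearMap.proj_apply, LinearMap.sum_apply]
      rw [hsum, hval, Finset.sum_ite_eq']
      simp [hkl, hk]
    · have hsum : ∑ q ∈ Finset.univ.filter (fun q => q < i ∧ ishat q = true), v i (j q) = 0 := by
        apply Finset.sum_eq_zero
        intro q hq
        simp only [Finset.mem_filter] at hq
        rw [hval]
        simp [hjl q hq.2.2, hinj.eq_iff, hq.2.1.ne]
      simp only [LinearMap.sub_apply, LinearMap.proj_apply, LinearMap.sum_apply]
      rw [hsum, hval]
      rcases hor with h | h
      · have : ishat i = false := by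
          cases h' : ishat i
          · rfl
          · exact absurd h (hjl i h')
        simp [h, this]
      · simp [h, (hjl i h).symm]
  constructor
  · refine ⟨v i, hviV, ?_, ?_⟩
    · by_cases h : j i = l
      · exact (keyB (Or.inl h)).1
      · exact (keyA h).1
    · rw [mem_NN]
      intro m hm
      rw [hval]
      unfold codeOf at hm
      simp only [lne, Ne] at hm
      by_cases h : j i = l
      · have : ishat i = false := by
          cases h' : ishat i
          · rfl
          · exact absurd h (hjl i h')
        simp [h] at hm
        simp [this, h, hm]
      · rw [if_neg h] at hm
        cases h' : ishat i
        · have : m ≠ j i := by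
            rintro rfl
            rcases hm with hm | hm
            · rw [h'] at hm
              simp at hm
            · exact h hm.1
          simp [this]
        · simp only [h', if_true] at hm
          have h1 : m ≠ l := by
            rintro rfl
            simp at hm
          have : m ≠ j i := by
            rintro rfl
            rcases hm with hm | hm
            · omega
            · exact h hm.1
          simp [this, h1]
  · rintro t ⟨w, hw, hw2, hw3⟩
    by_contra hlt
    push Not at hlt
    apply hw2
    rw [mem_NN] at hw3
    unfold codeOf at hlt
    simp only [lne] at hlt
    by_cases h : j i = l
    · rw [if_pos h] at hlt
      have ht : t = 0 := by omega
      subst ht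
      have : w = 0 := by
        funext m
        apply hw3
        by_cases hm : (m : ℕ) + 1 = n
        · right; exact ⟨hm, rfl⟩
        · left; exact ⟨hm, by simp⟩
      rw [this]; exact Submodule.zero_mem _
    · rw [if_neg h] at hlt
      have hjn : (j i : ℕ) + 1 ≠ n := by rw [Ne, lne]; exact h
      by_cases ht : t / 2 ≤ (j i : ℕ)
      · exact (keyA h).2 w hw (hw3 _ (Or.inl ⟨hjn, ht⟩))
      · have hh : ishat i = true := by
          cases h' : ishat i
          · rw [h'] at hlt
            simp at hlt
            omega
          · rfl
        rw [hh] at hlt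
        simp at hlt
        apply (keyB (Or.inr hh)).2 w hw
        · exact hw3 l (Or.inr ⟨hpl, by omega⟩)
        · intro k hk hkh
          have h1 : (j i : ℕ) < j k := hc k i hk hkh hh
          apply hw3
          left
          refine ⟨?_, by omega⟩
          rw [Ne, lne]; exact hjl k hkh

theorem std_unique {n : ℕ} {F F₁ F₂ : CompleteFlag n} (h1 : IsStdFlag n F₁)
    (h2 : IsStdFlag n F₂) (r1 : flagRel n F F₁) (r2 : flagRel n F F₂) : F₁ = F₂ := by
  obtain ⟨v, j, b, hV, hv, ha, hb, hc⟩ := h1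
  obtain ⟨v', j', b', hV', hv', ha', hb', hc'⟩ := h2
  have hcode : ∀ i, codeOf n (j i) (b i) = codeOf n (j' i) (b' i) := by
    intro i
    have e1 := std_code F₁ v j b hV hv ha hb hc i
    have e2 := std_code F₂ v' j' b' hV' hv' ha' hb' hc' i
    have : {t | att F₁ i t} = {t | att F₂ i t} := by
      ext t
      exact (att_iff r1 i t).symm.trans (att_iff r2 i t)
    rw [this] at e1
    exact e1.unique e2
  have hvv : v = v' := by
    funext i
    have h := hcode i
    have g1 := hv i
    have g2 := hv' i
    unfold codeOf at h
    have hj : j i = j' i ∧ b i = b' i := by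
      rw [Fin.ext_iff]
      cases hbi : b i <;> cases hbi' : b' i <;> simp only [hbi, hbi'] at h g1 g2 <;>
        simp at h g1 g2 ⊢ <;> split_ifs at h <;> omega
    cases hbi : b i
    · rw [g1.2 hbi, g2.2 (hj.2 ▸ hbi), hj.1]
    · rw [(g1.1 hbi).2, (g2.1 (hj.2 ▸ hbi)).2, hj.1]
  have : F₁.V = F₂.V := by
    funext i
    rw [hV, hV', hvv]
  cases F₁; cases F₂
  simp only at this
  subst this
  rfl


theorem exists_data {n : ℕ} (F : CompleteFlag n) (l : Fin n) (hl : (l : ℕ) + 1 = n) (i : Fin n) :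
    ∃ (t : ℕ) (w : Fin n → ℂ) (j : Fin n), w ∈ F.V i ∧ w ∉ WW F i ∧ w ∈ NN n t ∧
      (∀ s u, u ∈ F.V i → u ∉ WW F i → u ∈ NN n s → t ≤ s) ∧
      ((j = l ∧ t = 1) ∨ (j ≠ l ∧ t / 2 = j + 1)) ∧ (t % 2 = 1 → w l = 1) ∧ w j ≠ 0 := by
  classical
  have hex : ∃ t, att F i t := by
    refine ⟨2 * n + 1, ?_⟩
    have hlt : WW F i < F.V i := by
      refine lt_of_le_of_ne (WW_le F i) fun h => ?_
      have h1 := finrank_WW F i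
      rw [h, F.dimV] at h1
      omega
    obtain ⟨w, hw, hw2⟩ := SetLike.exists_of_lt hlt
    refine ⟨w, hw, hw2, ?_⟩
    rw [mem_NN]
    intro m hm
    have := m.isLt
    omega
  obtain ⟨t, ⟨w₀, hw, hw2, hw3⟩, hmin⟩ : ∃ t, att F i t ∧ ∀ s, att F i s → t ≤ s :=
    ⟨Nat.find hex, Nat.find_spec hex, fun s hs => Nat.find_min' hex hs⟩
  have ht0 : t ≠ 0 := by
    rintro rfl
    apply hw2
    have : w₀ = 0 := by
      funext m
      apply hw3
      omega
    rw [this]; exact Submodule.zero_mem _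
  have hodd : t % 2 = 1 → w₀ l ≠ 0 := by
    intro h h0
    have := hmin (t - 1) ⟨w₀, hw, hw2, by
      rw [mem_NN]
      intro m hm
      by_cases hml : m = l
      · rw [hml, h0]
      · apply hw3
        left
        rw [Fin.ext_iff] at hml
        omega⟩
    omega
  obtain ⟨c, hc, hcl⟩ : ∃ c : ℂ, c ≠ 0 ∧ (t % 2 = 1 → c * w₀ l = 1) := by
    by_cases h : t % 2 = 1
    · exact ⟨(w₀ l)⁻¹, inv_ne_zero (hodd h), fun _ => inv_mul_cancel₀ (hodd h)⟩
    · exact ⟨1, one_ne_zero, fun h' => absurd h' h⟩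
  have hw2' : c • w₀ ∉ WW F i := by
    rwa [Submodule.smul_mem_iff _ hc]
  have hmin' : ∀ s u, u ∈ F.V i → u ∉ WW F i → u ∈ NN n s → t ≤ s :=
    fun s u h1 h2 h3 => hmin s ⟨u, h1, h2, h3⟩
  by_cases h1 : t / 2 = 0
  · have ht : t = 1 := by omega
    refine ⟨t, c • w₀, l, Submodule.smul_mem _ _ hw, hw2', Submodule.smul_mem _ _ hw3, hmin',
      Or.inl ⟨rfl, ht⟩, hcl, ?_⟩
    have := hcl (by omega)
    simp only [Pi.smul_apply, smul_eq_mul]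
    rw [this]; exact one_ne_zero
  · have hlt : t / 2 < n := by
      by_contra hge
      have := hmin (t - 2) ⟨w₀, hw, hw2, by
        rw [mem_NN]
        intro m hm
        have := m.isLt
        apply hw3
        omega⟩
      omega
    obtain ⟨j, hj⟩ : ∃ j : Fin n, (j : ℕ) = t / 2 - 1 := ⟨⟨t / 2 - 1, by omega⟩, rfl⟩
    refine ⟨t, c • w₀, j, Submodule.smul_mem _ _ hw, hw2', Submodule.smul_mem _ _ hw3, hmin',
      Or.inr ⟨?_, by omega⟩, hcl, ?_⟩
    · rw [Ne, Fin.ext_iff]; omega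
    · simp only [Pi.smul_apply, smul_eq_mul]
      refine mul_ne_zero hc fun h0 => ?_
      have := hmin (t - 2) ⟨w₀, hw, hw2, by
        rw [mem_NN]
        intro m hm
        by_cases hmj : m = j
        · rw [hmj, h0]
        · apply hw3
          rw [Fin.ext_iff] at hmj
          omega⟩
      omega

theorem span_eq {n : ℕ} (F : CompleteFlag n) (w : Fin n → (Fin n → ℂ))
    (h1 : ∀ i, w i ∈ F.V i) (h2 : ∀ i, w i ∉ WW F i) (i : Fin n) :
    F.V i = Submodule.span ℂ {u | ∃ k : Fin n, k ≤ i ∧ u = w k} := by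
  induction i using WellFoundedLT.induction with
  | _ i ih =>
  apply le_antisymm
  · have hlt : WW F i < WW F i ⊔ Submodule.span ℂ {w i} := by
      refine lt_of_le_of_ne le_sup_left fun h => h2 i ?_
      rw [h]
      exact Submodule.mem_sup_right (Submodule.mem_span_singleton_self _)
    have hle : WW F i ⊔ Submodule.span ℂ {w i} ≤ F.V i := by
      refine sup_le (WW_le F i) ?_
      rw [Submodule.span_singleton_le_iff_mem]
      exact h1 i
    have heq : WW F i ⊔ Submodule.span ℂ {w i} = F.V i := by
      apply Submodule.eq_of_le_of_finrank_le hle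
      have := Submodule.finrank_lt_finrank_of_lt hlt
      rw [finrank_WW] at this
      rw [F.dimV]
      omega
    rw [← heq]
    refine sup_le (iSup₂_le fun k hk => ?_) ?_
    · rw [ih k hk]
      apply Submodule.span_mono
      rintro _ ⟨q, hq, rfl⟩
      exact ⟨q, hq.trans hk.le, rfl⟩
    · rw [Submodule.span_singleton_le_iff_mem]
      exact Submodule.subset_span ⟨i, le_rfl, rfl⟩
  · rw [Submodule.span_le]
    rintro _ ⟨k, hk, rfl⟩
    exact F.mono k i hk (h1 k)

theorem std_exists {n : ℕ} (hn : 1 ≤ n) (F : CompleteFlag n) :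
    ∃ F' : CompleteFlag n, IsStdFlag n F' ∧ flagRel n F F' := by
  classical
  obtain ⟨l, hl⟩ : ∃ l : Fin n, (l : ℕ) + 1 = n := ⟨⟨n - 1, by omega⟩, by simp; omega⟩
  have lne : ∀ m : Fin n, (m : ℕ) + 1 = n ↔ m = l := by
    intro m; rw [Fin.ext_iff]; omega
  choose t w j hw hW hN hmin hj hodd hwj using exists_data F l hl
  -- subtracting an earlier vector
  have hsub : ∀ a b : Fin n, a < b → ∀ c : ℂ, ∀ s, w b - c • w a ∈ NN n s → t b ≤ s := by
    intro a b hab c s hs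
    refine hmin b s _ ?_ ?_ hs
    · exact Submodule.sub_mem _ (hw b) (Submodule.smul_mem _ _ (F.mono a b hab.le (hw a)))
    · intro h
      apply hW b
      have := Submodule.add_mem _ h (Submodule.smul_mem _ c (le_WW F hab (hw a)))
      simpa using this
  have hne : ∀ a b : Fin n, a < b → j a ≠ j b := by
    intro a b hab he
    have h1 := hj a
    have h2 := hj b
    rw [he] at h1
    have hwa := hwj a
    rw [he] at hwa
    have := hsub a b hab (w b (j b) / w a (j b)) (t b / 2 * 2 - 1) (by
      rw [mem_NN]
      intro m hm
      by_cases hmj : m = j b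
      · subst hmj
        simp only [Pi.sub_apply, Pi.smul_apply, smul_eq_mul]
        field_simp
        ring
      · have hmj' := hmj
        rw [Fin.ext_iff] at hmj'
        have e1 : w a m = 0 := by
          apply hN
          simp only [Ne, lne] at hm ⊢
          rcases h1 with h1 | h1
          · rw [h1.1] at hmj; left; exact ⟨hmj, by omega⟩
          · left
            have : m ≠ l := by
              rintro rfl
              simp at hm
              omega
            refine ⟨this, ?_⟩
            have := hm.resolve_right (fun h => this h.1)
            omega
        have e2 : w b m = 0 := by
          apply hN
          simp only [Ne, lne] at hm ⊢
          rcases h2 with h2 | h2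
          · rw [h2.1] at hmj; left; exact ⟨hmj, by omega⟩
          · left
            have : m ≠ l := by
              rintro rfl
              simp at hm
              omega
            refine ⟨this, ?_⟩
            have := hm.resolve_right (fun h => this h.1)
            omega
        simp [e1, e2])
    omega
  have hinj : Function.Injective j := by
    intro a b hab
    rcases lt_trichotomy a b with h | h | h
    · exact absurd hab (hne a b h)
    · exact h
    · exact absurd hab.symm (hne b a h)
  have hsurj : Function.Surjective j := Finite.injective_iff_surjective.1 hinj
  have heven : ∀ a b : Fin n, a < b → t a % 2 = 1 → t a / 2 ≤ t b / 2 → t b % 2 = 0 := by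
    intro a b hab h1 h2
    by_contra h3
    have h4 : t b % 2 = 1 := by omega
    have := hsub a b hab 1 (t b / 2 * 2) (by
      rw [mem_NN]
      intro m hm
      by_cases hml : m = l
      · subst hml
        simp [hodd a h1, hodd b h4]
      · have hml' := hml
        rw [← lne] at hml'
        have e1 : w a m = 0 := by
          apply hN
          omega
        have e2 : w b m = 0 := by
          apply hN
          omega
        simp [e1, e2])
    omega
  let b : Fin n → Bool := fun i => decide (j i ≠ l ∧ t i % 2 = 1)
  have hbt : ∀ i, b i = true ↔ (j i ≠ l ∧ t i % 2 = 1) := fun i => by simp [b]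
  have hbf : ∀ i, b i = false ↔ ¬ (j i ≠ l ∧ t i % 2 = 1) := fun i => by
    rw [← hbt]; simp
  let v : Fin n → (Fin n → ℂ) := fun i => if b i = true then hatVec n (j i) else stdVec n (j i)
  let e : Fin n ≃ Fin n := Equiv.ofBijective j ⟨hinj, hsurj⟩
  have he : ∀ i, e.symm (j i) = i := fun i => e.symm_apply_apply i
  have he' : ∀ m, j (e.symm m) = m := fun m => e.apply_symm_apply m
  let g : Matrix (Fin n) (Fin n) ℂ := fun m q =>
    if q = l then (if m = l then 1 else 0) else (if m = l then 0 else w (e.symm q) m)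
  have gtri : ∀ m q : Fin n, (q : ℕ) < (m : ℕ) → g m q = 0 := by
    intro m q hqm
    have hm := m.isLt
    have hq : q ≠ l := by rw [Ne, Fin.ext_iff]; omega
    simp only [g, if_neg hq]
    split_ifs with hml
    · rfl
    · apply hN
      left
      rw [Ne, lne]
      refine ⟨hml, ?_⟩
      have h1 := hj (e.symm q)
      rw [he'] at h1
      rcases h1 with h1 | h1
      · exact absurd h1.1 hq
      · omega
  have gdiag : ∀ m, g m m ≠ 0 := by
    intro m
    by_cases hm : m = l
    · simp [g, hm]
    · simp only [g, if_neg hm]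
      have := hwj (e.symm m)
      rwa [he'] at this
  have gB : memB n g := by
    refine ⟨?_, gtri, ?_, ?_⟩
    · rw [Matrix.isUnit_iff_isUnit_det, Matrix.det_of_upperTriangular (fun a b h => gtri a b h)]
      rw [isUnit_iff_ne_zero, Finset.prod_ne_zero_iff]
      exact fun m _ => gdiag m
    · intro i hi
      rw [lne] at hi
      simp [g, hi]
    · intro i k hk hi
      rw [lne] at hk
      rw [Ne, lne] at hi
      simp [g, hk, hi]
  have gstd : ∀ q m, Matrix.toLin' g (stdVec n q) m = g m q := by
    intro q m
    simp [stdVec, Matrix.toLin'_apply]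
  have hhat : ∀ q, hatVec n q = stdVec n q + stdVec n l := by
    intro q
    funext m
    simp [hatVec_apply l hl, stdVec_apply]
  have gv : ∀ i, Matrix.toLin' g (v i) = w i := by
    intro i
    funext m
    by_cases hil : j i = l
    · have hbi : b i = false := by rw [hbf]; simp [hil]
      have hti : t i = 1 := by
        rcases hj i with h | h
        · exact h.2
        · exact absurd hil h.1
      simp only [v, hbi]
      rw [if_neg (by simp), gstd, hil]
      simp only [g, if_true]
      split_ifs with hm
      · rw [hm, hodd i (by omega)]
      · symm
        apply hN
        left
        rw [Ne, lne]
        exact ⟨hm, by omega⟩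
    · have hg1 : g m (j i) = if m = l then 0 else w i m := by
        simp [g, hil, he]
      cases hbi : b i
      · simp only [v, hbi]
        rw [if_neg (by simp), gstd, hg1]
        split_ifs with hm
        · symm
          apply hN
          right
          rw [lne]
          refine ⟨hm, ?_⟩
          have := (hbf i).1 hbi
          push Not at this
          have := this hil
          omega
        · rfl
      · simp only [v, hbi]
        rw [if_pos trivial, hhat, map_add, Pi.add_apply, gstd, gstd, hg1]
        split_ifs with hm
        · rw [hm, hodd i ((hbt i).1 hbi).2]
          simp [g]
        · simp [g, hm]
  have hinjg := unit_inj gB.1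
  have hmap : ∀ i, (Submodule.span ℂ {u | ∃ k : Fin n, k ≤ i ∧ u = v k}).map (Matrix.toLin' g)
      = F.V i := by
    intro i
    rw [span_eq F w hw hW i, Submodule.map_span]
    congr 1
    ext u
    constructor
    · rintro ⟨_, ⟨k, hk, rfl⟩, rfl⟩
      exact ⟨k, hk, gv k⟩
    · rintro ⟨k, hk, rfl⟩
      exact ⟨v k, ⟨k, hk, rfl⟩, gv k⟩
  refine ⟨⟨fun i => Submodule.span ℂ {u | ∃ k : Fin n, k ≤ i ∧ u = v k}, ?_, ?_⟩, ?_, g, gB, hmap⟩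
  · intro i k hik
    apply Submodule.span_mono
    rintro _ ⟨q, hq, rfl⟩
    exact ⟨q, hq.trans hik, rfl⟩
  · intro i
    rw [← F.dimV i, ← hmap i]
    exact (Submodule.equivMapOfInjective _ hinjg _).finrank_eq
  · refine ⟨v, j, b, fun i => rfl, ?_, ?_, ?_, ?_⟩
    · intro i
      constructor
      · intro h
        refine ⟨?_, by simp only [v, h]; rfl⟩
        have h1 := ((hbt i).1 h).1
        have := (j i).isLt
        rw [Ne, ← lne] at h1
        omega
      · intro h
        simp only [v, h]
        rw [if_neg (by simp)]
    · obtain ⟨i, hi⟩ := hsurj l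
      refine ⟨i, ?_, by rw [hi]; exact hl⟩
      rw [hbf]; simp [hi]
    · intro i k _ hi hik
      rw [lne] at hi
      have hti : t i = 1 := by
        rcases hj i with h | h
        · exact h.2
        · exact absurd hi h.1
      have := heven i k hik (by omega) (by omega)
      rw [hbf]
      omega
    · intro i k hik hi hk
      rw [hbt] at hi hk
      by_contra h
      have h1 : (j i : ℕ) ≤ j k := not_lt.1 h
      have h2 : t i / 2 = j i + 1 := by
        rcases hj i with h | h
        · exact absurd h.1 hi.1
        · exact h.2
      have h3 : t k / 2 = j k + 1 := by
        rcases hj k with h | h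
        · exact absurd h.1 hk.1
        · exact h.2
      have := heven i k hik hi.2 (by omega)
      omega

/-- Every complete flag in `ℂⁿ` lies in the `B_{n-1}`-orbit of a unique
complete flag in standard form. -/
theorem statement16 (n : ℕ) (hn : 1 ≤ n) (F : CompleteFlag n) :
    ∃! F' : CompleteFlag n, IsStdFlag n F' ∧ flagRel n F F' := by
  obtain ⟨F', h1, h2⟩ := std_exists hn F
  exact ⟨F', ⟨h1, h2⟩, fun G hG => std_unique hG.1 h1 hG.2 h2⟩

end
end

section
/- For every ℓ ≥ 1, there is a bijection between SPIL(ℓ) and the set of SO(2ℓ)-flags in standard form; in particular, the number of SO(2ℓ)-flags in standard form equals |SPIL(ℓ)|. -/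
open scoped BigOperators

noncomputable section

/-- A signed list on the finite set `A` of positive integers: a nonempty finite sequence of
nonzero integers whose absolute values are pairwise distinct and lie in `A`, and whose last
entry is positive. -/
def IsSignedList (A : Finset ℕ) (l : List ℤ) : Prop :=
  l ≠ [] ∧ (∀ x ∈ l, x ≠ 0 ∧ x.natAbs ∈ A) ∧ (l.map Int.natAbs).Nodup ∧
    0 < l.getLastD 0

/-- `P` is a signed partition into lists (SPIL) of the finite set `A` of positive integers. -/
def IsSPIL (A : Finset ℕ) (P : Finset (List ℤ)) : Prop :=
  (∀ l ∈ P, IsSignedList A l) ∧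
  (∀ l ∈ P, ∀ l' ∈ P, l ≠ l' →
    Disjoint (l.map Int.natAbs).toFinset (l'.map Int.natAbs).toFinset) ∧
  P.biUnion (fun l => (l.map Int.natAbs).toFinset) = A

/-- `|SPIL(ℓ)|`: the number of signed partitions into lists of `{1, …, ℓ}`. -/
def spilCount (ℓ : ℕ) : ℕ := Set.ncard {P : Finset (List ℤ) | IsSPIL (Finset.Icc 1 ℓ) P}

/-- The symmetric bilinear form `β(x, y) = xᵀ S y` on `ℂⁿ`, where `S` is the permutation
matrix sending `eᵢ` to `e_{n+1-i}`. -/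
def bform (n : ℕ) (x y : Fin n → ℂ) : ℂ :=
  ∑ i : Fin n, x i * y (⟨n - 1 - (i : ℕ), by have := i.isLt; omega⟩ : Fin n)

/-- Membership in `SO(n) = {g ∈ SL(n, ℂ) : β(gx, gy) = β(x, y)}`. -/
def memSO (n : ℕ) (g : Matrix (Fin n) (Fin n) ℂ) : Prop :=
  g.det = 1 ∧ ∀ x y : Fin n → ℂ, bform n (g.mulVec x) (g.mulVec y) = bform n x y

/-- Membership in the subgroup `B_{SO(2ℓ-1)}` of `SO(2ℓ)`: upper triangular elements of
`SO(2ℓ)` fixing `e_ℓ - e_{ℓ+1}` (0-indexed: indices `ℓ - 1` and `ℓ`). -/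
def memBD (ℓ : ℕ) (hl : 1 ≤ ℓ) (g : Matrix (Fin (2 * ℓ)) (Fin (2 * ℓ)) ℂ) : Prop :=
  memSO (2 * ℓ) g ∧
  (∀ i j : Fin (2 * ℓ), (j : ℕ) < (i : ℕ) → g i j = 0) ∧
  g.mulVec ((Pi.single (⟨ℓ - 1, by omega⟩ : Fin (2 * ℓ)) 1 :
        Fin (2 * ℓ) → ℂ) - Pi.single (⟨ℓ, by omega⟩ : Fin (2 * ℓ)) 1) =
    (Pi.single (⟨ℓ - 1, by omega⟩ : Fin (2 * ℓ)) 1 : Fin (2 * ℓ) → ℂ) -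
      Pi.single (⟨ℓ, by omega⟩ : Fin (2 * ℓ)) 1

/-- An isotropic flag of type D in `ℂ^{2ℓ}`: a chain `V₁ ⊂ ⋯ ⊂ V_{ℓ-1}` of isotropic
subspaces with `dim Vᵢ = i`. -/
structure FlagD (ℓ : ℕ) where
  V : Fin (ℓ - 1) → Submodule ℂ (Fin (2 * ℓ) → ℂ)
  mono : ∀ i j, i ≤ j → V i ≤ V j
  dimV : ∀ i, Module.finrank ℂ (V i) = (i : ℕ) + 1
  isot : ∀ i, ∀ u ∈ V i, ∀ w ∈ V i, bform (2 * ℓ) u w = 0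

/-- Two isotropic flags of type D lie in the same `B_{SO(2ℓ-1)}`-orbit. -/
def flagDRel (ℓ : ℕ) (hl : 1 ≤ ℓ) (F F' : FlagD ℓ) : Prop :=
  ∃ g, memBD ℓ hl g ∧ ∀ i, (F'.V i).map (Matrix.toLin' g) = F.V i

/-- The kinds of vectors occurring in an `SO(2ℓ)`-flag in standard form: standard basis
vectors `e` (0-indexed by `Fin (2ℓ)`), hat vectors `êⱼ = e₋ⱼ + e₋ₗ` and tilde vectors
`ẽⱼ = e₋ⱼ + eₗ` (for `1 ≤ j ≤ ℓ - 1`, where `e₋ⱼ := e_{2ℓ+1-j}` in 1-indexed notation). -/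
inductive DKind (ℓ : ℕ) where
  | std (j : Fin (2 * ℓ))
  | hat (j : ℕ)
  | tilde (j : ℕ)

/-- The vector in `ℂ^{2ℓ}` corresponding to a `DKind` (0-indexed: `eᵢ` is index `i - 1`,
`e₋ⱼ` is index `2ℓ - j`, `eₗ` is index `ℓ - 1` and `e₋ₗ` is index `ℓ`). -/
def dvec (ℓ : ℕ) : DKind ℓ → (Fin (2 * ℓ) → ℂ)
  | .std j => Pi.single j 1
  | .hat j =>
      if h : 1 ≤ j ∧ j < ℓ then
        Pi.single (⟨2 * ℓ - j, by omega⟩ : Fin (2 * ℓ)) 1 +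
          Pi.single (⟨ℓ, by omega⟩ : Fin (2 * ℓ)) 1
      else 0
  | .tilde j =>
      if h : 1 ≤ j ∧ j < ℓ then
        Pi.single (⟨2 * ℓ - j, by omega⟩ : Fin (2 * ℓ)) 1 +
          Pi.single (⟨ℓ - 1, by omega⟩ : Fin (2 * ℓ)) 1
      else 0

/-- An isotropic flag of type D in `ℂ^{2ℓ}` is an `SO(2ℓ)`-flag in standard form. -/
def IsStdFlagD (ℓ : ℕ) (F : FlagD ℓ) : Prop :=
  ∃ c : Fin (ℓ - 1) → DKind ℓ,
    (∀ i, F.V i = Submodule.span ℂ {w | ∃ k, k ≤ i ∧ w = dvec ℓ (c k)}) ∧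
    (∀ (i : Fin (ℓ - 1)) (j : ℕ),
      (c i = DKind.hat j ∨ c i = DKind.tilde j) → 1 ≤ j ∧ j < ℓ) ∧
    (∀ i k : Fin (ℓ - 1), i < k →
      (c i = DKind.std (⟨ℓ - 1, by have := i.isLt; omega⟩ : Fin (2 * ℓ)) ∨
        c i = DKind.std (⟨ℓ, by have := i.isLt; omega⟩ : Fin (2 * ℓ))) →
      ∃ j, c k = DKind.std j) ∧
    (∀ (i : Fin (ℓ - 1)) (j : ℕ), c i = DKind.tilde j →
      ∃ k : Fin (ℓ - 1),
        c k = DKind.std (⟨ℓ - 1, by have := i.isLt; omega⟩ : Fin (2 * ℓ))) ∧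
    (∀ i k : Fin (ℓ - 1), i < k → ∀ ji jk : ℕ,
      ((c i = DKind.hat ji ∧ c k = DKind.hat jk) ∨
        (c i = DKind.tilde ji ∧ c k = DKind.tilde jk)) → ji < jk) ∧
    (∀ (i k : Fin (ℓ - 1)) (j : ℕ) (h1 : 1 ≤ j) (h2 : j < ℓ),
      (c i = DKind.hat j ∨ c i = DKind.tilde j) →
      c k ≠ DKind.std (⟨2 * ℓ - j, by omega⟩ : Fin (2 * ℓ)))


/-! ### Combinatorial part: SPILs and decorated words -/

def lkey (ℓ : ℕ) (L : List ℤ) : ℕ :=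
  if ℓ ∈ L.map Int.natAbs then ℓ + 1 else (L.getLastD 0).natAbs

def OQ (ℓ : ℕ) (Q : List (List ℤ)) : Prop :=
  (∀ L ∈ Q, L ≠ [] ∧ 0 < L.getLastD 0) ∧ (Q.flatten.map Int.natAbs).Nodup ∧
  (Q.flatten.map Int.natAbs).toFinset = Finset.Icc 1 ℓ ∧
  Q.Pairwise (fun a b => lkey ℓ a < lkey ℓ b)

def wrel (ℓ : ℕ) (a b : ℤ × Bool) : Prop :=
  b.2 = true → a.1.natAbs < ℓ ∧ (a.2 = true → a.1.natAbs < b.1.natAbs)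

def IsW (ℓ : ℕ) (u : List (ℤ × Bool)) : Prop :=
  u.length = ℓ - 1 ∧ (∀ a ∈ u, 1 ≤ a.1.natAbs ∧ a.1.natAbs ≤ ℓ) ∧
  (∀ a ∈ u, a.2 = true → a.1 < 0 ∧ a.1.natAbs < ℓ) ∧
  (u.map (fun a => a.1.natAbs)).Nodup ∧ u.Pairwise (wrel ℓ)

def lseg (L : List ℤ) : List (ℤ × Bool) :=
  L.dropLast.map (fun x => (x, false)) ++ [(-(L.getLastD 0), true)]

def lenc (Q : List (List ℤ)) : List (ℤ × Bool) := Q.flatMap lseg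

theorem lseg_cons_cons (x y : ℤ) (L : List ℤ) :
    lseg (x :: y :: L) = (x, false) :: lseg (y :: L) := by
  simp [lseg]

theorem lseg_single (x : ℤ) : lseg [x] = [(-x, true)] := by simp [lseg]

theorem lseg_abs (L : List ℤ) (h : L ≠ []) :
    (lseg L).map (fun a => a.1.natAbs) = L.map Int.natAbs := by
  induction L with
  | nil => exact absurd rfl h
  | cons x L ih =>
    cases L with
    | nil => simp [lseg]
    | cons y L => rw [lseg_cons_cons, List.map_cons, ih (by simp)]; rfl

theorem lenc_abs (Q : List (List ℤ)) (h : ∀ L ∈ Q, L ≠ []) :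
    (lenc Q).map (fun a => a.1.natAbs) = Q.flatten.map Int.natAbs := by
  induction Q with
  | nil => rfl
  | cons L Q ih =>
    have h1 := lseg_abs L (h L (by simp))
    have h2 := ih (fun L hL => h L (by simp [hL]))
    simp only [lenc, List.flatMap_cons, List.flatten_cons, List.map_append] at *
    rw [h1, h2]

theorem lseg_append_inj (L L' : List ℤ) (h : L ≠ []) (h' : L' ≠ []) (w w' : List (ℤ × Bool))
    (he : lseg L ++ w = lseg L' ++ w') : L = L' ∧ w = w' := by
  induction L generalizing L' with
  | nil => exact absurd rfl h
  | cons x L ih =>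
    rcases L' with _ | ⟨x', L'⟩
    · exact absurd rfl h'
    rcases L with _ | ⟨y, L⟩ <;> rcases L' with _ | ⟨y', L'⟩
    · simpa [lseg] using he
    · simp [lseg] at he
    · simp [lseg] at he
    · rw [lseg_cons_cons, lseg_cons_cons, List.cons_append, List.cons_append] at he
      injection he with h1 h2
      injection h1 with h1 _
      obtain ⟨h3, h4⟩ := ih (y' :: L') (by simp) (by simp) h2
      rw [h1, h3, h4]; simp

theorem lenc_inj (Q Q' : List (List ℤ)) (h : ∀ L ∈ Q, L ≠ []) (h' : ∀ L ∈ Q', L ≠ [])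
    (he : lenc Q = lenc Q') : Q = Q' := by
  induction Q generalizing Q' with
  | nil =>
    cases Q' with
    | nil => rfl
    | cons L Q => simp [lenc, lseg] at he
  | cons L Q ih =>
    cases Q' with
    | nil => simp [lenc, lseg] at he
    | cons L' Q' =>
      simp only [lenc, List.flatMap_cons] at he
      obtain ⟨h1, h2⟩ := lseg_append_inj L L' (h L (by simp)) (h' L' (by simp)) _ _ he
      rw [h1, ih Q' (fun L hL => h L (by simp [hL])) (fun L hL => h' L (by simp [hL])) h2]

theorem lenc_surj (u : List (ℤ × Bool)) (m : ℤ) :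
    ∃ Q : List (List ℤ), Q ≠ [] ∧ (∀ L ∈ Q, L ≠ []) ∧ lenc Q = u ++ [(m, true)] := by
  induction u with
  | nil => exact ⟨[[-m]], by simp, by simp, by simp [lenc, lseg]⟩
  | cons a u ih =>
    obtain ⟨Q, h0, h1, h2⟩ := ih
    obtain ⟨x, b⟩ := a
    cases b with
    | true =>
      refine ⟨[-x] :: Q, by simp, ?_, ?_⟩
      · simpa using h1
      · simp only [lenc, List.flatMap_cons] at *
        rw [h2]; simp [lseg]
    | false =>
      obtain _ | ⟨L, Q⟩ := Q
      · exact absurd rfl h0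
      obtain _ | ⟨y, L⟩ := L
      · exact absurd rfl (h1 [] (by simp))
      refine ⟨(x :: y :: L) :: Q, by simp, ?_, ?_⟩
      · simp at h1 ⊢; exact h1
      · simp only [lenc, List.flatMap_cons, lseg_cons_cons, List.cons_append] at *
        rw [h2]

theorem lenc_append_last (Q : List (List ℤ)) (L : List ℤ) :
    lenc (Q ++ [L]) = (lenc Q ++ L.dropLast.map (fun x => (x, false))) ++
      [(-(L.getLastD 0), true)] := by
  simp [lenc, lseg]

theorem lenc_dropLast (Q : List (List ℤ)) (L : List ℤ) :
    (lenc (Q ++ [L])).dropLast = lenc Q ++ L.dropLast.map (fun x => (x, false)) := by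
  rw [lenc_append_last, List.dropLast_concat]

theorem mem_lseg_last (L : List ℤ) : (-(L.getLastD 0), true) ∈ lseg L := by simp [lseg]

theorem mem_lseg_true (L : List ℤ) (a : ℤ × Bool) (h : a ∈ lseg L) (h2 : a.2 = true) :
    a.1 = -(L.getLastD 0) := by
  simp only [lseg, List.mem_append, List.mem_map, List.mem_singleton] at h
  rcases h with ⟨x, _, rfl⟩ | rfl
  · simp at h2
  · rfl

theorem mem_lseg_abs (L : List ℤ) (h : L ≠ []) (a : ℤ × Bool) (ha : a ∈ lseg L) :
    a.1.natAbs ∈ L.map Int.natAbs := by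
  rw [← lseg_abs L h]; exact List.mem_map_of_mem (f := fun a : ℤ × Bool => a.1.natAbs) ha

theorem getLastD_mem (L : List ℤ) (h : L ≠ []) : L.getLastD 0 ∈ L := by
  rw [List.getLastD_eq_getLast?, List.getLast?_eq_some_getLast h]
  exact List.getLast_mem h

theorem eq_nil_or_append {α : Type*} (Q : List α) : Q = [] ∨ ∃ Q0 L, Q = Q0 ++ [L] := by
  rcases List.eq_nil_or_concat Q with h | ⟨a, b, h⟩
  · exact Or.inl h
  · exact Or.inr ⟨a, b, by rw [h, List.concat_eq_append]⟩

theorem OQ_nonempty (ℓ : ℕ) (hl : 1 ≤ ℓ) (Q : List (List ℤ)) (h : OQ ℓ Q) : Q ≠ [] := by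
  rintro rfl
  have := h.2.2.1
  have h1 : 1 ∈ Finset.Icc 1 ℓ := by rw [Finset.mem_Icc]; omega
  rw [← this] at h1
  simp at h1

theorem OQ_to_W (ℓ : ℕ) (hl : 1 ≤ ℓ) (Q : List (List ℤ)) (h : OQ ℓ Q) :
    IsW ℓ (lenc Q).dropLast := by
  obtain ⟨Q0, L, rfl⟩ := (eq_nil_or_append Q).resolve_left (OQ_nonempty ℓ hl Q h)
  obtain ⟨h1, h2, h3, h4⟩ := h
  have habs := lenc_abs (Q0 ++ [L]) (fun L hL => (h1 L hL).1)
  have hlen : (lenc (Q0 ++ [L])).length = ℓ := by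
    have := congrArg Finset.card h3
    rw [List.toFinset_card_of_nodup h2, ← habs] at this
    simpa using this
  have hmem : ∀ a ∈ lenc (Q0 ++ [L]), 1 ≤ a.1.natAbs ∧ a.1.natAbs ≤ ℓ := by
    intro a ha
    have : a.1.natAbs ∈ (List.map Int.natAbs (Q0 ++ [L]).flatten).toFinset := by
      rw [← habs, List.mem_toFinset]
      exact List.mem_map_of_mem (f := fun a : ℤ × Bool => a.1.natAbs) ha
    rw [h3] at this
    simpa using this
  rw [List.pairwise_append] at h4
  obtain ⟨h4, -, h5⟩ := h4
  have hsm : ∀ L' ∈ Q0, ℓ ∉ L'.map Int.natAbs := by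
    intro L' hL' hh
    have := h5 L' hL' L (by simp)
    have hL : L ≠ [] := (h1 L (by simp)).1
    have h6 : (L.getLastD 0).natAbs ≤ ℓ := by
      have h7 := hmem (-(L.getLastD 0), true) (by rw [lenc_append_last]; simp)
      simpa using h7.2
    rw [lkey, lkey, if_pos hh] at this
    split_ifs at this <;> omega
  have hsm2 : ∀ a ∈ lenc Q0, a.1.natAbs < ℓ := by
    intro a ha
    have h6 := hmem a (by simp [lenc] at ha ⊢; left; exact ha)
    simp only [lenc, List.mem_flatMap] at ha
    obtain ⟨L', hL', ha⟩ := ha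
    have := mem_lseg_abs L' (h1 L' (by simp [hL'])).1 a ha
    have h8 := hsm L' hL'
    have : a.1.natAbs ≠ ℓ := fun h => h8 (h ▸ this)
    omega
  refine ⟨by rw [List.length_dropLast, hlen], fun a ha => hmem a (List.mem_of_mem_dropLast ha),
    ?_, ?_, ?_⟩
  · rw [lenc_dropLast]
    intro a ha ht
    rw [List.mem_append] at ha
    rcases ha with ha | ha
    · refine ⟨?_, hsm2 a ha⟩
      simp only [lenc, List.mem_flatMap] at ha
      obtain ⟨L', hL', ha⟩ := ha
      have := mem_lseg_true L' a ha ht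
      have := (h1 L' (by simp [hL'])).2
      omega
    · simp only [List.mem_map] at ha
      obtain ⟨x, _, rfl⟩ := ha
      simp at ht
  · rw [← habs] at h2
    exact h2.sublist ((List.dropLast_sublist _).map _)
  · rw [lenc_dropLast, List.pairwise_append]
    refine ⟨?_, ?_, ?_⟩
    · rw [lenc, List.pairwise_flatMap]
      constructor
      · intro L' hL'
        rw [lseg, List.pairwise_append]
        refine ⟨?_, by simp, ?_⟩
        · rw [List.pairwise_map]
          exact List.pairwise_of_forall (by intro x y; simp [wrel])
        · intro a ha b hb _
          refine ⟨hsm2 a ?_, ?_⟩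
          · rw [lenc, List.mem_flatMap]
            exact ⟨L', hL', by rw [lseg, List.mem_append]; exact Or.inl ha⟩
          · intro ht
            simp only [List.mem_map] at ha
            obtain ⟨x, _, rfl⟩ := ha
            simp at ht
      · refine h4.imp_of_mem ?_
        intro L1 L2 hL1 hL2 hk a ha b hb hbt
        refine ⟨hsm2 a ?_, ?_⟩
        · rw [lenc, List.mem_flatMap]
          exact ⟨L1, hL1, ha⟩
        · intro hat
          rw [lkey, lkey, if_neg (hsm L1 hL1), if_neg (hsm L2 hL2)] at hk
          rw [mem_lseg_true L1 a ha hat, mem_lseg_true L2 b hb hbt]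
          simpa using hk
    · rw [List.pairwise_map]
      exact List.pairwise_of_forall (by intro x y; simp [wrel])
    · intro a ha b hb hbt
      simp only [List.mem_map] at hb
      obtain ⟨x, _, rfl⟩ := hb
      simp at hbt

theorem W_missing (ℓ : ℕ) (hl : 1 ≤ ℓ) (u : List (ℤ × Bool)) (h : IsW ℓ u) :
    ∃ m : ℕ, Finset.Icc 1 ℓ \ (u.map (fun a => a.1.natAbs)).toFinset = {m} := by
  rw [← Finset.card_eq_one, Finset.card_sdiff_of_subset, List.toFinset_card_of_nodup h.2.2.2.1]
  · simp [h.1]; omega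
  · intro x hx
    simp only [List.mem_toFinset, List.mem_map] at hx
    obtain ⟨a, ha, rfl⟩ := hx
    simpa using h.2.1 a ha

theorem W_to_OQ (ℓ : ℕ) (hl : 1 ≤ ℓ) (u : List (ℤ × Bool)) (h : IsW ℓ u) :
    ∃ Q, OQ ℓ Q ∧ (lenc Q).dropLast = u := by
  obtain ⟨m, hm⟩ := W_missing ℓ hl u h
  obtain ⟨Q, hQ0, hQ1, hQ2⟩ := lenc_surj u (-(m : ℤ))
  refine ⟨Q, ?_, by rw [hQ2, List.dropLast_concat]⟩
  have hm' : m ∈ Finset.Icc 1 ℓ \ (u.map (fun a => a.1.natAbs)).toFinset := by rw [hm]; simp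
  rw [Finset.mem_sdiff, Finset.mem_Icc, List.mem_toFinset] at hm'
  obtain ⟨hm1, hm2⟩ := hm'
  have habs := lenc_abs Q hQ1
  obtain ⟨w1, w2, w3, w4, w5⟩ := h
  have hpos : ∀ L ∈ Q, 0 < L.getLastD 0 := by
    intro L hL
    have : (-(L.getLastD 0), true) ∈ u ++ [(-(m : ℤ), true)] := by
      rw [← hQ2, lenc, List.mem_flatMap]; exact ⟨L, hL, mem_lseg_last L⟩
    rw [List.mem_append, List.mem_singleton] at this
    rcases this with h | h
    · have := (w3 _ h rfl).1; simp only at this; omega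
    · injection h with h _; omega
  have hnd : (Q.flatten.map Int.natAbs).Nodup := by
    rw [← habs, hQ2, List.map_append, List.nodup_append]
    refine ⟨w4, by simp, ?_⟩
    intro a ha b hb
    simp at hb
    rintro rfl
    rw [hb] at ha
    exact hm2 ha
  have hfin : (Q.flatten.map Int.natAbs).toFinset = Finset.Icc 1 ℓ := by
    rw [← habs, hQ2, List.map_append, List.toFinset_append]
    ext x
    have hx := Finset.ext_iff.1 hm x
    simp only [Finset.mem_sdiff, Finset.mem_Icc, List.mem_toFinset, Finset.mem_singleton] at hx
    simp only [Finset.mem_union, List.mem_toFinset, Finset.mem_Icc, List.map_cons, List.map_nil,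
      List.mem_singleton, Int.natAbs_neg, Int.natAbs_natCast]
    constructor
    · rintro (h | rfl)
      · simp only [List.mem_map] at h
        obtain ⟨a, ha, rfl⟩ := h
        exact w2 a ha
      · exact hm1
    · intro h
      by_cases h' : x ∈ u.map (fun a => a.1.natAbs)
      · exact Or.inl h'
      · exact Or.inr (hx.1 ⟨h, h'⟩)
  refine ⟨fun L hL => ⟨hQ1 L hL, hpos L hL⟩, hnd, hfin, ?_⟩
  obtain ⟨Q0, L, rfl⟩ := (eq_nil_or_append Q).resolve_left hQ0
  have hu : u = lenc Q0 ++ L.dropLast.map (fun x => (x, false)) := by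
    rw [← lenc_dropLast, hQ2, List.dropLast_concat]
  have w5' := w5
  rw [hu, List.pairwise_append] at w5'
  obtain ⟨w6, -, -⟩ := w5'
  rw [lenc, List.pairwise_flatMap] at w6
  obtain ⟨w6, w7⟩ := w6
  have hsm : ∀ L' ∈ Q0, ℓ ∉ L'.map Int.natAbs := by
    intro L' hL' hh
    rw [← lseg_abs L' (hQ1 L' (by simp [hL']))] at hh
    simp only [List.mem_map] at hh
    obtain ⟨a, ha, hal⟩ := hh
    have hau : a ∈ u := by
      rw [hu, List.mem_append, lenc, List.mem_flatMap]; exact Or.inl ⟨L', hL', ha⟩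
    have := w6 L' hL'
    rw [lseg, List.pairwise_append] at this
    obtain ⟨-, -, h7⟩ := this
    rw [lseg, List.mem_append] at ha
    rcases ha with ha | ha
    · have := (h7 a ha _ (List.mem_singleton_self _) rfl).1; omega
    · simp at ha
      have := (w3 a hau (by rw [ha])).2
      omega
  have hL : ℓ ∈ L.map Int.natAbs := by
    have : ℓ ∈ (List.map Int.natAbs (Q0 ++ [L]).flatten).toFinset := by
      rw [hfin]; simp; omega
    simp only [List.mem_toFinset, List.flatten_append, List.map_append, List.mem_append,
      List.map_flatten, List.mem_flatten, List.mem_map, List.flatten_singleton] at this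
    rcases this with ⟨l, ⟨L', hL', rfl⟩, hl⟩ | h
    · exact absurd hl (hsm L' hL')
    · simpa using h
  rw [List.pairwise_append]
  refine ⟨?_, by simp, ?_⟩
  · refine w7.imp_of_mem ?_
    intro L1 L2 hL1 hL2 hr
    have := (hr _ (mem_lseg_last L1) _ (mem_lseg_last L2) rfl).2 rfl
    rw [lkey, lkey, if_neg (hsm L1 hL1), if_neg (hsm L2 hL2)]
    simpa using this
  · intro L1 hL1 L2 hL2
    rw [List.mem_singleton] at hL2
    subst hL2
    rw [lkey, lkey, if_neg (hsm L1 hL1), if_pos hL]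
    have : (L1.getLastD 0).natAbs ∈ (List.map Int.natAbs (Q0 ++ [L2]).flatten).toFinset := by
      rw [List.mem_toFinset]
      apply List.mem_map_of_mem
      rw [List.mem_flatten]
      exact ⟨L1, by simp [hL1], getLastD_mem L1 (hQ1 L1 (by simp [hL1]))⟩
    rw [hfin] at this
    have := (Finset.mem_Icc.1 this).2
    omega

theorem OQ_inj (ℓ : ℕ) (hl : 1 ≤ ℓ) (Q Q' : List (List ℤ)) (h : OQ ℓ Q) (h' : OQ ℓ Q')
    (he : (lenc Q).dropLast = (lenc Q').dropLast) : Q = Q' := by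
  have key : ∀ Q, OQ ℓ Q → ∃ m : ℕ, lenc Q = (lenc Q).dropLast ++ [(-(m : ℤ), true)] ∧
      m ∈ Finset.Icc 1 ℓ \ ((lenc Q).dropLast.map (fun a => a.1.natAbs)).toFinset := by
    intro Q h
    obtain ⟨Q0, L, rfl⟩ := (eq_nil_or_append Q).resolve_left (OQ_nonempty ℓ hl Q h)
    have hp := (h.1 L (by simp)).2
    have habs := lenc_abs (Q0 ++ [L]) (fun L hL => (h.1 L hL).1)
    have e1 : lenc (Q0 ++ [L]) = (lenc (Q0 ++ [L])).dropLast ++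
        [(-(((L.getLastD 0).natAbs : ℕ) : ℤ), true)] := by
      rw [lenc_dropLast, lenc_append_last, Int.natCast_natAbs, abs_of_pos hp]
    refine ⟨(L.getLastD 0).natAbs, e1, ?_⟩
    have h2 := h.2.1
    have h3 := h.2.2.1
    rw [Finset.mem_sdiff, ← h3, ← habs]
    rw [← habs] at h2
    constructor
    · rw [e1]; simp [Int.natAbs_abs]
    · rw [e1, List.map_append, List.nodup_append] at h2
      rw [List.mem_toFinset]
      intro h5
      exact h2.2.2 _ h5 _ (by simp [Int.natAbs_abs]) rfl
  obtain ⟨m, hm1, hm2⟩ := key Q h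
  obtain ⟨m', hm1', hm2'⟩ := key Q' h'
  obtain ⟨m0, hm0⟩ := W_missing ℓ hl _ (OQ_to_W ℓ hl Q h)
  rw [hm0, Finset.mem_singleton] at hm2
  rw [← he, hm0, Finset.mem_singleton] at hm2'
  apply lenc_inj Q Q' (fun L hL => (h.1 L hL).1) (fun L hL => (h'.1 L hL).1)
  rw [hm1, hm1', he, hm2, hm2']

theorem OQ_to_SPIL (ℓ : ℕ) (Q : List (List ℤ)) (h : OQ ℓ Q) :
    IsSPIL (Finset.Icc 1 ℓ) Q.toFinset := by
  obtain ⟨h1, h2, h3, h4⟩ := h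
  have h2' := h2
  rw [List.map_flatten, List.nodup_flatten] at h2'
  obtain ⟨n1, n2⟩ := h2'
  rw [List.pairwise_map] at n2
  refine ⟨?_, ?_, ?_⟩
  · intro l hl
    rw [List.mem_toFinset] at hl
    refine ⟨(h1 l hl).1, ?_, n1 _ (List.mem_map_of_mem hl), (h1 l hl).2⟩
    intro x hx
    have : x.natAbs ∈ Finset.Icc 1 ℓ := by
      rw [← h3, List.mem_toFinset]
      apply List.mem_map_of_mem
      rw [List.mem_flatten]
      exact ⟨l, hl, hx⟩
    refine ⟨?_, this⟩
    rintro rfl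
    simp at this
  · intro l hl l' hl' hne
    rw [List.mem_toFinset] at hl hl'
    have hsym : Std.Symm (fun a b : List ℤ => List.Disjoint (a.map Int.natAbs) (b.map Int.natAbs)) :=
      ⟨fun a b h => h.symm⟩
    have := n2.forall hl hl' hne
    rwa [List.disjoint_toFinset_iff_disjoint]
  · rw [← h3]
    ext x
    simp [List.map_flatten]

theorem SPIL_to_OQ (ℓ : ℕ) (P : Finset (List ℤ)) (h : IsSPIL (Finset.Icc 1 ℓ) P) :
    ∃ Q, OQ ℓ Q ∧ Q.toFinset = P := by
  obtain ⟨h1, h2, h3⟩ := h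
  let Q := P.toList.mergeSort (fun a b => decide (lkey ℓ a ≤ lkey ℓ b))
  have hperm : Q.Perm P.toList := List.mergeSort_perm _ _
  have hmem : ∀ L, L ∈ Q ↔ L ∈ P := fun L => by rw [hperm.mem_iff, Finset.mem_toList]
  have hnd : Q.Nodup := hperm.nodup_iff.2 P.nodup_toList
  have hsort : Q.Pairwise (fun a b => lkey ℓ a ≤ lkey ℓ b) := by
    have := List.pairwise_mergeSort (le := fun a b => decide (lkey ℓ a ≤ lkey ℓ b))
      (by intro a b c; simp; omega) (by intro a b; simp; omega) P.toList
    simpa using this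
  have hlast : ∀ L ∈ P, (L.getLastD 0).natAbs ∈ L.map Int.natAbs := fun L hL =>
    List.mem_map_of_mem (getLastD_mem L (h1 L hL).1)
  have hle : ∀ L ∈ P, (L.getLastD 0).natAbs ≤ ℓ := by
    intro L hL
    have := ((h1 L hL).2.1 _ (getLastD_mem L (h1 L hL).1)).2
    exact (Finset.mem_Icc.1 this).2
  have hdis : ∀ L ∈ P, ∀ L' ∈ P, L ≠ L' → ∀ x, x ∈ L.map Int.natAbs →
      x ∈ L'.map Int.natAbs → False := by
    intro L hL L' hL' hne x hx hx'
    have := h2 L hL L' hL' hne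
    rw [List.disjoint_toFinset_iff_disjoint] at this
    exact this hx hx'
  refine ⟨Q, ⟨?_, ?_, ?_, ?_⟩, ?_⟩
  · intro L hL
    rw [hmem] at hL
    exact ⟨(h1 L hL).1, (h1 L hL).2.2.2⟩
  · rw [List.map_flatten, List.nodup_flatten]
    constructor
    · intro l hl
      rw [List.mem_map] at hl
      obtain ⟨L, hL, rfl⟩ := hl
      exact (h1 L ((hmem L).1 hL)).2.2.1
    · rw [List.pairwise_map]
      refine List.Pairwise.imp_of_mem ?_ hnd
      intro a b ha hb hab x hx hx'
      exact hdis a ((hmem a).1 ha) b ((hmem b).1 hb) hab x hx hx'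
  · rw [← h3]
    ext x
    simp [List.map_flatten, hmem]
  · refine List.Pairwise.imp_of_mem ?_ (hsort.and hnd)
    intro a b ha hb hab
    rw [hmem] at ha hb
    have hne : lkey ℓ a ≠ lkey ℓ b := by
      intro he
      have l1 := hle a ha
      have l2 := hle b hb
      have m1 := hlast a ha
      have m2 := hlast b hb
      unfold lkey at he
      split_ifs at he with c1 c2 c2
      · exact hdis a ha b hb hab.2 _ c1 c2
      · omega
      · omega
      · rw [he] at m1
        exact hdis a ha b hb hab.2 _ m1 m2
    have := hab.1
    omega
  · ext L
    rw [List.mem_toFinset, hmem]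

theorem OQ_SPIL_inj (ℓ : ℕ) (Q Q' : List (List ℤ)) (h : OQ ℓ Q) (h' : OQ ℓ Q')
    (he : Q.toFinset = Q'.toFinset) : Q = Q' := by
  have nd : ∀ Q, OQ ℓ Q → Q.Nodup := fun Q h => h.2.2.2.imp (by rintro a b hab rfl; omega)
  have hp : Q.Perm Q' := List.perm_of_nodup_nodup_toFinset_eq (nd Q h) (nd Q' h') he
  refine hp.eq_of_pairwise ?_ h.2.2.2 h'.2.2.2
  intro a b _ _ h1 h2
  omega

theorem spil_equiv_W (ℓ : ℕ) (hl : 1 ≤ ℓ) :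
    Nonempty ({P : Finset (List ℤ) // IsSPIL (Finset.Icc 1 ℓ) P} ≃
      {u : List (ℤ × Bool) // IsW ℓ u}) := by
  let f : {Q // OQ ℓ Q} → {P : Finset (List ℤ) // IsSPIL (Finset.Icc 1 ℓ) P} :=
    fun Q => ⟨Q.1.toFinset, OQ_to_SPIL ℓ Q.1 Q.2⟩
  let g : {Q // OQ ℓ Q} → {u : List (ℤ × Bool) // IsW ℓ u} :=
    fun Q => ⟨(lenc Q.1).dropLast, OQ_to_W ℓ hl Q.1 Q.2⟩
  have hf : Function.Bijective f := by
    constructor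
    · intro a b hab
      exact Subtype.ext (OQ_SPIL_inj ℓ _ _ a.2 b.2 (congrArg Subtype.val hab))
    · rintro ⟨P, hP⟩
      obtain ⟨Q, hQ, rfl⟩ := SPIL_to_OQ ℓ P hP
      exact ⟨⟨Q, hQ⟩, rfl⟩
  have hg : Function.Bijective g := by
    constructor
    · intro a b hab
      exact Subtype.ext (OQ_inj ℓ hl _ _ a.2 b.2 (congrArg Subtype.val hab))
    · rintro ⟨u, hu⟩
      obtain ⟨Q, hQ, rfl⟩ := W_to_OQ ℓ hl u hu
      exact ⟨⟨Q, hQ⟩, rfl⟩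
  exact ⟨(Equiv.ofBijective f hf).symm.trans (Equiv.ofBijective g hg)⟩


/-! ### Linear algebra part: decorated words and flags -/

def sv (ℓ : ℕ) (p : Fin (2 * ℓ)) : ℤ := if (p : ℕ) < ℓ then (p : ℤ) + 1 else (p : ℤ) - 2 * ℓ

theorem sv_range (ℓ : ℕ) (p : Fin (2 * ℓ)) : 1 ≤ (sv ℓ p).natAbs ∧ (sv ℓ p).natAbs ≤ ℓ := by
  have := p.isLt
  unfold sv; split_ifs <;> omega

theorem sv_inj (ℓ : ℕ) (p q : Fin (2 * ℓ)) (h : sv ℓ p = sv ℓ q) : p = q := by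
  have := p.isLt
  have := q.isLt
  unfold sv at h
  apply Fin.ext
  split_ifs at h <;> omega

theorem sv_surj (ℓ : ℕ) (x : ℤ) (h : 1 ≤ x.natAbs ∧ x.natAbs ≤ ℓ) : ∃ p, sv ℓ p = x := by
  by_cases hx : 0 < x
  · refine ⟨⟨(x - 1).toNat, by omega⟩, ?_⟩
    unfold sv; split_ifs with h1 <;> simp only at * <;> omega
  · refine ⟨⟨(2 * ℓ + x).toNat, by omega⟩, ?_⟩
    unfold sv; split_ifs with h1 <;> simp only at * <;> omega

theorem sv_rev (ℓ : ℕ) (p : Fin (2 * ℓ)) (h : 2 * ℓ - 1 - (p : ℕ) < 2 * ℓ) :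
    sv ℓ ⟨2 * ℓ - 1 - (p : ℕ), h⟩ = - sv ℓ p := by
  have := p.isLt
  unfold sv
  simp only
  split_ifs <;> omega

def Ev (ℓ : ℕ) (x : ℤ) : Fin (2 * ℓ) → ℂ := fun p => if sv ℓ p = x then 1 else 0

theorem Ev_sv (ℓ : ℕ) (p : Fin (2 * ℓ)) : Ev ℓ (sv ℓ p) = Pi.single p 1 := by
  ext q
  unfold Ev
  by_cases h : q = p
  · subst h; simp
  · rw [if_neg (fun h' => h (sv_inj ℓ _ _ h')), Pi.single_eq_of_ne h]

theorem Ev_zero (ℓ : ℕ) : Ev ℓ 0 = 0 := by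
  ext q
  have := sv_range ℓ q
  unfold Ev
  rw [if_neg (by intro h; rw [h] at this; simp at this)]; rfl

theorem bform_add_left (n : ℕ) (x y z : Fin n → ℂ) :
    bform n (x + y) z = bform n x z + bform n y z := by
  simp [bform, add_mul, Finset.sum_add_distrib]

theorem bform_add_right (n : ℕ) (x y z : Fin n → ℂ) :
    bform n x (y + z) = bform n x y + bform n x z := by
  simp [bform, mul_add, Finset.sum_add_distrib]

theorem bform_smul_left (n : ℕ) (a : ℂ) (x z : Fin n → ℂ) :
    bform n (a • x) z = a * bform n x z := by
  simp [bform, Finset.mul_sum, mul_assoc]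

theorem bform_smul_right (n : ℕ) (a : ℂ) (x z : Fin n → ℂ) :
    bform n x (a • z) = a * bform n x z := by
  simp only [bform, Finset.mul_sum, Pi.smul_apply, smul_eq_mul]
  exact Finset.sum_congr rfl (fun i _ => by ring)

theorem bform_zero_left (n : ℕ) (z : Fin n → ℂ) : bform n 0 z = 0 := by simp [bform]
theorem bform_zero_right (n : ℕ) (z : Fin n → ℂ) : bform n z 0 = 0 := by simp [bform]

theorem bform_span (n : ℕ) (S : Set (Fin n → ℂ)) (h : ∀ a ∈ S, ∀ b ∈ S, bform n a b = 0)
    (u w : Fin n → ℂ) (hu : u ∈ Submodule.span ℂ S) (hw : w ∈ Submodule.span ℂ S) :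
    bform n u w = 0 := by
  induction hu using Submodule.span_induction with
  | mem a ha =>
    induction hw using Submodule.span_induction with
    | mem b hb => exact h a ha b hb
    | zero => exact bform_zero_right n _
    | add x y _ _ hx hy => rw [bform_add_right, hx, hy, add_zero]
    | smul c x _ hx => rw [bform_smul_right, hx, mul_zero]
  | zero => exact bform_zero_left n _
  | add x y _ _ hx hy => rw [bform_add_left, hx, hy, add_zero]
  | smul c x _ hx => rw [bform_smul_left, hx, mul_zero]

def opp (ℓ : ℕ) (x y : ℤ) : Prop := x = -y ∧ 1 ≤ x.natAbs ∧ x.natAbs ≤ ℓ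

open Classical in
theorem bform_Ev (ℓ : ℕ) (x y : ℤ) :
    bform (2 * ℓ) (Ev ℓ x) (Ev ℓ y) =
      if opp ℓ x y then 1 else 0 := by
  unfold bform Ev
  simp only [sv_rev]
  split_ifs with h
  · obtain ⟨p, hp⟩ := sv_surj ℓ x h.2
    rw [Finset.sum_eq_single p]
    · rw [if_pos hp, if_pos (by have := h.1; omega)]; simp
    · intro q _ hq
      rw [if_neg (fun h' => hq (sv_inj ℓ _ _ (h'.trans hp.symm))), zero_mul]
    · simp
  · apply Finset.sum_eq_zero
    intro q _
    have := sv_range ℓ q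
    split_ifs with h1 h2
    · exact absurd ⟨by omega, by rw [← h1]; exact this⟩ h
    all_goals simp

open Classical in
theorem bform_pair (ℓ : ℕ) (x d y e : ℤ) :
    bform (2 * ℓ) (Ev ℓ x + Ev ℓ d) (Ev ℓ y + Ev ℓ e) = 0 ↔
      ¬ opp ℓ x y ∧ ¬ opp ℓ x e ∧ ¬ opp ℓ d y ∧ ¬ opp ℓ d e := by
  rw [bform_add_left, bform_add_right, bform_add_right, bform_Ev, bform_Ev, bform_Ev, bform_Ev]
  by_cases h1 : opp ℓ x y <;> by_cases h2 : opp ℓ x e <;> by_cases h3 : opp ℓ d y <;>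
    by_cases h4 : opp ℓ d e <;> simp [h1, h2, h3, h4] <;> norm_num

/-- numerical data of a flag: `v_i = E x_i + E d_i`. -/
structure Good (ℓ : ℕ) (x d : Fin (ℓ - 1) → ℤ) : Prop where
  rng : ∀ i, 1 ≤ (x i).natAbs ∧ (x i).natAbs ≤ ℓ
  dist : ∀ i k, i ≠ k → (x i).natAbs ≠ (x k).natAbs
  dval : ∀ i, d i = 0 ∨ (d i).natAbs = ℓ
  dec : ∀ i, d i ≠ 0 → ∀ k, k ≤ i → (x k).natAbs < ℓ
  iso : ∀ i k, bform (2 * ℓ) (Ev ℓ (x i) + Ev ℓ (d i)) (Ev ℓ (x k) + Ev ℓ (d k)) = 0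

def gspan (ℓ : ℕ) (x d : Fin (ℓ - 1) → ℤ) (i : Fin (ℓ - 1)) : Submodule ℂ (Fin (2 * ℓ) → ℂ) :=
  Submodule.span ℂ {w | ∃ k, k ≤ i ∧ w = Ev ℓ (x k) + Ev ℓ (d k)}

theorem mem_gspan (ℓ : ℕ) (x d : Fin (ℓ - 1) → ℤ) (i k : Fin (ℓ - 1)) (h : k ≤ i) :
    Ev ℓ (x k) + Ev ℓ (d k) ∈ gspan ℓ x d i := Submodule.subset_span ⟨k, h, rfl⟩

theorem gspan_iso {ℓ : ℕ} {x d : Fin (ℓ - 1) → ℤ} (h : Good ℓ x d) (i : Fin (ℓ - 1))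
    (u w : Fin (2 * ℓ) → ℂ) (hu : u ∈ gspan ℓ x d i) (hw : w ∈ gspan ℓ x d i) :
    bform (2 * ℓ) u w = 0 := by
  refine bform_span _ _ ?_ u w hu hw
  rintro _ ⟨k, _, rfl⟩ _ ⟨m, _, rfl⟩
  exact h.iso k m

theorem Ev_d_zero {ℓ : ℕ} (p : Fin (2 * ℓ)) (hp : (sv ℓ p).natAbs < ℓ) (e : ℤ)
    (he : e = 0 ∨ e.natAbs = ℓ) : Ev ℓ e p = 0 := by
  have := sv_range ℓ p
  unfold Ev
  rw [if_neg]
  intro h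
  rcases he with he | he
  · rw [h, he] at this; simp at this
  · rw [h] at hp; omega

theorem gspan_coord {ℓ : ℕ} {x d : Fin (ℓ - 1) → ℤ} (h : Good ℓ x d) (i : Fin (ℓ - 1))
    (p : Fin (2 * ℓ)) (hp : (sv ℓ p).natAbs < ℓ) (hx : ∀ k, k ≤ i → x k ≠ sv ℓ p)
    (w : Fin (2 * ℓ) → ℂ) (hw : w ∈ gspan ℓ x d i) : w p = 0 := by
  unfold gspan at hw
  induction hw using Submodule.span_induction with
  | mem a ha =>
    obtain ⟨k, hk, rfl⟩ := ha
    rw [Pi.add_apply, Ev_d_zero p hp _ (h.dval k), add_zero, Ev, if_neg (fun h => hx k hk h.symm)]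
  | zero => rfl
  | add x y _ _ hx hy => rw [Pi.add_apply, hx, hy, add_zero]
  | smul c x _ hx => rw [Pi.smul_apply, hx, smul_zero]

theorem gspan_zero {ℓ : ℕ} {x d : Fin (ℓ - 1) → ℤ} (h : Good ℓ x d) (i : Fin (ℓ - 1))
    (hx : ∀ k, k ≤ i → (x k).natAbs < ℓ)
    (w : Fin (2 * ℓ) → ℂ) (hw : w ∈ gspan ℓ x d i)
    (h0 : ∀ p, (sv ℓ p).natAbs < ℓ → w p = 0) : w = 0 := by
  choose p hp using fun k => sv_surj ℓ (x k) (h.rng k)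
  have key : w = ∑ k ∈ Finset.Iic i, w (p k) • (Ev ℓ (x k) + Ev ℓ (d k)) := by
    clear h0
    unfold gspan at hw
    induction hw using Submodule.span_induction with
    | mem a ha =>
      obtain ⟨m, hm, rfl⟩ := ha
      rw [Finset.sum_eq_single m]
      · rw [Pi.add_apply, Ev_d_zero (p m) (by rw [hp]; exact hx m hm) _ (h.dval m), add_zero, Ev,
          if_pos (hp m), one_smul]
      · intro k hk hkm
        rw [Finset.mem_Iic] at hk
        rw [Pi.add_apply, Ev_d_zero (p k) (by rw [hp]; exact hx k hk) _ (h.dval m), add_zero, Ev,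
          if_neg, zero_smul]
        rw [hp]
        intro h'
        exact h.dist k m hkm (by rw [h'])
      · intro h'; exact absurd (Finset.mem_Iic.2 hm) h'
    | zero => simp
    | add x y _ _ hx hy =>
      simp only [Pi.add_apply, add_smul, Finset.sum_add_distrib]
      rw [← hx, ← hy]
    | smul c x _ hx =>
      simp only [Pi.smul_apply, smul_assoc]
      rw [← Finset.smul_sum, ← hx]
  rw [key]
  apply Finset.sum_eq_zero
  intro k hk
  rw [Finset.mem_Iic] at hk
  rw [h0 (p k) (by rw [hp]; exact hx k hk), zero_smul]

theorem good_indep {ℓ : ℕ} {x d : Fin (ℓ - 1) → ℤ} (h : Good ℓ x d) :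
    LinearIndependent ℂ (fun k => Ev ℓ (x k) + Ev ℓ (d k)) := by
  rw [Fintype.linearIndependent_iff]
  intro g hg
  choose p hp using fun k => sv_surj ℓ (x k) (h.rng k)
  have hE : ∀ k m, Ev ℓ (x m) (p k) = if m = k then 1 else 0 := by
    intro k m
    unfold Ev
    rw [hp]
    by_cases hmk : m = k
    · subst hmk; simp
    · rw [if_neg hmk, if_neg]
      intro h'
      exact h.dist m k hmk (by rw [h'])
  have hc : ∀ k, ∑ m, g m * (Ev ℓ (x m) (p k) + Ev ℓ (d m) (p k)) = 0 := by
    intro k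
    have := congrFun hg (p k)
    simpa [Finset.sum_apply, mul_add] using this
  have h1 : ∀ k, (x k).natAbs < ℓ → g k = 0 := by
    intro k hk
    have := hc k
    simpa [hE, Ev_d_zero (p k) (by rw [hp]; exact hk) _ (h.dval _)] using this
  intro k
  by_cases hk : (x k).natAbs < ℓ
  · exact h1 k hk
  · have := hc k
    rw [Finset.sum_eq_single k] at this
    · have hd : d k = 0 := by
        by_contra h'
        exact hk (h.dec k h' k le_rfl)
      rw [hE, hd, Ev_zero] at this
      simpa using this
    · intro m _ hmk
      have h2 := h.dist m k hmk
      have h3 := h.rng m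
      have h4 := h.rng k
      rw [h1 m (by omega), zero_mul]
    · simp

theorem gspan_finrank {ℓ : ℕ} {x d : Fin (ℓ - 1) → ℤ} (h : Good ℓ x d) (i : Fin (ℓ - 1)) :
    Module.finrank ℂ (gspan ℓ x d i) = (i : ℕ) + 1 := by
  have h1 := (good_indep h).comp (fun k : {k // k ≤ i} => k.1) Subtype.val_injective
  have h2 := finrank_span_eq_card h1
  have h3 : Fintype.card {k // k ≤ i} = (i : ℕ) + 1 := by
    rw [Fintype.card_subtype]
    have : Finset.univ.filter (fun k => k ≤ i) = Finset.Iic i := by ext; simp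
    rw [this, Fin.card_Iic]
  rw [h3] at h2
  rw [← h2]
  unfold gspan
  refine congrArg (fun S : Set (Fin (2 * ℓ) → ℂ) => Module.finrank ℂ (Submodule.span ℂ S)) ?_
  ext w
  constructor
  · rintro ⟨k, hk, rfl⟩; exact ⟨⟨k, hk⟩, rfl⟩
  · rintro ⟨⟨k, hk⟩, rfl⟩; exact ⟨k, hk, rfl⟩

theorem good_inj_aux {ℓ : ℕ} {x d x' d' : Fin (ℓ - 1) → ℤ} (h : Good ℓ x d) (h' : Good ℓ x' d')
    (i : Fin (ℓ - 1)) (he : gspan ℓ x d i = gspan ℓ x' d' i)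
    (ih : ∀ k, k < i → x k = x' k) (hx : (x' i).natAbs < ℓ) : x i = x' i := by
  by_contra hne
  obtain ⟨p, hp⟩ := sv_surj ℓ (x' i) (h'.rng i)
  have h1 := mem_gspan ℓ x' d' i i le_rfl
  rw [← he] at h1
  have h2 := gspan_coord h i p (by rw [hp]; exact hx) ?_ _ h1
  · rw [Pi.add_apply, Ev_d_zero p (by rw [hp]; exact hx) _ (h'.dval i), Ev, if_pos hp] at h2
    simp at h2
  · intro k hk
    rw [hp]
    rcases hk.lt_or_eq with hk | rfl
    · rw [ih k hk]
      intro h3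
      exact h'.dist k i hk.ne (by rw [h3])
    · exact hne

theorem good_inj {ℓ : ℕ} {x d x' d' : Fin (ℓ - 1) → ℤ} (h : Good ℓ x d) (h' : Good ℓ x' d')
    (he : ∀ i, gspan ℓ x d i = gspan ℓ x' d' i) (i : Fin (ℓ - 1)) :
    x i = x' i ∧ d i = d' i := by
  induction i using WellFoundedLT.induction with
  | ind i ih =>
  have hxi : x i = x' i := by
    by_cases c1 : (x' i).natAbs < ℓ
    · exact good_inj_aux h h' i (he i) (fun k hk => (ih k hk).1) c1
    by_cases c2 : (x i).natAbs < ℓ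
    · exact (good_inj_aux h' h i (he i).symm (fun k hk => (ih k hk).1.symm) c2).symm
    by_contra hne
    have r := h.rng i
    have r' := h'.rng i
    have m1 := mem_gspan ℓ x d i i le_rfl
    have m2 := mem_gspan ℓ x' d' i i le_rfl
    rw [← he i] at m2
    have := gspan_iso h i _ _ m1 m2
    rw [bform_pair] at this
    exact this.1 ⟨by omega, r⟩
  refine ⟨hxi, ?_⟩
  by_contra hne
  have hsm : ∀ k, k ≤ i → (x k).natAbs < ℓ := by
    intro k hk
    by_cases c : d i = 0
    · have := h'.dec i (fun h0 => hne (by rw [c, h0])) k hk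
      rcases hk.lt_or_eq with hk | rfl
      · rwa [(ih k hk).1]
      · rwa [hxi]
    · exact h.dec i c k hk
  have m1 := mem_gspan ℓ x d i i le_rfl
  have m2 := mem_gspan ℓ x' d' i i le_rfl
  rw [← he i, ← hxi] at m2
  have m3 := Submodule.sub_mem _ m2 m1
  have h0 := gspan_zero h i hsm _ m3 (by
    intro p hp
    simp [Ev_d_zero p hp _ (h.dval i), Ev_d_zero p hp _ (h'.dval i)])
  have h1 : ∀ p, Ev ℓ (d' i) p = Ev ℓ (d i) p := by
    intro p
    have := congrFun h0 p
    simp at this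
    exact sub_eq_zero.1 this
  have hl : 1 ≤ ℓ := by have := i.isLt; omega
  by_cases c : d i = 0
  · have c' : d' i ≠ 0 := fun h0 => hne (by rw [c, h0])
    obtain ⟨p, hp⟩ := sv_surj ℓ (d' i) (by have := (h'.dval i).resolve_left c'; omega)
    have := h1 p
    rw [c, Ev_zero, Ev, if_pos hp] at this
    simp at this
  · obtain ⟨p, hp⟩ := sv_surj ℓ (d i) (by have := (h.dval i).resolve_left c; omega)
    have := h1 p
    rw [Ev, Ev, if_pos hp, if_neg (by rw [hp]; exact hne)] at this
    simp at this


structure VW (ℓ : ℕ) (u : Fin (ℓ - 1) → ℤ × Bool) : Prop where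
  rng : ∀ i, 1 ≤ (u i).1.natAbs ∧ (u i).1.natAbs ≤ ℓ
  neg : ∀ i, (u i).2 = true → (u i).1 < 0 ∧ (u i).1.natAbs < ℓ
  dist : ∀ i k, i ≠ k → (u i).1.natAbs ≠ (u k).1.natAbs
  rel : ∀ i k, i < k → wrel ℓ (u i) (u k)

theorem isW_ofFn (ℓ : ℕ) (u : Fin (ℓ - 1) → ℤ × Bool) : IsW ℓ (List.ofFn u) ↔ VW ℓ u := by
  unfold IsW
  have e : (List.ofFn u).map (fun a => a.1.natAbs) = List.ofFn (fun i => (u i).1.natAbs) := by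
    rw [List.map_ofFn]; rfl
  rw [e, List.nodup_ofFn, List.pairwise_ofFn]
  simp only [List.length_ofFn, List.forall_mem_ofFn_iff, true_and]
  constructor
  · rintro ⟨h1, h2, h3, h4⟩
    exact ⟨h1, h2, fun i k hik h => hik (h3 h), fun i k hik => h4 hik⟩
  · intro h
    refine ⟨h.rng, h.neg, ?_, fun i k hik => h.rel i k hik⟩
    intro i k hik
    by_contra hne
    exact h.dist i k hne hik

theorem W_equiv_VW (ℓ : ℕ) :
    Nonempty ({u : Fin (ℓ - 1) → ℤ × Bool // VW ℓ u} ≃ {u : List (ℤ × Bool) // IsW ℓ u}) := by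
  refine ⟨Equiv.ofBijective (fun u => ⟨List.ofFn u.1, (isW_ofFn ℓ u.1).2 u.2⟩) ⟨?_, ?_⟩⟩
  · intro a b hab
    exact Subtype.ext (List.ofFn_injective (congrArg Subtype.val hab))
  · rintro ⟨u, hu⟩
    have hlen := hu.1
    have e : List.ofFn (fun i : Fin (ℓ - 1) => u.get (i.cast hlen.symm)) = u := by
      apply List.ext_get
      · simp [hlen]
      · intro n h1 h2; simp
    refine ⟨⟨_, (isW_ofFn ℓ _).1 (by rw [e]; exact hu)⟩, Subtype.ext e⟩

open Classical in
def dOf (ℓ : ℕ) (u : Fin (ℓ - 1) → ℤ × Bool) (i : Fin (ℓ - 1)) : ℤ :=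
  if (u i).2 = true then (if ∃ k, (u k).1 = ℓ then (ℓ : ℤ) else -(ℓ : ℤ)) else 0

theorem dOf_ne (ℓ : ℕ) (hl : 1 ≤ ℓ) (u : Fin (ℓ - 1) → ℤ × Bool) (i : Fin (ℓ - 1)) :
    dOf ℓ u i ≠ 0 ↔ (u i).2 = true := by
  unfold dOf
  split_ifs with h1 h2
  · exact iff_of_true (by omega) h1
  · exact iff_of_true (by omega) h1
  · exact iff_of_false (by simp) h1

theorem VW_good {ℓ : ℕ} {u : Fin (ℓ - 1) → ℤ × Bool} (h : VW ℓ u) :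
    Good ℓ (fun i => (u i).1) (dOf ℓ u) := by
  have hd : ∀ i, dOf ℓ u i = 0 ∨ ((u i).2 = true ∧ (∃ k, (u k).1 = ℓ) ∧ dOf ℓ u i = ℓ) ∨
      ((u i).2 = true ∧ (¬ ∃ k, (u k).1 = ℓ) ∧ dOf ℓ u i = -ℓ) := by
    intro i
    unfold dOf
    split_ifs with h1 h2
    · exact Or.inr (Or.inl ⟨h1, h2, rfl⟩)
    · exact Or.inr (Or.inr ⟨h1, h2, rfl⟩)
    · exact Or.inl rfl
  have hxd : ∀ i k, ¬ ((u i).1 = - dOf ℓ u k ∧ 1 ≤ (u i).1.natAbs) := by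
    rintro i k ⟨h1, h2⟩
    rcases hd k with h3 | ⟨-, ⟨m, hm⟩, h3⟩ | ⟨-, h4, h3⟩
    · omega
    · by_cases him : i = m
      · subst him; omega
      · exact h.dist i m him (by omega)
    · exact h4 ⟨i, by omega⟩
  refine ⟨h.rng, h.dist, ?_, ?_, ?_⟩
  · intro i
    rcases hd i with h | ⟨-, -, h⟩ | ⟨-, -, h⟩
    · exact Or.inl h
    · right; omega
    · right; omega
  · intro i hi k hk
    have ht : (u i).2 = true := by
      rcases hd i with h | ⟨h, -, -⟩ | ⟨h, -, -⟩
      · exact absurd h hi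
      · exact h
      · exact h
    rcases hk.lt_or_eq with hk | rfl
    · exact (h.rel k i hk ht).1
    · exact (h.neg k ht).2
  · intro i k
    rw [bform_pair]
    refine ⟨?_, ?_, ?_, ?_⟩
    · rintro ⟨h1, h2, -⟩
      by_cases hik : i = k
      · subst hik; omega
      · exact h.dist i k hik (by omega)
    · rintro ⟨h1, h2, -⟩
      exact hxd i k ⟨h1, h2⟩
    · rintro ⟨h1, h2, -⟩
      exact hxd k i ⟨by omega, by omega⟩
    · rintro ⟨h1, h2, -⟩
      rcases hd i with h3 | ⟨-, h4, h3⟩ | ⟨-, h4, h3⟩ <;>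
      rcases hd k with h5 | ⟨-, h6, h5⟩ | ⟨-, h6, h5⟩
      all_goals first | omega | exact h4 h6 | exact h6 h4

def gflag {ℓ : ℕ} {x d : Fin (ℓ - 1) → ℤ} (h : Good ℓ x d) : FlagD ℓ where
  V := gspan ℓ x d
  mono := fun i j hij => Submodule.span_mono (by
    rintro w ⟨k, hk, rfl⟩; exact ⟨k, hk.trans hij, rfl⟩)
  dimV := gspan_finrank h
  isot := fun i u hu w hw => gspan_iso h i u w hu hw

theorem flag_ext {ℓ : ℕ} (F F' : FlagD ℓ) (h : F.V = F'.V) : F = F' := by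
  cases F; cases F'; cases h; rfl

def kx (ℓ : ℕ) : DKind ℓ → ℤ × Bool
  | .std p => (sv ℓ p, false)
  | .hat j => (-(j : ℤ), true)
  | .tilde j => (-(j : ℤ), true)

def kd (ℓ : ℕ) : DKind ℓ → ℤ
  | .std _ => 0
  | .hat _ => -(ℓ : ℤ)
  | .tilde _ => (ℓ : ℤ)

theorem sv_neg (ℓ j : ℕ) (h1 : 1 ≤ j) (h2 : j ≤ ℓ) (h : 2 * ℓ - j < 2 * ℓ) :
    sv ℓ ⟨2 * ℓ - j, h⟩ = -(j : ℤ) := by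
  unfold sv; simp only; split_ifs <;> omega

theorem sv_mid (ℓ : ℕ) (h1 : 1 ≤ ℓ) (h : ℓ < 2 * ℓ) : sv ℓ ⟨ℓ, h⟩ = -(ℓ : ℤ) := by
  unfold sv; simp only; split_ifs <;> omega

theorem sv_mid' (ℓ : ℕ) (h1 : 1 ≤ ℓ) (h : ℓ - 1 < 2 * ℓ) : sv ℓ ⟨ℓ - 1, h⟩ = (ℓ : ℤ) := by
  unfold sv; simp only; split_ifs <;> omega

theorem dvec_eq (ℓ : ℕ) (c : DKind ℓ)
    (hc : ∀ j, (c = DKind.hat j ∨ c = DKind.tilde j) → 1 ≤ j ∧ j < ℓ) :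
    dvec ℓ c = Ev ℓ (kx ℓ c).1 + Ev ℓ (kd ℓ c) := by
  cases c with
  | std p => simp [dvec, kx, kd, Ev_sv, Ev_zero]
  | hat j =>
    have h := hc j (Or.inl rfl)
    simp only [dvec, dif_pos h, kx, kd]
    rw [← sv_neg ℓ j h.1 h.2.le (by omega), ← sv_mid ℓ (by omega) (by omega), Ev_sv, Ev_sv]
  | tilde j =>
    have h := hc j (Or.inr rfl)
    simp only [dvec, dif_pos h, kx, kd]
    rw [← sv_neg ℓ j h.1 h.2.le (by omega), ← sv_mid' ℓ (by omega) (by omega), Ev_sv, Ev_sv]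

theorem std_of_isStd {ℓ : ℕ} {u : Fin (ℓ - 1) → ℤ × Bool} (h : VW ℓ u) :
    IsStdFlagD ℓ (gflag (VW_good h)) := by
  classical
  choose p hp using fun i => sv_surj ℓ (u i).1 (h.rng i)
  let c : Fin (ℓ - 1) → DKind ℓ := fun i =>
    if (u i).2 = true then (if ∃ k, (u k).1 = ℓ then DKind.tilde (u i).1.natAbs
      else DKind.hat (u i).1.natAbs) else DKind.std (p i)
  have cstd : ∀ i q, c i = DKind.std q → (u i).2 = false ∧ sv ℓ q = (u i).1 := by
    intro i q hi
    simp only [c] at hi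
    split_ifs at hi with h1 h2
    injection hi with hi
    exact ⟨by simpa using h1, by rw [← hi]; exact hp i⟩
  have chat : ∀ i j, c i = DKind.hat j → (u i).2 = true ∧ j = (u i).1.natAbs := by
    intro i j hi
    simp only [c] at hi
    split_ifs at hi with h1 h2
    injection hi with hi
    exact ⟨h1, hi.symm⟩
  have ctil : ∀ i j, c i = DKind.tilde j →
      (u i).2 = true ∧ j = (u i).1.natAbs ∧ ∃ k, (u k).1 = ℓ := by
    intro i j hi
    simp only [c] at hi
    split_ifs at hi with h1 h2
    injection hi with hi
    exact ⟨h1, hi.symm, h2⟩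
  have cdec : ∀ i j, (c i = DKind.hat j ∨ c i = DKind.tilde j) →
      (u i).2 = true ∧ j = (u i).1.natAbs := by
    intro i j hi
    rcases hi with hi | hi
    · exact chat i j hi
    · exact ⟨(ctil i j hi).1, (ctil i j hi).2.1⟩
  have cund : ∀ i, (u i).2 = false → c i = DKind.std (p i) := by
    intro i hi; simp [c, hi]
  have ckx : ∀ i, (kx ℓ (c i)).1 = (u i).1 ∧ kd ℓ (c i) = dOf ℓ u i := by
    intro i
    simp only [c, dOf]
    split_ifs with h1 h2
    · have := (h.neg i h1).1
      exact ⟨by simp only [kx]; omega, rfl⟩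
    · have := (h.neg i h1).1
      exact ⟨by simp only [kx]; omega, rfl⟩
    · exact ⟨hp i, rfl⟩
  have cval : ∀ (i : Fin (ℓ - 1)) (j : ℕ),
      (c i = DKind.hat j ∨ c i = DKind.tilde j) → 1 ≤ j ∧ j < ℓ := by
    intro i j hij
    obtain ⟨h1, h2⟩ := cdec i j hij
    have := (h.neg i h1).2
    have := (h.rng i).1
    omega
  refine ⟨c, ?_, cval, ?_, ?_, ?_, ?_⟩
  · intro i
    change gspan ℓ _ _ i = _
    unfold gspan
    congr 1
    ext w
    constructor
    · rintro ⟨k, hk, rfl⟩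
      refine ⟨k, hk, ?_⟩
      rw [dvec_eq ℓ _ (cval k), (ckx k).1, (ckx k).2]
    · rintro ⟨k, hk, rfl⟩
      refine ⟨k, hk, ?_⟩
      rw [dvec_eq ℓ _ (cval k), (ckx k).1, (ckx k).2]
  · intro i k hik hi
    have hl : 1 ≤ ℓ := by have := i.isLt; omega
    have hx : (u i).1.natAbs = ℓ := by
      rcases hi with hi | hi
      · have := (cstd i _ hi).2
        rw [sv_mid' ℓ hl] at this
        omega
      · have := (cstd i _ hi).2
        rw [sv_mid ℓ hl] at this
        omega
    refine ⟨p k, cund k ?_⟩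
    by_contra hk
    have := (h.rel i k hik (by simpa using hk)).1
    omega
  · intro i j hi
    have hl : 1 ≤ ℓ := by have := i.isLt; omega
    obtain ⟨-, -, k, hk⟩ := ctil i j hi
    refine ⟨k, ?_⟩
    rw [cund k ?_]
    · congr 1
      apply sv_inj ℓ
      rw [hp k, hk, sv_mid' ℓ hl]
    · by_contra h1
      have := (h.neg k (by simpa using h1)).1
      omega
  · intro i k hik ji jk hh
    have : (u i).2 = true ∧ ji = (u i).1.natAbs ∧ (u k).2 = true ∧ jk = (u k).1.natAbs := by
      rcases hh with ⟨h1, h2⟩ | ⟨h1, h2⟩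
      · exact ⟨(chat _ _ h1).1, (chat _ _ h1).2, (chat _ _ h2).1, (chat _ _ h2).2⟩
      · exact ⟨(ctil _ _ h1).1, (ctil _ _ h1).2.1, (ctil _ _ h2).1, (ctil _ _ h2).2.1⟩
    obtain ⟨h1, h2, h3, h4⟩ := this
    rw [h2, h4]
    exact (h.rel i k hik h3).2 h1
  · intro i k j h1 h2 hi hk
    obtain ⟨d1, d2⟩ := cdec i j hi
    obtain ⟨d3, d4⟩ := cstd k _ hk
    rw [sv_neg ℓ j h1 h2.le] at d4
    by_cases hik : i = k
    · subst hik; rw [d1] at d3; simp at d3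
    · exact h.dist i k hik (by omega)

theorem std_surj (ℓ : ℕ) (F : FlagD ℓ) (hF : IsStdFlagD ℓ F) :
    ∃ (u : Fin (ℓ - 1) → ℤ × Bool) (h : VW ℓ u), gflag (VW_good h) = F := by
  obtain ⟨c, hV, cval, ca, cb, cc, cd⟩ := hF
  have hdv : ∀ i, dvec ℓ (c i) = Ev ℓ (kx ℓ (c i)).1 + Ev ℓ (kd ℓ (c i)) :=
    fun i => dvec_eq ℓ (c i) (cval i)
  have hmem : ∀ i k, k ≤ i → dvec ℓ (c k) ∈ F.V i := by
    intro i k hk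
    rw [hV]
    exact Submodule.subset_span ⟨k, hk, rfl⟩
  have hiso : ∀ i k, ¬ opp ℓ (kx ℓ (c i)).1 (kx ℓ (c k)).1 ∧
      ¬ opp ℓ (kx ℓ (c i)).1 (kd ℓ (c k)) ∧ ¬ opp ℓ (kd ℓ (c i)) (kx ℓ (c k)).1 ∧
      ¬ opp ℓ (kd ℓ (c i)) (kd ℓ (c k)) := by
    intro i k
    rw [← bform_pair, ← hdv, ← hdv]
    exact F.isot (max i k) _ (hmem _ _ (le_max_left _ _)) _ (hmem _ _ (le_max_right _ _))
  have hne : ∀ i k, i ≠ k → c i ≠ c k := by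
    intro i k hik hc
    have hpos : 0 < ℓ - 1 := lt_of_le_of_lt (Nat.zero_le _) i.isLt
    let t : Fin (ℓ - 1) := ⟨ℓ - 1 - 1, by omega⟩
    have hr : F.V t = Submodule.span ℂ (Set.range (fun k => dvec ℓ (c k))) := by
      rw [hV]
      congr 1
      ext w
      constructor
      · rintro ⟨k, _, rfl⟩; exact ⟨k, rfl⟩
      · rintro ⟨k, rfl⟩
        refine ⟨k, ?_, rfl⟩
        rw [Fin.le_def]
        have := k.isLt
        simp only [t]; omega
    have hdim := F.dimV t
    rw [hr] at hdim
    have hli : LinearIndependent ℂ (fun k => dvec ℓ (c k)) := by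
      rw [linearIndependent_iff_card_eq_finrank_span]
      unfold Set.finrank
      rw [hdim, Fintype.card_fin]
      simp only [t]; omega
    exact hik (hli.injective (by simp only [hc]))
  let u : Fin (ℓ - 1) → ℤ × Bool := fun i => kx ℓ (c i)
  have hrng : ∀ i, 1 ≤ (u i).1.natAbs ∧ (u i).1.natAbs ≤ ℓ := by
    intro i
    simp only [u]
    cases hc : c i with
    | std p => exact sv_range ℓ p
    | hat j => have := cval i j (Or.inl hc); simp only [kx]; omega
    | tilde j => have := cval i j (Or.inr hc); simp only [kx]; omega
  have hdec : ∀ i, (u i).2 = true → ∃ j : ℕ, 1 ≤ j ∧ j < ℓ ∧ (u i).1 = -(j : ℤ) ∧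
      (c i = DKind.hat j ∨ c i = DKind.tilde j) := by
    intro i
    simp only [u]
    cases hc : c i with
    | std p => intro h; simp [kx] at h
    | hat j =>
      intro _
      have := cval i j (Or.inl hc)
      exact ⟨j, this.1, this.2, rfl, Or.inl rfl⟩
    | tilde j =>
      intro _
      have := cval i j (Or.inr hc)
      exact ⟨j, this.1, this.2, rfl, Or.inr rfl⟩
  have hund : ∀ i, (u i).2 = false → ∃ p, c i = DKind.std p ∧ sv ℓ p = (u i).1 := by
    intro i
    simp only [u]
    cases hc : c i with
    | std p => intro _; exact ⟨p, rfl, rfl⟩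
    | hat j => intro h; simp [kx] at h
    | tilde j => intro h; simp [kx] at h
  -- hat and tilde vectors do not coexist
  have hmix : ∀ i k j j', c i = DKind.hat j → c k = DKind.tilde j' → False := by
    intro i k j j' h1 h2
    have h3 := (hiso i k).2.2.2
    have := cval i j (Or.inl h1)
    apply h3
    rw [h1, h2]
    refine ⟨?_, ?_, ?_⟩ <;> simp only [kd] <;> omega
  have hvw : VW ℓ u := by
    refine ⟨hrng, ?_, ?_, ?_⟩
    · intro i hi
      obtain ⟨j, h1, h2, h3, -⟩ := hdec i hi
      omega
    · intro i k hik habs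
      have hx : (u i).1 = (u k).1 := by
        by_contra hx
        exact (hiso i k).1 ⟨by simp only [u] at *; omega, hrng i⟩
      have aux : ∀ i k, (u i).1 = (u k).1 → (u i).2 = true → (u k).2 = false → False := by
        intro i k hx hi hk
        obtain ⟨j, h1, h2, h3, h4⟩ := hdec i hi
        obtain ⟨p, hp, hp'⟩ := hund k hk
        apply cd i k j h1 h2 h4
        rw [hp]
        congr 1
        apply sv_inj ℓ
        rw [sv_neg ℓ j h1 h2.le, hp', ← hx, h3]
      cases hi : (u i).2 <;> cases hk : (u k).2
      · obtain ⟨p, hp, hp'⟩ := hund i hi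
        obtain ⟨q, hq, hq'⟩ := hund k hk
        apply hne i k hik
        rw [hp, hq, sv_inj ℓ p q (by rw [hp', hq', hx])]
      · exact aux k i hx.symm hk hi
      · exact aux i k hx hi hk
      · obtain ⟨j, h1, h2, h3, h4⟩ := hdec i hi
        obtain ⟨j', h1', h2', h3', h4'⟩ := hdec k hk
        have hj : j = j' := by omega
        subst hj
        rcases h4 with h4 | h4 <;> rcases h4' with h4' | h4'
        · exact hne i k hik (by rw [h4, h4'])
        · exact hmix _ _ _ _ h4 h4'
        · exact hmix _ _ _ _ h4' h4
        · exact hne i k hik (by rw [h4, h4'])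
    · intro i k hik hk
      have hl : 1 ≤ ℓ := by have := i.isLt; omega
      obtain ⟨j, h1, h2, h3, h4⟩ := hdec k hk
      constructor
      · by_contra hge
        have hr := hrng i
        have hi : (u i).2 = false := by
          by_contra hi
          obtain ⟨j, d1, d2, d3, -⟩ := hdec i (by simpa using hi)
          omega
        obtain ⟨p, hp, hp'⟩ := hund i hi
        obtain ⟨q, hq⟩ := ca i k hik (by
          by_cases hpos : 0 < (u i).1
          · left
            rw [hp]; congr 1
            apply sv_inj ℓ
            rw [sv_mid' ℓ hl, hp']; omega
          · right
            rw [hp]; congr 1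
            apply sv_inj ℓ
            rw [sv_mid ℓ hl, hp']; omega)
        rcases h4 with h4 | h4 <;> rw [h4] at hq <;> cases hq
      · intro hi
        obtain ⟨j', h1', h2', h3', h4'⟩ := hdec i hi
        have : j' < j := by
          rcases h4' with h4' | h4' <;> rcases h4 with h4 | h4
          · exact cc i k hik j' j (Or.inl ⟨h4', h4⟩)
          · exact (hmix _ _ _ _ h4' h4).elim
          · exact (hmix _ _ _ _ h4 h4').elim
          · exact cc i k hik j' j (Or.inr ⟨h4', h4⟩)
        omega
  refine ⟨u, hvw, flag_ext _ _ (funext fun i => ?_)⟩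
  have hd : ∀ i, dOf ℓ u i = kd ℓ (c i) := by
    intro i
    have hl : 1 ≤ ℓ := by have := i.isLt; omega
    unfold dOf
    split_ifs with h1 h2
    · obtain ⟨j, -, -, -, h4⟩ := hdec i h1
      rcases h4 with h4 | h4
      · exfalso
        obtain ⟨k, hk⟩ := h2
        apply (hiso k i).2.1
        rw [h4]
        refine ⟨?_, hrng k⟩
        change (u k).1 = _
        rw [hk]; simp [kd]
      · rw [h4]; rfl
    · obtain ⟨j, -, -, -, h4⟩ := hdec i h1
      rcases h4 with h4 | h4
      · rw [h4]; rfl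
      · exfalso
        obtain ⟨k, hk⟩ := cb i j h4
        refine h2 ⟨k, ?_⟩
        simp only [u, hk, kx]
        rw [sv_mid' ℓ hl]
    · obtain ⟨p, hp, -⟩ := hund i (by simpa using h1)
      rw [hp]; rfl
  rw [hV]
  change gspan ℓ _ _ i = _
  unfold gspan
  congr 1
  ext w
  constructor
  · rintro ⟨k, hk, rfl⟩
    exact ⟨k, hk, by rw [hdv, hd]⟩
  · rintro ⟨k, hk, rfl⟩
    exact ⟨k, hk, by rw [hdv, hd]⟩

theorem VW_equiv_flags (ℓ : ℕ) :
    Nonempty ({u : Fin (ℓ - 1) → ℤ × Bool // VW ℓ u} ≃ {F : FlagD ℓ // IsStdFlagD ℓ F}) := by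
  refine ⟨Equiv.ofBijective (fun u => ⟨gflag (VW_good u.2), std_of_isStd u.2⟩) ⟨?_, ?_⟩⟩
  · rintro ⟨u, hu⟩ ⟨u', hu'⟩ hab
    have h1 : gflag (VW_good hu) = gflag (VW_good hu') := congrArg Subtype.val hab
    have h2 : ∀ i, gspan ℓ _ _ i = gspan ℓ _ _ i := fun i => congrFun (congrArg FlagD.V h1) i
    have h3 := good_inj (VW_good hu) (VW_good hu') h2
    apply Subtype.ext
    funext i
    obtain ⟨e1, e2⟩ := h3 i
    have hl : 1 ≤ ℓ := by have := i.isLt; omega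
    refine Prod.ext e1 ?_
    change (u i).2 = (u' i).2
    rw [Bool.eq_iff_iff, ← dOf_ne ℓ hl u i, ← dOf_ne ℓ hl u' i, e2]
  · rintro ⟨F, hF⟩
    obtain ⟨u, h, rfl⟩ := std_surj ℓ F hF
    exact ⟨⟨u, h⟩, rfl⟩

/-- There is a bijection between `SPIL(ℓ)` and the set of
`SO(2ℓ)`-flags in standard form. -/
theorem statement17 (ℓ : ℕ) (hl : 1 ≤ ℓ) :
    Nonempty ({P : Finset (List ℤ) // IsSPIL (Finset.Icc 1 ℓ) P} ≃
      {F : FlagD ℓ // IsStdFlagD ℓ F}) := by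
  obtain ⟨e1⟩ := spil_equiv_W ℓ hl
  obtain ⟨e2⟩ := W_equiv_VW ℓ
  obtain ⟨e3⟩ := VW_equiv_flags ℓ
  exact ⟨(e1.trans e2.symm).trans e3⟩

end
end

section
/- Let ℓ ≥ 1. For every isotropic flag F of type D in ℂ^{2ℓ} there exists a unique SO(2ℓ)-flag F′ in standard form such that F = g·F′ for some g ∈ B_{SO(2ℓ−1)}. Equivalently, the map sending an SO(2ℓ)-flag in standard form to its B_{SO(2ℓ−1)}-orbit is a bijection from the set of SO(2ℓ)-flags in standard form onto the set of B_{SO(2ℓ−1)}-orbits of isotropic flags of type D in ℂ^{2ℓ}. -/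
open scoped BigOperators

noncomputable section

/-- `bform` as a bilinear map. -/
def bl (n : ℕ) : (Fin n → ℂ) →ₗ[ℂ] (Fin n → ℂ) →ₗ[ℂ] ℂ :=
  LinearMap.mk₂ ℂ (bform n)
    (by intro x y z; simp [bform, add_mul, Finset.sum_add_distrib])
    (by intro c x y; simp [bform, mul_assoc, Finset.mul_sum])
    (by intro x y z; simp [bform, mul_add, Finset.sum_add_distrib])
    (by intro c x y; simp [bform, mul_left_comm, Finset.mul_sum])

theorem bl_apply (n : ℕ) (x y : Fin n → ℂ) : bl n x y = ∑ i, x i * y i.rev := by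
  change bform n x y = _
  unfold bform
  apply Finset.sum_congr rfl
  intro i _
  congr 2
  ext
  simp [Fin.val_rev]
  omega

theorem bform_bl (n : ℕ) (x y : Fin n → ℂ) : bform n x y = bl n x y := rfl

theorem bl_symm (n : ℕ) (x y : Fin n → ℂ) : bl n x y = bl n y x := by
  rw [bl_apply, bl_apply, ← Equiv.sum_comp Fin.revPerm]
  simp [mul_comm]

theorem bl_lead_eq {n : ℕ} {x y : Fin n → ℂ} {i : Fin n} (hx : ∀ a, i < a → x a = 0)
    (hy : ∀ a, i.rev < a → y a = 0) : bl n x y = x i * y i.rev := by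
  rw [bl_apply]
  apply Finset.sum_eq_single i
  · intro b _ hb
    rcases lt_or_gt_of_ne hb with h | h
    · rw [hy b.rev (by simpa using h), mul_zero]
    · rw [hx b h, zero_mul]
  · simp

theorem bl_lead_zero {n : ℕ} {x y : Fin n → ℂ} {i j : Fin n} (hx : ∀ a, i < a → x a = 0)
    (hy : ∀ a, j < a → y a = 0) (h : j < i.rev) : bl n x y = 0 := by
  rw [bl_lead_eq hx (fun a ha => hy a (h.trans ha)), hy _ h, mul_zero]

/-- Upper triangular hyperbolic bases. -/
structure Good_s18 {n : ℕ} (f : Fin n → Fin n → ℂ) : Prop where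
  tri : ∀ j a, j < a → f j a = 0
  pair : ∀ i j, bl n (f i) (f j) = if j = i.rev then 1 else 0

theorem Good_s18.diag {n : ℕ} {f : Fin n → Fin n → ℂ} (hf : Good_s18 f) (j : Fin n) :
    f j j * f j.rev j.rev = 1 := by
  rw [← bl_lead_eq (hf.tri j) (hf.tri j.rev), hf.pair]; simp

theorem Good_s18.std (n : ℕ) : Good_s18 (fun j : Fin n => (Pi.single j 1 : Fin n → ℂ)) := by
  constructor
  · intro j a h
    simp [h.ne']
  · intro i j
    rw [bl_apply]
    rw [Finset.sum_eq_single i]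
    · simp [Pi.single_apply, eq_comm]
    · intro b _ hb; simp [hb]
    · simp

theorem Good_s18.step {n : ℕ} {f : Fin n → Fin n → ℂ} (hf : Good_s18 f) (hn : ∀ q : Fin n, q.rev ≠ q)
    {v : Fin n → ℂ} {q : Fin n} (hv : ∀ a, q < a → v a = 0) (h1 : bl n (f q.rev) v = 1)
    (h0 : bl n v v = 0) :
    Good_s18 (fun j => if j = q then v else if j = q.rev then f j
      else f j - bl n (f j) v • f q.rev) := by
  constructor
  · intro j a hja
    split_ifs with h2 h3
    · subst h2; exact hv a hja
    · exact hf.tri j a hja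
    · simp only [Pi.sub_apply, Pi.smul_apply, smul_eq_mul, hf.tri j a hja]
      by_cases h4 : q < j.rev
      · rw [bl_lead_zero (hf.tri j) hv h4]; simp
      · have : q.rev ≤ j := by
          rw [not_lt] at h4
          simpa using Fin.rev_le_rev.mpr h4
        rw [hf.tri q.rev a (lt_of_le_of_lt this hja)]; simp
  · intro i j
    have hq := hn q
    have hs : ∀ j, bl n v (f j) = bl n (f j) v := fun j => bl_symm n _ _
    split_ifs with h2 h3 h4 h5 h6 h7 h8 h9 <;>
      (try simp only [map_sub, map_smul, LinearMap.sub_apply, LinearMap.smul_apply, hf.pair,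
        smul_eq_mul, h0, h1, hs]) <;>
      grind [Fin.rev_rev]

theorem Good_s18.elem {n : ℕ} {f : Fin n → Fin n → ℂ} (hf : Good_s18 f) (hn : ∀ q : Fin n, q.rev ≠ q)
    {a b : Fin n} (hab : a < b) (hba : b ≠ a.rev) (c : ℂ) :
    Good_s18 (fun j => if j = b then f b + c • f a else if j = a.rev then f j - c • f b.rev
      else f j) := by
  constructor
  · intro j x hja
    split_ifs with h2 h3
    · subst h2; simp [hf.tri _ _ hja, hf.tri _ _ (hab.trans hja)]
    · subst h3
      have : b.rev < a.rev := by simpa using hab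
      simp [hf.tri _ _ hja, hf.tri _ _ (this.trans hja)]
    · exact hf.tri _ _ hja
  · intro i j
    have ha := hn a
    have hb := hn b
    have e1 : a ≠ b := hab.ne
    have e2 : a ≠ b.rev := by intro h; apply hba; simp [h]
    split_ifs with h2 h3 h4 h5 h6 h7 h8 h9 <;>
      simp only [map_sub, map_add, map_smul, LinearMap.sub_apply, LinearMap.add_apply,
        LinearMap.smul_apply, hf.pair, smul_eq_mul] <;>
      grind [Fin.rev_rev]

theorem Good_s18.scale {n : ℕ} {f : Fin n → Fin n → ℂ} (hf : Good_s18 f) (t : Fin n → ℂ)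
    (ht : ∀ j, t j * t j.rev = 1) : Good_s18 (fun j => t j • f j) := by
  constructor
  · intro j a h
    simp [hf.tri j a h]
  · intro i j
    simp only [map_smul, LinearMap.smul_apply, hf.pair, smul_eq_mul]
    split_ifs with h
    · subst h; rw [mul_one, mul_comm, ht]
    · simp

/-- The index of `e_ℓ`. -/
abbrev iL (ℓ : ℕ) (hl : 1 ≤ ℓ) : Fin (2 * ℓ) := ⟨ℓ - 1, by omega⟩

/-- The index of `e_{-ℓ}`. -/
abbrev iM (ℓ : ℕ) (hl : 1 ≤ ℓ) : Fin (2 * ℓ) := ⟨ℓ, by omega⟩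

/-- The vector `e_ℓ - e_{-ℓ}`. -/
def x0 (ℓ : ℕ) (hl : 1 ≤ ℓ) : Fin (2 * ℓ) → ℂ :=
  (Pi.single (iL ℓ hl) 1 : Fin (2 * ℓ) → ℂ) - Pi.single (iM ℓ hl) 1

theorem rev_ne (ℓ : ℕ) (q : Fin (2 * ℓ)) : q.rev ≠ q := by
  intro h
  have := congrArg Fin.val h
  rw [Fin.val_rev] at this
  omega

theorem rev_iL (ℓ : ℕ) (hl : 1 ≤ ℓ) : (iL ℓ hl).rev = iM ℓ hl := by
  ext; simp [Fin.val_rev]; omega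

theorem rev_iM (ℓ : ℕ) (hl : 1 ≤ ℓ) : (iM ℓ hl).rev = iL ℓ hl := by
  ext; simp [Fin.val_rev]; omega

theorem bl_x0 (ℓ : ℕ) (hl : 1 ≤ ℓ) (v : Fin (2 * ℓ) → ℂ) :
    bl _ (x0 ℓ hl) v = v (iM ℓ hl) - v (iL ℓ hl) := by
  have h : ∀ i : Fin (2 * ℓ), bl _ (Pi.single i 1) v = v i.rev := by
    intro i
    rw [bl_apply, Finset.sum_eq_single i]
    · simp
    · intro b _ hb; simp [hb]
    · simp
  rw [x0, map_sub, LinearMap.sub_apply, h, h, rev_iL, rev_iM]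

theorem iL_lt_iM (ℓ : ℕ) (hl : 1 ≤ ℓ) : iL ℓ hl < iM ℓ hl := by
  rw [Fin.lt_def]; simp; omega

theorem bl_x0_x0 (ℓ : ℕ) (hl : 1 ≤ ℓ) : bl _ (x0 ℓ hl) (x0 ℓ hl) = -2 := by
  have h := (iL_lt_iM ℓ hl).ne
  rw [bl_x0, x0]
  simp only [Pi.sub_apply, Pi.single_apply, if_pos, if_neg h, if_neg h.symm]
  norm_num

theorem x0_tri (ℓ : ℕ) (hl : 1 ≤ ℓ) (a : Fin (2 * ℓ)) (h : iM ℓ hl < a) : x0 ℓ hl a = 0 := by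
  have h' := (iL_lt_iM ℓ hl).trans h
  simp [x0, h.ne', h'.ne']

theorem x0_iM (ℓ : ℕ) (hl : 1 ≤ ℓ) : x0 ℓ hl (iM ℓ hl) = -1 := by
  have h := (iL_lt_iM ℓ hl).ne
  simp [x0, -Fin.mk.injEq, h.symm]

theorem Good_s18.y_low {ℓ : ℕ} {hl : 1 ≤ ℓ} {f : Fin (2 * ℓ) → Fin (2 * ℓ) → ℂ} (hf : Good_s18 f)
    {j : Fin (2 * ℓ)} (hj : j < iL ℓ hl) : bl _ (x0 ℓ hl) (f j) = 0 := by
  rw [bl_x0, hf.tri _ _ hj, hf.tri _ _ (hj.trans (iL_lt_iM ℓ hl)), sub_zero]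

theorem Good_s18.y_mid {ℓ : ℕ} {hl : 1 ≤ ℓ} {f : Fin (2 * ℓ) → Fin (2 * ℓ) → ℂ} (hf : Good_s18 f) :
    bl _ (x0 ℓ hl) (f (iL ℓ hl)) * bl _ (x0 ℓ hl) (f (iM ℓ hl)) = -1 := by
  have hd := hf.diag (iL ℓ hl)
  have hz : f (iM ℓ hl) (iL ℓ hl) * f (iM ℓ hl) (iM ℓ hl) = 0 := by
    have h := hf.pair (iM ℓ hl) (iM ℓ hl)
    rw [if_neg (rev_ne ℓ _).symm, bl_apply,
      Finset.sum_eq_add_of_mem (iL ℓ hl) (iM ℓ hl) (Finset.mem_univ _) (Finset.mem_univ _)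
        (iL_lt_iM ℓ hl).ne, rev_iL, rev_iM] at h
    · linear_combination h / 2
    · intro c _ hc
      rcases lt_or_ge (iM ℓ hl) c with h | h
      · rw [hf.tri _ _ h, zero_mul]
      · rw [hf.tri _ c.rev, mul_zero]
        rw [Fin.lt_def, Fin.val_rev]
        have h1 : (c : ℕ) ≠ ℓ - 1 := fun h => hc.1 (Fin.ext h)
        have h2 : (c : ℕ) ≠ ℓ := fun h => hc.2 (Fin.ext h)
        have h3 : (c : ℕ) ≤ ℓ := h
        change ℓ < _
        omega
  rw [rev_iL] at hd
  rw [bl_x0, bl_x0, hf.tri _ _ (iL_lt_iM ℓ hl)]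
  have hM : f (iM ℓ hl) (iM ℓ hl) ≠ 0 := right_ne_zero_of_mul (hd ▸ one_ne_zero)
  have := (mul_eq_zero.1 hz).resolve_right hM
  rw [this]
  linear_combination -hd

theorem Good_s18.final {ℓ : ℕ} {hl : 1 ≤ ℓ} {f : Fin (2 * ℓ) → Fin (2 * ℓ) → ℂ} (hf : Good_s18 f)
    (hL : bl _ (x0 ℓ hl) (f (iL ℓ hl)) = -1) (hM : bl _ (x0 ℓ hl) (f (iM ℓ hl)) = 1)
    {r : Fin (2 * ℓ)} {s : ℂ} (hr : (r = iL ℓ hl ∧ s = -1) ∨ (r = iM ℓ hl ∧ s = 1)) :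
    Good_s18 (fun j => if j = r.rev then s • x0 ℓ hl + f r else if j = r then f r
      else f j - (s * bl _ (x0 ℓ hl) (f j)) • f r) := by
  have hyr : bl _ (x0 ℓ hl) (f r) = s := by
    rcases hr with ⟨rfl, rfl⟩ | ⟨rfl, rfl⟩
    · exact hL
    · exact hM
  have hss : s * s = 1 := by
    rcases hr with ⟨rfl, rfl⟩ | ⟨rfl, rfl⟩ <;> norm_num
  have hrM : r ≤ iM ℓ hl := by
    rcases hr with ⟨rfl, rfl⟩ | ⟨rfl, rfl⟩
    · exact (iL_lt_iM ℓ hl).le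
    · exact le_rfl
  constructor
  · intro j a hja
    split_ifs with h1 h2
    · subst h1
      rcases hr with ⟨rfl, rfl⟩ | ⟨rfl, rfl⟩
      · rw [rev_iL] at hja
        simp [x0_tri ℓ hl a hja, hf.tri _ _ ((iL_lt_iM ℓ hl).trans hja)]
      · rw [rev_iM] at hja
        rcases lt_or_ge (iM ℓ hl) a with h | h
        · simp [x0_tri ℓ hl a h, hf.tri _ _ h]
        · have : a = iM ℓ hl := by
            ext
            rw [Fin.lt_def] at hja
            have h3 : (a : ℕ) ≤ ℓ := h
            change ℓ - 1 < (a : ℕ) at hja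
            change (a : ℕ) = ℓ
            omega
          subst this
          have hd := hf.diag (iL ℓ hl)
          rw [rev_iL] at hd
          rw [bl_x0, hf.tri _ _ (iL_lt_iM ℓ hl)] at hL
          have : f (iL ℓ hl) (iL ℓ hl) = 1 := by linear_combination -hL
          rw [this, one_mul] at hd
          simp only [Pi.add_apply, Pi.smul_apply, x0_iM, hd]
          simp
    · subst h2
      exact hf.tri _ _ hja
    · rcases lt_or_ge j (iL ℓ hl) with h | h
      · simp [hf.y_low h, hf.tri _ _ hja]
      · have h4 : iM ℓ hl < j := by
          rw [Fin.lt_def]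
          have h3 : ℓ - 1 ≤ (j : ℕ) := h
          have h5 : (j : ℕ) ≠ ℓ - 1 := by
            intro h5
            have : j = iL ℓ hl := Fin.ext h5
            rcases hr with ⟨rfl, rfl⟩ | ⟨rfl, rfl⟩
            · exact h2 this
            · rw [rev_iM] at h1; exact h1 this
          have h6 : (j : ℕ) ≠ ℓ := by
            intro h5
            have : j = iM ℓ hl := Fin.ext h5
            rcases hr with ⟨rfl, rfl⟩ | ⟨rfl, rfl⟩
            · rw [rev_iL] at h1; exact h1 this
            · exact h2 this
          change ℓ < (j : ℕ)
          omega
        simp [hf.tri _ _ hja, hf.tri r a (lt_of_le_of_lt hrM (h4.trans hja))]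
  · intro i j
    have hq := rev_ne ℓ r
    have hs : ∀ j, bl _ (f j) (x0 ℓ hl) = bl _ (x0 ℓ hl) (f j) := fun j => bl_symm _ _ _
    have hxx := bl_x0_x0 ℓ hl
    have hjr : ∀ j : Fin (2 * ℓ), j.rev.rev = j := fun j => Fin.rev_rev j
    split_ifs with h2 h3 h4 h5 h6 h7 h8 h9 <;>
      (try simp only [map_sub, map_add, map_smul, LinearMap.sub_apply, LinearMap.add_apply,
        LinearMap.smul_apply, hf.pair, smul_eq_mul, hs, hyr, hxx]) <;>
      grind

theorem Good_s18.toBD {ℓ : ℕ} {hl : 1 ≤ ℓ} {f : Fin (2 * ℓ) → Fin (2 * ℓ) → ℂ} (hf : Good_s18 f)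
    (hx : f (iL ℓ hl) - f (iM ℓ hl) = x0 ℓ hl) :
    memBD ℓ hl (Matrix.of fun a j => f j a) := by
  have hcol : ∀ j, (Matrix.of fun a j => f j a).mulVec (Pi.single j 1) = f j := by
    intro j
    ext a
    simp
  refine ⟨⟨?_, ?_⟩, ?_, ?_⟩
  · rw [Matrix.det_of_isUpperTriangular]
    · apply Finset.prod_involution (fun a _ => Fin.rev a)
      · intro a _; exact hf.diag a
      · intro a _ _; exact rev_ne ℓ a
      · simp
      · simp
    · intro i j hij
      exact hf.tri j i hij
  · have : (bl (2 * ℓ)).compl₁₂ (Matrix.of fun a j => f j a).mulVecLin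
        (Matrix.of fun a j => f j a).mulVecLin = bl (2 * ℓ) := by
      apply LinearMap.ext_basis (Pi.basisFun ℂ _) (Pi.basisFun ℂ _)
      intro i j
      simp only [LinearMap.compl₁₂_apply, Matrix.mulVecLin_apply, Pi.basisFun_apply, hcol]
      rw [hf.pair, (Good_s18.std _).pair]
    intro x y
    exact LinearMap.congr_fun₂ this x y
  · intro i j hij
    exact hf.tri j i hij
  · rw [Matrix.mulVec_sub, hcol, hcol]
    exact hx

theorem flag_isot {ℓ : ℕ} (F : FlagD ℓ) (i : Fin (ℓ - 1)) {u w : Fin (2 * ℓ) → ℂ}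
    (hu : u ∈ F.V i) (hw : w ∈ F.V i) : bl _ u w = 0 := F.isot i u hu w hw

/-- Bruhat decomposition: every isotropic flag is a coordinate flag in some upper triangular
hyperbolic basis. -/
theorem bruhat {ℓ : ℕ} (F : FlagD ℓ) (n : ℕ) (hn : n ≤ ℓ - 1) :
    ∃ (f : Fin (2 * ℓ) → Fin (2 * ℓ) → ℂ) (w : Fin (ℓ - 1) → Fin (2 * ℓ)), Good_s18 f ∧
      ∀ k : Fin (ℓ - 1), (k : ℕ) < n → F.V k = Submodule.span ℂ {x | ∃ m, m ≤ k ∧ x = f (w m)} := by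
  classical
  induction n with
  | zero =>
    exact ⟨_, fun m => ⟨m, by omega⟩, Good_s18.std _, fun k hk => absurd hk (by omega)⟩
  | succ n ih =>
    obtain ⟨f, w, hf, hV⟩ := ih (by omega)
    set N : Fin (ℓ - 1) := ⟨n, by omega⟩ with hN
    set P : Submodule ℂ (Fin (2 * ℓ) → ℂ) := Submodule.span ℂ {x | ∃ m, m < N ∧ x = f (w m)}
      with hP
    have hPle : P ≤ F.V N := by
      rw [hP, Submodule.span_le]
      rintro x ⟨m, hm, rfl⟩
      apply F.mono m N hm.le
      rw [hV m hm]
      exact Submodule.subset_span ⟨m, le_rfl, rfl⟩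
    have hPr : Module.finrank ℂ P = n := by
      rcases n with _ | k
      · have : P = ⊥ := by
          rw [hP, Submodule.span_eq_bot]
          rintro x ⟨m, hm, rfl⟩
          exact absurd (Fin.lt_def.1 hm) (by simp [hN])
        rw [this]; simp
      · have : P = F.V ⟨k, by omega⟩ := by
          rw [hV _ (by simp), hP]
          congr 1
          ext x
          constructor
          · rintro ⟨m, hm, rfl⟩
            exact ⟨m, by rw [Fin.le_def]; rw [Fin.lt_def] at hm; simp [hN] at hm ⊢; omega, rfl⟩
          · rintro ⟨m, hm, rfl⟩
            exact ⟨m, by rw [Fin.le_def] at hm; rw [Fin.lt_def]; simp [hN] at hm ⊢; omega, rfl⟩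
        rw [this, F.dimV]
    have hNr : Module.finrank ℂ (F.V N) = n + 1 := F.dimV N
    have hex : ∃ K : ℕ, ∃ v ∈ F.V N, v ∉ P ∧ ∀ a : Fin (2 * ℓ), K ≤ (a : ℕ) → v a = 0 := by
      have : ∃ v ∈ F.V N, v ∉ P := by
        by_contra! hcon
        have := Submodule.finrank_mono (show F.V N ≤ P from hcon)
        omega
      obtain ⟨v, hv, hvP⟩ := this
      exact ⟨2 * ℓ, v, hv, hvP, fun a ha => absurd a.isLt (by omega)⟩
    obtain ⟨v, hv, hvP, hva⟩ := Nat.find_spec hex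
    have hmin : ∀ K' < Nat.find hex, ¬ _ := fun K' h => Nat.find_min hex h
    generalize Nat.find hex = K at hva hmin
    have hK0 : K ≠ 0 := by
      rintro rfl
      apply hvP
      have : v = 0 := by ext a; exact hva a (Nat.zero_le _)
      rw [this]; exact P.zero_mem
    have hK2 : K ≤ 2 * ℓ := by
      by_contra hcon
      exact hmin (2 * ℓ) (by omega) ⟨v, hv, hvP, fun a ha => absurd a.isLt (by omega)⟩
    set q : Fin (2 * ℓ) := ⟨K - 1, by omega⟩ with hq
    have hvq : v q ≠ 0 := by
      intro h
      apply hmin (K - 1) (by omega)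
      refine ⟨v, hv, hvP, fun a ha => ?_⟩
      by_cases h2 : (a : ℕ) = K - 1
      · have : a = q := Fin.ext h2
        rw [this, h]
      · exact hva a (by omega)
    have hvt : ∀ a, q < a → v a = 0 := by
      intro a ha
      apply hva
      rw [Fin.lt_def] at ha
      simp [hq] at ha
      omega
    have hlead : bl _ (f q.rev) v ≠ 0 := by
      rw [bl_lead_eq (hf.tri q.rev) (by simpa using hvt)]
      have := hf.diag q.rev
      rw [Fin.rev_rev] at *
      exact mul_ne_zero (left_ne_zero_of_mul (this ▸ one_ne_zero)) hvq
    have hmem : ∀ m, m < N → f (w m) ∈ P := fun m hm => Submodule.subset_span ⟨m, hm, rfl⟩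
    have hwq : ∀ m, m < N → w m ≠ q := by
      intro m hm h
      apply hmin (K - 1) (by omega)
      have hfq : f q q ≠ 0 := left_ne_zero_of_mul ((hf.diag q) ▸ one_ne_zero)
      have hm' := hmem m hm
      rw [h] at hm'
      refine ⟨v - (v q / f q q) • f q, ?_, ?_, ?_⟩
      · exact Submodule.sub_mem _ hv (Submodule.smul_mem _ _ (hPle hm'))
      · intro h2
        apply hvP
        have := P.add_mem h2 (P.smul_mem (v q / f q q) hm')
        simpa using this
      · intro a ha
        by_cases h2 : (a : ℕ) = K - 1
        · have : a = q := Fin.ext h2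
          rw [this]
          simp [hfq]
        · have h3 : q < a := by rw [Fin.lt_def]; simp [hq]; omega
          simp [hvt a h3, hf.tri q a h3]
    have horth : ∀ m, m < N → bl _ (f (w m)) v = 0 := fun m hm =>
      flag_isot F N (hPle (hmem m hm)) hv
    have hwq' : ∀ m, m < N → w m ≠ q.rev := by
      intro m hm h
      apply hlead
      rw [← h]; exact horth m hm
    set c := (bl _ (f q.rev) v)⁻¹ with hc
    have hc0 : c ≠ 0 := inv_ne_zero hlead
    have hgood := hf.step (rev_ne ℓ) (v := c • v) (q := q)
      (by intro a ha; simp [hvt a ha]) (by simp [hc, hlead])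
      (flag_isot F N (Submodule.smul_mem _ _ hv) (Submodule.smul_mem _ _ hv))
    set f' : Fin (2 * ℓ) → Fin (2 * ℓ) → ℂ := fun j => if j = q then c • v else
      if j = q.rev then f j else f j - bl _ (f j) (c • v) • f q.rev with hf'
    have hfw : ∀ m, m < N → f' (w m) = f (w m) := by
      intro m hm
      simp only [hf', if_neg (hwq m hm), if_neg (hwq' m hm), map_smul, horth m hm]
      simp
    have hfq : f' q = c • v := by simp [hf']
    refine ⟨f', fun m => if m = N then q else w m, hgood, ?_⟩
    have hw1 : ∀ m, m < N → f' (if m = N then q else w m) = f (w m) := by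
      intro m hm; rw [if_neg hm.ne, hfw m hm]
    intro k hk
    rcases lt_or_eq_of_le (Nat.lt_succ_iff.1 hk) with h | h
    · rw [hV k h]
      congr 1
      ext x
      constructor
      · rintro ⟨m, hm, rfl⟩
        exact ⟨m, hm, (hw1 m (lt_of_le_of_lt hm h)).symm⟩
      · rintro ⟨m, hm, rfl⟩
        exact ⟨m, hm, hw1 m (lt_of_le_of_lt hm h)⟩
    · have hkN : k = N := Fin.ext h
      subst hkN
      symm
      have hle : Submodule.span ℂ {x | ∃ m, m ≤ N ∧ x = f' (if m = N then q else w m)}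
          ≤ F.V N := by
        rw [Submodule.span_le]
        rintro x ⟨m, hm, rfl⟩
        rcases lt_or_eq_of_le hm with h2 | h2
        · rw [hw1 m h2]; exact hPle (hmem m h2)
        · rw [if_pos h2, hfq]; exact Submodule.smul_mem _ _ hv
      apply Submodule.eq_of_le_of_finrank_le hle
      rw [hNr]
      have hlt : P < Submodule.span ℂ {x | ∃ m, m ≤ N ∧ x = f' (if m = N then q else w m)} := by
        apply lt_of_le_of_ne
        · rw [hP]
          apply Submodule.span_mono
          rintro x ⟨m, hm, rfl⟩
          exact ⟨m, hm.le, (hw1 m hm).symm⟩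
        · intro heq
          apply hvP
          have h3 : c • v ∈ P := by
            rw [heq]
            exact Submodule.subset_span ⟨N, le_rfl, by simp [hfq]⟩
          have := P.smul_mem c⁻¹ h3
          rwa [smul_smul, inv_mul_cancel₀ hc0, one_smul] at this
      have := Submodule.finrank_lt_finrank_of_lt hlt
      omega

theorem flag_linInd {ℓ : ℕ} (F : FlagD ℓ) (d : Fin (ℓ - 1) → Fin (2 * ℓ) → ℂ)
    (h : ∀ k, F.V k = Submodule.span ℂ {x | ∃ m, m ≤ k ∧ x = d m}) : LinearIndependent ℂ d := by
  rw [linearIndependent_iff_card_eq_finrank_span, Fintype.card_fin, Set.finrank]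
  rcases Nat.eq_zero_or_pos (ℓ - 1) with h0 | h0
  · have : IsEmpty (Fin (ℓ - 1)) := by rw [h0]; infer_instance
    rw [Set.range_eq_empty d, Submodule.span_empty, finrank_bot, h0]
  · have h1 := F.dimV ⟨ℓ - 2, by omega⟩
    rw [h] at h1
    have : {x | ∃ m, m ≤ (⟨ℓ - 2, by omega⟩ : Fin (ℓ - 1)) ∧ x = d m} = Set.range d := by
      ext x
      constructor
      · rintro ⟨m, _, rfl⟩; exact ⟨m, rfl⟩
      · rintro ⟨m, rfl⟩
        exact ⟨m, by rw [Fin.le_def]; have := m.isLt; simp; omega, rfl⟩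
    rw [this] at h1
    rw [h1]; simp; omega

/-- Good bases in which the flag is the coordinate flag given by `w`. -/
def GoodFor {ℓ : ℕ} (F : FlagD ℓ) (w : Fin (ℓ - 1) → Fin (2 * ℓ))
    (f : Fin (2 * ℓ) → Fin (2 * ℓ) → ℂ) : Prop :=
  Good_s18 f ∧ ∀ k, F.V k = Submodule.span ℂ {x | ∃ m, m ≤ k ∧ x = f (w m)}

/-- The set of positions `i` at which `β(x0, f_{-i})` is nonzero. -/
def supp {ℓ : ℕ} (hl : 1 ≤ ℓ) (f : Fin (2 * ℓ) → Fin (2 * ℓ) → ℂ) : Finset (Fin (2 * ℓ)) :=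
  by classical exact Finset.univ.filter fun i => i < iL ℓ hl ∧ bl _ (x0 ℓ hl) (f i.rev) ≠ 0

theorem mem_supp {ℓ : ℕ} {hl : 1 ≤ ℓ} {f : Fin (2 * ℓ) → Fin (2 * ℓ) → ℂ} {i : Fin (2 * ℓ)} :
    i ∈ supp hl f ↔ i < iL ℓ hl ∧ bl _ (x0 ℓ hl) (f i.rev) ≠ 0 := by
  simp [supp]

theorem kill {ℓ : ℕ} (hl : 1 ≤ ℓ) {F : FlagD ℓ} {w : Fin (ℓ - 1) → Fin (2 * ℓ)}
    {f : Fin (2 * ℓ) → Fin (2 * ℓ) → ℂ} (hf : GoodFor F w f) {i b : Fin (2 * ℓ)}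
    (hi : i < iL ℓ hl) (hyi : bl _ (x0 ℓ hl) (f i.rev) ≠ 0) (hib : i < b) (hbi : b ≠ i.rev)
    (hyb : bl _ (x0 ℓ hl) (f b.rev) ≠ 0) (hwb : ∀ m, w m ≠ b)
    (hw : ∀ m, w m = i.rev → ∃ m', m' < m ∧ w m' = b.rev) :
    ∃ f', GoodFor F w f' ∧ (supp hl f').card < (supp hl f).card := by
  obtain ⟨hg, hV⟩ := hf
  set c := bl _ (x0 ℓ hl) (f i.rev) / bl _ (x0 ℓ hl) (f b.rev) with hc
  have hg' := hg.elem (rev_ne ℓ) hib hbi c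
  set f' : Fin (2 * ℓ) → Fin (2 * ℓ) → ℂ := fun j => if j = b then f b + c • f i else
    if j = i.rev then f j - c • f b.rev else f j with hf'
  have hbr : b.rev ≠ i.rev := fun h => hib.ne (Fin.rev_injective h).symm
  have e1 : f' b.rev = f b.rev := by simp [hf', rev_ne, hbr]
  have e2 : f' i.rev = f i.rev - c • f b.rev := by simp [hf', hbi.symm]
  have e3 : ∀ j, j ≠ b → j ≠ i.rev → f' j = f j := by
    intro j h1 h2; simp [hf', h1, h2]
  refine ⟨f', ⟨hg', ?_⟩, ?_⟩
  · intro k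
    rw [hV k]
    apply le_antisymm
    · rw [Submodule.span_le]
      rintro x ⟨m, hm, rfl⟩
      by_cases h : w m = i.rev
      · obtain ⟨m', hm', hw'⟩ := hw m h
        have h1 : f (w m) = f' (w m) + c • f' (w m') := by
          rw [hw', h, e1, e2]; simp
        rw [h1]
        exact Submodule.add_mem _ (Submodule.subset_span ⟨m, hm, rfl⟩)
          (Submodule.smul_mem _ _ (Submodule.subset_span ⟨m', hm'.le.trans hm, rfl⟩))
      · exact Submodule.subset_span ⟨m, hm, (e3 _ (hwb m) h).symm⟩
    · rw [Submodule.span_le]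
      rintro x ⟨m, hm, rfl⟩
      by_cases h : w m = i.rev
      · obtain ⟨m', hm', hw'⟩ := hw m h
        have h1 : f' (w m) = f (w m) - c • f (w m') := by
          rw [hw', h, e2]
        rw [h1]
        exact Submodule.sub_mem _ (Submodule.subset_span ⟨m, hm, rfl⟩)
          (Submodule.smul_mem _ _ (Submodule.subset_span ⟨m', hm'.le.trans hm, rfl⟩))
      · exact Submodule.subset_span ⟨m, hm, e3 _ (hwb m) h⟩
  · apply Finset.card_lt_card
    rw [Finset.ssubset_iff_of_subset]
    · refine ⟨i, mem_supp.2 ⟨hi, hyi⟩, ?_⟩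
      rw [mem_supp, e2]
      simp [hc, hyb]
    · intro i' hi'
      rw [mem_supp] at hi' ⊢
      refine ⟨hi'.1, ?_⟩
      have h2 := hi'.2
      by_cases h3 : i'.rev = i.rev
      · rw [h3]; exact hyi
      · by_cases h4 : i'.rev = b
        · rw [h4] at h2 ⊢
          have : f' b = f b + c • f i := by simp [hf']
          rw [this, map_add, map_smul, hg.y_low hi] at h2
          simpa using h2
        · rwa [e3 _ h4 h3] at h2

theorem exists_min {ℓ : ℕ} (hl : 1 ≤ ℓ) (F : FlagD ℓ) :
    ∃ (w : Fin (ℓ - 1) → Fin (2 * ℓ)) (f : Fin (2 * ℓ) → Fin (2 * ℓ) → ℂ), GoodFor F w f ∧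
      ∀ i b : Fin (2 * ℓ), i < iL ℓ hl → bl _ (x0 ℓ hl) (f i.rev) ≠ 0 → i < b → b ≠ i.rev →
        bl _ (x0 ℓ hl) (f b.rev) ≠ 0 → (∀ m, w m ≠ b) →
        ∃ m, w m = i.rev ∧ ∀ m', m' < m → w m' ≠ b.rev := by
  obtain ⟨f₀, w, h1, h2⟩ := bruhat F (ℓ - 1) le_rfl
  have hne : {f | GoodFor F w f}.Nonempty := ⟨f₀, h1, fun k => h2 k k.isLt⟩
  obtain ⟨f, hf, hmin⟩ := (measure fun f => (supp hl f).card).wf.has_min _ hne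
  refine ⟨w, f, hf, ?_⟩
  intro i b hi hyi hib hbi hyb hwb
  by_contra! hcon
  obtain ⟨f', hf', hlt⟩ := kill hl hf hi hyi hib hbi hyb hwb hcon
  exact hmin f' hf' hlt

theorem GoodFor.scale {ℓ : ℕ} {F : FlagD ℓ} {w : Fin (ℓ - 1) → Fin (2 * ℓ)}
    {f : Fin (2 * ℓ) → Fin (2 * ℓ) → ℂ} (hf : GoodFor F w f) (t : Fin (2 * ℓ) → ℂ)
    (ht : ∀ j, t j * t j.rev = 1) : GoodFor F w (fun j => t j • f j) := by
  refine ⟨hf.1.scale t ht, fun k => ?_⟩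
  have h0 : ∀ j, t j ≠ 0 := fun j => left_ne_zero_of_mul (ht j ▸ one_ne_zero)
  rw [hf.2 k]
  apply le_antisymm
  · rw [Submodule.span_le]
    rintro x ⟨m, hm, rfl⟩
    have : f (w m) = (t (w m))⁻¹ • t (w m) • f (w m) := by
      rw [smul_smul, inv_mul_cancel₀ (h0 _), one_smul]
    rw [this]
    exact Submodule.smul_mem _ _ (Submodule.subset_span ⟨m, hm, rfl⟩)
  · rw [Submodule.span_le]
    rintro x ⟨m, hm, rfl⟩
    exact Submodule.smul_mem _ _ (Submodule.subset_span ⟨m, hm, rfl⟩)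

theorem exists_scaled {ℓ : ℕ} (hl : 1 ≤ ℓ) (F : FlagD ℓ) :
    ∃ w : Fin (ℓ - 1) → Fin (2 * ℓ), ∀ s : ℂ, s ≠ 0 →
      ∃ f : Fin (2 * ℓ) → Fin (2 * ℓ) → ℂ, GoodFor F w f ∧
      (∀ i b : Fin (2 * ℓ), i < iL ℓ hl → bl _ (x0 ℓ hl) (f i.rev) ≠ 0 → i < b → b ≠ i.rev →
        bl _ (x0 ℓ hl) (f b.rev) ≠ 0 → (∀ m, w m ≠ b) →
        ∃ m, w m = i.rev ∧ ∀ m', m' < m → w m' ≠ b.rev) ∧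
      bl _ (x0 ℓ hl) (f (iL ℓ hl)) = -1 ∧ bl _ (x0 ℓ hl) (f (iM ℓ hl)) = 1 ∧
      ∀ j, iM ℓ hl < j → bl _ (x0 ℓ hl) (f j) ≠ 0 → bl _ (x0 ℓ hl) (f j) = s := by
  classical
  obtain ⟨w, f, hf, hK⟩ := exists_min hl F
  refine ⟨w, fun s hs => ?_⟩
  have hmid := hf.1.y_mid (hl := hl)
  have hM0 : bl _ (x0 ℓ hl) (f (iM ℓ hl)) ≠ 0 :=
    right_ne_zero_of_mul (hmid ▸ neg_ne_zero.2 one_ne_zero)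
  set y : Fin (2 * ℓ) → ℂ := fun j => bl _ (x0 ℓ hl) (f j) with hy
  set u : Fin (2 * ℓ) → ℂ := fun j => if j = iM ℓ hl then (y j)⁻¹ else
    if y j = 0 then 1 else s / y j with hu
  have hu0 : ∀ j, u j ≠ 0 := by
    intro j
    simp only [hu]
    split_ifs with h1 h2
    · rw [h1]; exact inv_ne_zero hM0
    · exact one_ne_zero
    · exact div_ne_zero hs h2
  set t : Fin (2 * ℓ) → ℂ := fun j => if iM ℓ hl ≤ j then u j else (u j.rev)⁻¹ with ht
  have htt : ∀ j, t j * t j.rev = 1 := by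
    intro j
    have hj : iM ℓ hl ≤ j ↔ ¬ iM ℓ hl ≤ j.rev := by
      rw [Fin.le_def, Fin.le_def, Fin.val_rev]
      have := j.isLt
      change ℓ ≤ _ ↔ ¬ ℓ ≤ _
      omega
    by_cases h : iM ℓ hl ≤ j
    · simp only [ht, if_pos h, if_neg (hj.1 h), Fin.rev_rev]
      exact mul_inv_cancel₀ (hu0 j)
    · have h' : iM ℓ hl ≤ j.rev := by
        by_contra h'; exact h (hj.2 h')
      simp only [ht, if_pos h', if_neg h]
      exact inv_mul_cancel₀ (hu0 _)
  have h0 : ∀ j, t j ≠ 0 := fun j => left_ne_zero_of_mul (htt j ▸ one_ne_zero)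
  refine ⟨fun j => t j • f j, hf.scale t htt, ?_, ?_, ?_, ?_⟩
  · intro i b hi hyi hib hbi hyb hwb
    rw [map_smul, smul_eq_mul] at hyi hyb
    exact hK i b hi (right_ne_zero_of_mul hyi) hib hbi (right_ne_zero_of_mul hyb) hwb
  · rw [map_smul, smul_eq_mul]
    have : t (iL ℓ hl) = y (iM ℓ hl) := by
      simp only [ht, if_neg (not_le.2 (iL_lt_iM ℓ hl)), rev_iL, hu, if_true, inv_inv]
    rw [this, mul_comm]; exact hmid
  · rw [map_smul, smul_eq_mul]
    have : t (iM ℓ hl) = (y (iM ℓ hl))⁻¹ := by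
      simp only [ht, le_refl, hu, if_true]
    rw [this]
    exact inv_mul_cancel₀ hM0
  · intro j hj hne
    rw [map_smul, smul_eq_mul] at hne ⊢
    have h1 : y j ≠ 0 := right_ne_zero_of_mul hne
    have : t j = s / y j := by
      simp only [ht, if_pos hj.le, hu, if_neg hj.ne', if_neg h1]
    rw [this]
    exact div_mul_cancel₀ s h1

theorem exists_std {ℓ : ℕ} (hl : 1 ≤ ℓ) (F : FlagD ℓ) :
    ∃ F' : FlagD ℓ, IsStdFlagD ℓ F' ∧ flagDRel ℓ hl F F' := by
  classical
  obtain ⟨w, hw⟩ := exists_scaled hl F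
  obtain ⟨r, s, hr, hrw⟩ : ∃ (r : Fin (2 * ℓ)) (s : ℂ),
      ((r = iL ℓ hl ∧ s = -1) ∨ (r = iM ℓ hl ∧ s = 1)) ∧
      ((r = iL ℓ hl ∧ ∃ m, w m = iL ℓ hl) ∨ (r = iM ℓ hl ∧ ∀ m, w m ≠ iL ℓ hl)) := by
    by_cases h : ∃ m, w m = iL ℓ hl
    · exact ⟨_, _, Or.inl ⟨rfl, rfl⟩, Or.inl ⟨rfl, h⟩⟩
    · push Not at h
      exact ⟨_, _, Or.inr ⟨rfl, rfl⟩, Or.inr ⟨rfl, h⟩⟩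
  have hss : s * s = 1 := by
    rcases hr with ⟨rfl, rfl⟩ | ⟨rfl, rfl⟩ <;> norm_num
  have hs0 : s ≠ 0 := left_ne_zero_of_mul (hss ▸ one_ne_zero)
  obtain ⟨f, ⟨hg, hV⟩, hK, hL, hM, hy⟩ := hw s hs0
  have hne := (iL_lt_iM ℓ hl).ne
  have hyr : bl _ (x0 ℓ hl) (f r) = s := by
    rcases hr with ⟨rfl, rfl⟩ | ⟨rfl, rfl⟩
    · exact hL
    · exact hM
  -- isotropy and injectivity of `w`
  have hiso : ∀ m m', w m ≠ (w m').rev := by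
    intro m m' h
    have h1 := hg.pair (w m') (w m)
    rw [if_pos h] at h1
    have h2 : f (w m) ∈ F.V (max m m') := by
      rw [hV]; exact Submodule.subset_span ⟨m, le_max_left _ _, rfl⟩
    have h3 : f (w m') ∈ F.V (max m m') := by
      rw [hV]; exact Submodule.subset_span ⟨m', le_max_right _ _, rfl⟩
    rw [flag_isot F _ h3 h2] at h1
    exact zero_ne_one h1
  have hinj : Function.Injective w := by
    have h := (flag_linInd F (fun m => f (w m)) hV).injective
    intro a b hab
    apply h
    simp only [hab]
  have hr' : ∀ m, w m ≠ r.rev := by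
    intro m h
    rcases hrw with ⟨rfl, m', hm'⟩ | ⟨rfl, h2⟩
    · apply hiso m m'
      rw [h, hm']
    · rw [rev_iM] at h
      exact h2 m h
  have hrmid : ∀ j, j = iL ℓ hl ∨ j = iM ℓ hl → j = r ∨ j = r.rev := by
    intro j hj
    rcases hrw with ⟨rfl, _⟩ | ⟨rfl, _⟩
    · rw [rev_iL]; exact hj
    · rw [rev_iM]; exact hj.symm
  have hrle : r ≤ iM ℓ hl ∧ r.rev ≤ iM ℓ hl ∧ iL ℓ hl ≤ r.rev := by
    rcases hrw with ⟨rfl, _⟩ | ⟨rfl, _⟩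
    · rw [rev_iL]; exact ⟨(iL_lt_iM ℓ hl).le, le_rfl, (iL_lt_iM ℓ hl).le⟩
    · rw [rev_iM]; exact ⟨le_rfl, (iL_lt_iM ℓ hl).le, le_rfl⟩
  have hgood := hg.final hL hM hr
  set f' : Fin (2 * ℓ) → Fin (2 * ℓ) → ℂ := fun j => if j = r.rev then s • x0 ℓ hl + f r else
    if j = r then f r else f j - (s * bl _ (x0 ℓ hl) (f j)) • f r with hf'
  have hrr := rev_ne ℓ r
  have e1 : f' r = f r := by simp only [hf', if_neg hrr.symm, if_true]
  have e2 : f' r.rev = s • x0 ℓ hl + f r := by simp only [hf', if_true]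
  have e3 : ∀ j, j ≠ r → j ≠ r.rev → f' j = f j - (s * bl _ (x0 ℓ hl) (f j)) • f r := by
    intro j h1 h2
    simp only [hf', if_neg h1, if_neg h2]
  have hBD : memBD ℓ hl (Matrix.of fun a j => f' j a) := by
    apply hgood.toBD
    rcases hr with ⟨rfl, rfl⟩ | ⟨rfl, rfl⟩
    · rw [rev_iL] at e2
      rw [e1, e2]; simp
    · rw [rev_iM] at e2
      rw [e1, e2]; simp
  set g : Matrix (Fin (2 * ℓ)) (Fin (2 * ℓ)) ℂ := Matrix.of fun a j => f' j a with hgdef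
  have hcol : ∀ j, Matrix.toLin' g (Pi.single j 1) = f' j := by
    intro j
    ext a
    simp [hgdef]
  -- the kinds
  set P : Fin (ℓ - 1) → Prop := fun m => iM ℓ hl < w m ∧ bl _ (x0 ℓ hl) (f (w m)) ≠ 0 with hP
  set c : Fin (ℓ - 1) → DKind ℓ := fun m =>
    if P m then (if r = iL ℓ hl then DKind.tilde (2 * ℓ - (w m : ℕ))
      else DKind.hat (2 * ℓ - (w m : ℕ))) else DKind.std (w m) with hc
  have hPj : ∀ m, P m → 1 ≤ 2 * ℓ - (w m : ℕ) ∧ 2 * ℓ - (w m : ℕ) < ℓ := by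
    rintro m ⟨h, _⟩
    have h1 := (w m).isLt
    have h2 : ℓ < (w m : ℕ) := h
    omega
  have cstd : ∀ m j, c m = DKind.std j → ¬ P m ∧ j = w m := by
    intro m j h
    simp only [hc] at h
    split_ifs at h with h1 h2
    exact ⟨h1, by injection h with h; exact h.symm⟩
  have chat : ∀ m j, c m = DKind.hat j → P m ∧ r = iM ℓ hl ∧ j = 2 * ℓ - (w m : ℕ) := by
    intro m j h
    simp only [hc] at h
    split_ifs at h with h1 h2
    refine ⟨h1, ?_, by injection h with h; exact h.symm⟩
    rcases hrw with h | h
    · exact absurd h.1 h2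
    · exact h.1
  have ctil : ∀ m j, c m = DKind.tilde j → P m ∧ r = iL ℓ hl ∧ j = 2 * ℓ - (w m : ℕ) := by
    intro m j h
    simp only [hc] at h
    split_ifs at h with h1 h2
    exact ⟨h1, h2, by injection h with h; exact h.symm⟩
  have cht : ∀ m j, (c m = DKind.hat j ∨ c m = DKind.tilde j) → P m ∧ j = 2 * ℓ - (w m : ℕ) := by
    rintro m j (h | h)
    · exact ⟨(chat m j h).1, (chat m j h).2.2⟩
    · exact ⟨(ctil m j h).1, (ctil m j h).2.2⟩
  have hdv : ∀ m, Matrix.toLin' g (dvec ℓ (c m)) = f (w m) := by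
    intro m
    by_cases h : P m
    · have hj := hPj m h
      have hidx : (⟨2 * ℓ - (2 * ℓ - (w m : ℕ)), by omega⟩ : Fin (2 * ℓ)) = w m := by
        ext; have := (w m).isLt; simp; omega
      have hd : dvec ℓ (c m) = Pi.single (w m) 1 + Pi.single r 1 := by
        rcases hrw with ⟨h1, _⟩ | ⟨h1, _⟩
        · simp only [hc, if_pos h, if_pos h1, dvec, dif_pos hj, hidx]
          rw [h1]
        · have h2 : ¬ r = iL ℓ hl := by rw [h1]; exact hne.symm
          simp only [hc, if_pos h, if_neg h2, dvec, dif_pos hj, hidx]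
          rw [h1]
      rw [hd, map_add, hcol, hcol, e1, e3 _ (lt_of_le_of_lt hrle.1 h.1).ne'
        (lt_of_le_of_lt hrle.2.1 h.1).ne', hy _ h.1 h.2, hss]
      simp
    · have hd : dvec ℓ (c m) = Pi.single (w m) 1 := by
        simp only [hc, if_neg h, dvec]
      rw [hd, hcol]
      by_cases h1 : w m = r
      · rw [h1, e1]
      · rw [e3 _ h1 (hr' m)]
        have : bl _ (x0 ℓ hl) (f (w m)) = 0 := by
          by_contra h2
          rcases lt_or_ge (w m) (iL ℓ hl) with h3 | h3
          · exact h2 (hg.y_low h3)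
          · apply h
            refine ⟨?_, h2⟩
            by_contra h4
            have h5 : (w m : ℕ) ≤ ℓ := not_lt.1 h4
            have h6 : ℓ - 1 ≤ (w m : ℕ) := h3
            have h7 : w m = iL ℓ hl ∨ w m = iM ℓ hl := by
              rcases Nat.lt_or_ge (w m : ℕ) ℓ with h8 | h8
              · left; ext; change _ = ℓ - 1; omega
              · right; ext; change _ = ℓ; omega
            rcases hrmid _ h7 with h8 | h8
            · exact h1 h8
            · exact hr' m h8
        rw [this]; simp
  have hdet : IsUnit g.det := by rw [hBD.1.1]; exact isUnit_one
  have hginj : Function.Injective (Matrix.toLin' g) := by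
    intro x y h
    rw [Matrix.toLin'_apply, Matrix.toLin'_apply] at h
    have := congrArg (g⁻¹.mulVec) h
    simpa [Matrix.mulVec_mulVec, Matrix.nonsing_inv_mul g hdet] using this
  have hmap : ∀ i, (Submodule.span ℂ {x | ∃ k, k ≤ i ∧ x = dvec ℓ (c k)}).map (Matrix.toLin' g)
      = F.V i := by
    intro i
    rw [Submodule.map_span, hV i]
    congr 1
    ext x
    constructor
    · rintro ⟨y, ⟨m, hm, rfl⟩, rfl⟩
      exact ⟨m, hm, hdv m⟩
    · rintro ⟨m, hm, rfl⟩
      exact ⟨_, ⟨m, hm, rfl⟩, hdv m⟩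
  -- key order facts
  have hrevlt : ∀ m, P m → (w m).rev < iL ℓ hl := by
    intro m h
    have h2 : ℓ < (w m : ℕ) := h.1
    rw [Fin.lt_def, Fin.val_rev]
    change _ < ℓ - 1
    have := (w m).isLt
    omega
  have key : ∀ i k, i < k → P k → (w i = r ∨ (P i ∧ w i < w k)) → False := by
    intro i k hik hk hi
    have hyk : bl _ (x0 ℓ hl) (f (w k).rev.rev) ≠ 0 := by rw [Fin.rev_rev]; exact hk.2
    obtain ⟨m, hm, hm'⟩ := hK (w k).rev (w i).rev (hrevlt k hk) hyk
      (by
        rcases hi with h | h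
        · rw [h]; exact lt_of_lt_of_le (hrevlt k hk) hrle.2.2
        · exact Fin.rev_lt_rev.2 h.2)
      (by rw [Fin.rev_rev]; exact (hiso k i).symm)
      (by
        rw [Fin.rev_rev]
        rcases hi with h | h
        · rw [h, hyr]; exact hs0
        · exact h.1.2)
      (fun m => hiso m i)
    rw [Fin.rev_rev] at hm
    have := hinj hm
    subst this
    apply hm' i hik
    rw [Fin.rev_rev]
  refine ⟨⟨fun i => Submodule.span ℂ {x | ∃ k, k ≤ i ∧ x = dvec ℓ (c k)}, ?_, ?_, ?_⟩, ?_, ?_⟩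
  · intro i j hij
    apply Submodule.span_mono
    rintro x ⟨m, hm, rfl⟩
    exact ⟨m, hm.trans hij, rfl⟩
  · intro i
    rw [← F.dimV i, ← hmap i]
    exact (LinearEquiv.finrank_eq (Submodule.equivMapOfInjective _ hginj _))
  · intro i u hu v hv
    rw [← hBD.1.2]
    apply F.isot i
    · rw [← hmap i]; exact ⟨u, hu, rfl⟩
    · rw [← hmap i]; exact ⟨v, hv, rfl⟩
  · refine ⟨c, fun i => rfl, ?_, ?_, ?_, ?_, ?_⟩
    · intro i j h
      obtain ⟨h1, rfl⟩ := cht i j h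
      exact hPj i h1
    · intro i k hik h
      by_cases hk : P k
      · exfalso
        have h1 : w i = iL ℓ hl ∨ w i = iM ℓ hl := by
          rcases h with h | h
          · exact Or.inl (cstd _ _ h).2.symm
          · exact Or.inr (cstd _ _ h).2.symm
        exact key i k hik hk (Or.inl ((hrmid _ h1).resolve_right (hr' i)))
      · exact ⟨w k, by simp only [hc, if_neg hk]⟩
    · intro i j h
      obtain ⟨h1, h2, _⟩ := ctil i j h
      rcases hrw with ⟨_, m, hm⟩ | ⟨h3, _⟩
      · refine ⟨m, ?_⟩
        have : ¬ P m := by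
          rintro ⟨h4, _⟩
          rw [hm] at h4
          exact absurd h4 (not_lt.2 (iL_lt_iM ℓ hl).le)
        simp only [hc, if_neg this, hm]
      · exact absurd (h2.symm.trans h3) hne
    · intro i k hik ji jk h
      have h1 : (P i ∧ ji = 2 * ℓ - (w i : ℕ)) ∧ (P k ∧ jk = 2 * ℓ - (w k : ℕ)) := by
        rcases h with h | h
        · exact ⟨cht _ _ (Or.inl h.1), cht _ _ (Or.inl h.2)⟩
        · exact ⟨cht _ _ (Or.inr h.1), cht _ _ (Or.inr h.2)⟩
      obtain ⟨⟨hi, rfl⟩, ⟨hk, rfl⟩⟩ := h1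
      rcases lt_trichotomy (w i) (w k) with h2 | h2 | h2
      · exact (key i k hik hk (Or.inr ⟨hi, h2⟩)).elim
      · exact absurd (hinj h2) hik.ne
      · rw [Fin.lt_def] at h2
        have := (w i).isLt
        omega
    · intro i k j h1 h2 h h3
      obtain ⟨h4, h5⟩ := cht i j h
      obtain ⟨h6, h7⟩ := cstd k _ h3
      have : w i = w k := by
        rw [← h7]; ext
        have := (w i).isLt
        simp; omega
      exact h6 (hinj this ▸ h4)
  · exact ⟨g, hBD, hmap⟩

/-- The index of the leading coordinate. -/
def kpiv {ℓ : ℕ} : DKind ℓ → ℕ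
  | .std j => (j : ℕ)
  | .hat j => 2 * ℓ - j
  | .tilde j => 2 * ℓ - j

/-- The data of a flag in standard form. -/
structure StdC (ℓ : ℕ) (hl : 1 ≤ ℓ) (F : FlagD ℓ) (c : Fin (ℓ - 1) → DKind ℓ) : Prop where
  span : ∀ i, F.V i = Submodule.span ℂ {w | ∃ k, k ≤ i ∧ w = dvec ℓ (c k)}
  rng : ∀ (i : Fin (ℓ - 1)) (j : ℕ),
      (c i = DKind.hat j ∨ c i = DKind.tilde j) → 1 ≤ j ∧ j < ℓ
  ca : ∀ i k : Fin (ℓ - 1), i < k →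
      (c i = DKind.std (iL ℓ hl) ∨ c i = DKind.std (iM ℓ hl)) → ∃ j, c k = DKind.std j
  cb : ∀ (i : Fin (ℓ - 1)) (j : ℕ), c i = DKind.tilde j →
      ∃ k : Fin (ℓ - 1), c k = DKind.std (iL ℓ hl)
  cc : ∀ i k : Fin (ℓ - 1), i < k → ∀ ji jk : ℕ,
      ((c i = DKind.hat ji ∧ c k = DKind.hat jk) ∨
        (c i = DKind.tilde ji ∧ c k = DKind.tilde jk)) → ji < jk
  cd : ∀ (i k : Fin (ℓ - 1)) (j : ℕ) (h1 : 1 ≤ j) (h2 : j < ℓ),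
      (c i = DKind.hat j ∨ c i = DKind.tilde j) →
      c k ≠ DKind.std (⟨2 * ℓ - j, by omega⟩ : Fin (2 * ℓ))

theorem IsStdFlagD.toStdC {ℓ : ℕ} {hl : 1 ≤ ℓ} {F : FlagD ℓ} (h : IsStdFlagD ℓ F) :
    ∃ c, StdC ℓ hl F c := by
  obtain ⟨c, h1, h2, h3, h4, h5, h6⟩ := h
  exact ⟨c, h1, h2, h3, h4, h5, h6⟩

namespace StdC

variable {ℓ : ℕ} {hl : 1 ≤ ℓ} {F : FlagD ℓ} {c : Fin (ℓ - 1) → DKind ℓ}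

theorem piv_lt (h : StdC ℓ hl F c) (m : Fin (ℓ - 1)) : kpiv (c m) < 2 * ℓ := by
  have h1 := h.rng m
  rcases hc : c m with j | j | j
  · exact j.isLt
  · have := h1 j (Or.inl hc)
    simp only [kpiv]; omega
  · have := h1 j (Or.inr hc)
    simp only [kpiv]; omega

theorem lead_zero (h : StdC ℓ hl F c) (m : Fin (ℓ - 1)) (a : Fin (2 * ℓ))
    (ha : kpiv (c m) < (a : ℕ)) : dvec ℓ (c m) a = 0 := by
  have h1 := h.rng m
  rcases hc : c m with j | j | j
  · rw [hc] at ha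
    simp only [kpiv] at ha
    have : a ≠ j := by rintro rfl; omega
    simp [dvec, this]
  · have h2 := h1 j (Or.inl hc)
    rw [hc] at ha
    simp only [kpiv] at ha
    simp only [dvec, dif_pos h2, Pi.add_apply, Pi.single_apply, Fin.ext_iff]
    rw [if_neg (by omega), if_neg (by omega), add_zero]
  · have h2 := h1 j (Or.inr hc)
    rw [hc] at ha
    simp only [kpiv] at ha
    simp only [dvec, dif_pos h2, Pi.add_apply, Pi.single_apply, Fin.ext_iff]
    rw [if_neg (by omega), if_neg (by omega), add_zero]

theorem lead_one (h : StdC ℓ hl F c) (m : Fin (ℓ - 1)) (a : Fin (2 * ℓ))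
    (ha : kpiv (c m) = (a : ℕ)) : dvec ℓ (c m) a = 1 := by
  have h1 := h.rng m
  rcases hc : c m with j | j | j
  · rw [hc] at ha
    have : a = j := Fin.ext ha.symm
    simp [dvec, this]
  · have h2 := h1 j (Or.inl hc)
    rw [hc] at ha
    simp only [kpiv] at ha
    simp only [dvec, dif_pos h2, Pi.add_apply, Pi.single_apply, Fin.ext_iff]
    rw [if_pos (by omega), if_neg (by omega), add_zero]
  · have h2 := h1 j (Or.inr hc)
    rw [hc] at ha
    simp only [kpiv] at ha
    simp only [dvec, dif_pos h2, Pi.add_apply, Pi.single_apply, Fin.ext_iff]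
    rw [if_pos (by omega), if_neg (by omega), add_zero]

theorem mem (h : StdC ℓ hl F c) {m i : Fin (ℓ - 1)} (hm : m ≤ i) : dvec ℓ (c m) ∈ F.V i := by
  rw [h.span]; exact Submodule.subset_span ⟨m, hm, rfl⟩

theorem isot (h : StdC ℓ hl F c) (m k : Fin (ℓ - 1)) :
    bl _ (dvec ℓ (c m)) (dvec ℓ (c k)) = 0 :=
  flag_isot F (max m k) (h.mem (le_max_left _ _)) (h.mem (le_max_right _ _))

theorem bl_single (i : Fin (2 * ℓ)) (v : Fin (2 * ℓ) → ℂ) :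
    bl _ (Pi.single i 1) v = v i.rev := by
  rw [bl_apply, Finset.sum_eq_single i]
  · simp
  · intro b _ hb; simp [hb]
  · simp

theorem not_hat_L (h : StdC ℓ hl F c) {m k : Fin (ℓ - 1)} {j : ℕ} (hm : c m = DKind.hat j)
    (hk : c k = DKind.std (iL ℓ hl)) : False := by
  have h1 := h.isot k m
  have h2 := h.rng m j (Or.inl hm)
  rw [hk, hm] at h1
  simp only [dvec, dif_pos h2] at h1
  rw [bl_single, rev_iL] at h1
  simp only [Pi.add_apply, Pi.single_apply, Fin.ext_iff] at h1
  have c1 : ¬ (ℓ = 2 * ℓ - j) := by omega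
  simp [c1] at h1

theorem not_L_M (h : StdC ℓ hl F c) {m k : Fin (ℓ - 1)} (hm : c m = DKind.std (iM ℓ hl))
    (hk : c k = DKind.std (iL ℓ hl)) : False := by
  have h1 := h.isot k m
  rw [hk, hm] at h1
  simp only [dvec] at h1
  rw [bl_single, rev_iL] at h1
  simp at h1

theorem not_hat_tilde (h : StdC ℓ hl F c) {m k : Fin (ℓ - 1)} {j j' : ℕ}
    (hm : c m = DKind.hat j) (hk : c k = DKind.tilde j') : False := by
  obtain ⟨k', hk'⟩ := h.cb k j' hk
  exact h.not_hat_L hm hk'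

theorem piv_ne (h : StdC ℓ hl F c) {m k : Fin (ℓ - 1)} (hmk : m < k) :
    kpiv (c m) ≠ kpiv (c k) := by
  intro heq
  have hinj := (flag_linInd F (fun m => dvec ℓ (c m)) h.span).injective
  have hcd : ∀ (i k : Fin (ℓ - 1)) (j : ℕ) (j' : Fin (2 * ℓ)),
      (c i = DKind.hat j ∨ c i = DKind.tilde j) → c k = DKind.std j' → (j' : ℕ) = 2 * ℓ - j →
      False := by
    intro i k j j' h1 h2 h3
    have h4 := h.rng i j h1
    apply h.cd i k j h4.1 h4.2 h1
    rw [h2]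
    congr 1
    exact Fin.ext h3
  have e1 := h.rng m
  have e2 := h.rng k
  have e3 := h.cc m k hmk
  rcases hm : c m with j | j | j <;> rcases hk : c k with j' | j' | j' <;>
    rw [hm, hk] at heq <;> simp only [kpiv] at heq
  · apply hmk.ne
    apply hinj
    simp only [hm, hk, Fin.ext heq]
  · exact hcd k m j' j (Or.inl hk) hm heq
  · exact hcd k m j' j (Or.inr hk) hm heq
  · exact hcd m k j j' (Or.inl hm) hk heq.symm
  · have a1 := e1 j (Or.inl hm)
    have a2 := e2 j' (Or.inl hk)
    have a3 := e3 j j' (Or.inl ⟨hm, hk⟩)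
    omega
  · exact h.not_hat_tilde hm hk
  · exact hcd m k j j' (Or.inr hm) hk heq.symm
  · exact h.not_hat_tilde hk hm
  · have a1 := e1 j (Or.inr hm)
    have a2 := e2 j' (Or.inr hk)
    have a3 := e3 j j' (Or.inr ⟨hm, hk⟩)
    omega

theorem piv_inj (h : StdC ℓ hl F c) {m k : Fin (ℓ - 1)} (heq : kpiv (c m) = kpiv (c k)) :
    m = k := by
  rcases lt_trichotomy m k with h1 | h1 | h1
  · exact absurd heq (h.piv_ne h1)
  · exact h1
  · exact absurd heq.symm (h.piv_ne h1)

/-- Elimination: a vector of `V_i` supported up to `q` only involves basis vectors with leading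
index at most `q`. -/
theorem elim (h : StdC ℓ hl F c) {i : Fin (ℓ - 1)} {v : Fin (2 * ℓ) → ℂ} (hv : v ∈ F.V i)
    {q : ℕ} (hq : ∀ a : Fin (2 * ℓ), q < (a : ℕ) → v a = 0) (ψ : (Fin (2 * ℓ) → ℂ) →ₗ[ℂ] ℂ)
    (hψ : ψ v ≠ 0) : ∃ m, m ≤ i ∧ kpiv (c m) ≤ q ∧ ψ (dvec ℓ (c m)) ≠ 0 := by
  classical
  have hset : {w | ∃ k, k ≤ i ∧ w = dvec ℓ (c k)} =
      Set.range (fun k : {k : Fin (ℓ - 1) // k ≤ i} => dvec ℓ (c k)) := by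
    ext x
    constructor
    · rintro ⟨k, hk, rfl⟩; exact ⟨⟨k, hk⟩, rfl⟩
    · rintro ⟨⟨k, hk⟩, rfl⟩; exact ⟨k, hk, rfl⟩
  rw [h.span, hset, Submodule.mem_span_range_iff_exists_fun] at hv
  obtain ⟨a, rfl⟩ := hv
  have hle : ∀ m, a m ≠ 0 → kpiv (c m) ≤ q := by
    by_contra! hcon
    obtain ⟨m₀, hm₀, hq₀⟩ := hcon
    obtain ⟨m, hm, hmax⟩ := Finset.exists_max_image
      (Finset.univ.filter fun m => a m ≠ 0) (fun m => kpiv (c m)) ⟨m₀, by simp [hm₀]⟩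
    simp only [Finset.mem_filter, Finset.mem_univ, true_and] at hm hmax
    have h1 := hq ⟨kpiv (c m), h.piv_lt m⟩ (lt_of_lt_of_le hq₀ (hmax m₀ hm₀))
    rw [Finset.sum_apply, Finset.sum_eq_single m] at h1
    · rw [Pi.smul_apply, h.lead_one m _ rfl] at h1
      apply hm
      simpa using h1
    · intro b _ hb
      by_cases hab : a b = 0
      · simp [hab]
      · have h2 : kpiv (c b) ≠ kpiv (c m) := fun h3 => hb (Subtype.ext (h.piv_inj h3))
        have h3 := hmax b hab
        rw [Pi.smul_apply, h.lead_zero b _ (lt_of_le_of_ne h3 h2), smul_zero]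
    · simp
  rw [map_sum] at hψ
  obtain ⟨m, _, hm⟩ := Finset.exists_ne_zero_of_sum_ne_zero hψ
  rw [map_smul, smul_eq_mul] at hm
  exact ⟨m, m.2, hle m (left_ne_zero_of_mul hm), right_ne_zero_of_mul hm⟩

theorem phi_std (hl : 1 ≤ ℓ) (j : Fin (2 * ℓ)) : bl _ (x0 ℓ hl) (dvec ℓ (DKind.std j)) ≠ 0 ↔
    (j = iL ℓ hl ∨ j = iM ℓ hl) := by
  have hne := (iL_lt_iM ℓ hl).ne
  rw [bl_x0]
  simp only [dvec, Pi.single_apply]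
  constructor
  · intro h
    by_contra! hcon
    rw [if_neg hcon.1.symm, if_neg hcon.2.symm] at h
    simp at h
  · rintro (rfl | rfl)
    · rw [if_neg hne.symm, if_pos rfl]; simp
    · rw [if_neg hne, if_pos rfl]; simp

theorem phi_ht (h : StdC ℓ hl F c) {m : Fin (ℓ - 1)} {j : ℕ}
    (hm : c m = DKind.hat j ∨ c m = DKind.tilde j) :
    bl _ (x0 ℓ hl) (dvec ℓ (c m)) ≠ 0 := by
  have h2 := h.rng m j hm
  rw [bl_x0]
  rcases hm with hm | hm <;> rw [hm] <;>
    simp only [dvec, dif_pos h2, Pi.add_apply, Pi.single_apply, Fin.ext_iff]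
  all_goals
    have c1 : ¬ (ℓ = 2 * ℓ - j) := by omega
    have c2 : ¬ (ℓ - 1 = 2 * ℓ - j) := by omega
    have c3 : ¬ (ℓ - 1 = ℓ) := by omega
    have c4 : ¬ (ℓ = ℓ - 1) := by omega
    simp only [if_neg c1, if_neg c2, if_neg c3, if_neg c4, if_true]
    simp

theorem antichain (h : StdC ℓ hl F c) {m k : Fin (ℓ - 1)} (hmk : m < k)
    (hm : bl _ (x0 ℓ hl) (dvec ℓ (c m)) ≠ 0) (hk : bl _ (x0 ℓ hl) (dvec ℓ (c k)) ≠ 0) :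
    kpiv (c k) < kpiv (c m) := by
  have e1 := h.rng m
  have e2 := h.rng k
  have e3 := h.cc m k hmk
  have hne := h.piv_ne hmk
  rcases hcm : c m with j | j | j
  · rw [hcm, phi_std] at hm
    obtain ⟨j', hj'⟩ := h.ca m k hmk (by rw [hcm]; rcases hm with rfl | rfl <;> simp)
    rw [hj', phi_std] at hk
    rcases hm with rfl | rfl <;> rcases hk with rfl | rfl
    · rw [hcm, hj'] at hne; exact absurd rfl hne
    · exact (h.not_L_M hj' hcm).elim
    · exact (h.not_L_M hcm hj').elim
    · rw [hcm, hj'] at hne; exact absurd rfl hne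
  · have a1 := e1 j (Or.inl hcm)
    rcases hck : c k with j' | j' | j'
    · rw [hck, phi_std] at hk
      simp only [kpiv]
      rcases hk with rfl | rfl
      · simp only [iL]; omega
      · simp only [iM]; omega
    · have a2 := e3 j j' (Or.inl ⟨hcm, hck⟩)
      simp only [kpiv]; omega
    · exact (h.not_hat_tilde hcm hck).elim
  · have a1 := e1 j (Or.inr hcm)
    rcases hck : c k with j' | j' | j'
    · rw [hck, phi_std] at hk
      simp only [kpiv]
      rcases hk with rfl | rfl
      · simp only [iL]; omega
      · simp only [iM]; omega
    · exact (h.not_hat_tilde hck hcm).elim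
    · have a2 := e3 j j' (Or.inr ⟨hcm, hck⟩)
      simp only [kpiv]; omega

end StdC

theorem memBD.inv {ℓ : ℕ} {hl : 1 ≤ ℓ} {g : Matrix (Fin (2 * ℓ)) (Fin (2 * ℓ)) ℂ}
    (hg : memBD ℓ hl g) : memBD ℓ hl g⁻¹ := by
  obtain ⟨⟨h1, h2⟩, h3, h4⟩ := hg
  have hu : IsUnit g.det := by rw [h1]; exact isUnit_one
  have : Invertible g := Matrix.invertibleOfIsUnitDet g hu
  refine ⟨⟨?_, ?_⟩, ?_, ?_⟩
  · rw [Matrix.det_nonsing_inv, h1]; simp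
  · intro x y
    rw [← h2, Matrix.mulVec_mulVec, Matrix.mulVec_mulVec, Matrix.mul_nonsing_inv g hu]
    simp
  · have h5 : g.BlockTriangular id := fun i j hij => h3 i j hij
    intro i j hij
    exact Matrix.blockTriangular_inv_of_blockTriangular h5 hij
  · conv_lhs => rw [← h4]
    rw [Matrix.mulVec_mulVec, Matrix.nonsing_inv_mul g hu, Matrix.one_mulVec]

theorem memBD.mul {ℓ : ℕ} {hl : 1 ≤ ℓ} {g g' : Matrix (Fin (2 * ℓ)) (Fin (2 * ℓ)) ℂ}
    (hg : memBD ℓ hl g) (hg' : memBD ℓ hl g') : memBD ℓ hl (g * g') := by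
  refine ⟨⟨?_, ?_⟩, ?_, ?_⟩
  · rw [Matrix.det_mul, hg.1.1, hg'.1.1, one_mul]
  · intro x y
    rw [← Matrix.mulVec_mulVec, ← Matrix.mulVec_mulVec, hg.1.2, hg'.1.2]
  · have h5 : g.BlockTriangular id := fun i j hij => hg.2.1 i j hij
    have h6 : g'.BlockTriangular id := fun i j hij => hg'.2.1 i j hij
    intro i j hij
    exact h5.mul h6 hij
  · rw [← Matrix.mulVec_mulVec, hg'.2.2, hg.2.2]

theorem flagDRel.symm {ℓ : ℕ} {hl : 1 ≤ ℓ} {F F' : FlagD ℓ} (h : flagDRel ℓ hl F F') :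
    flagDRel ℓ hl F' F := by
  obtain ⟨g, hg, h1⟩ := h
  have hu : IsUnit g.det := by rw [hg.1.1]; exact isUnit_one
  refine ⟨g⁻¹, hg.inv, fun i => ?_⟩
  rw [← h1 i, ← Submodule.map_comp, ← Matrix.toLin'_mul, Matrix.nonsing_inv_mul g hu,
    Matrix.toLin'_one, Submodule.map_id]

theorem flagDRel.trans {ℓ : ℕ} {hl : 1 ≤ ℓ} {F F' F'' : FlagD ℓ} (h : flagDRel ℓ hl F F')
    (h' : flagDRel ℓ hl F' F'') : flagDRel ℓ hl F F'' := by
  obtain ⟨g, hg, h1⟩ := h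
  obtain ⟨g', hg', h1'⟩ := h'
  refine ⟨g * g', hg.mul hg', fun i => ?_⟩
  rw [Matrix.toLin'_mul, Submodule.map_comp, h1' i, h1 i]

/-- The transformation of a vector `v` by an element of `B` does not raise leading indices. -/
theorem memBD.lead {ℓ : ℕ} {hl : 1 ≤ ℓ} {g : Matrix (Fin (2 * ℓ)) (Fin (2 * ℓ)) ℂ}
    (hg : memBD ℓ hl g) {v : Fin (2 * ℓ) → ℂ} {q : ℕ}
    (hq : ∀ a : Fin (2 * ℓ), q < (a : ℕ) → v a = 0) :
    (∀ a : Fin (2 * ℓ), q < (a : ℕ) → g.mulVec v a = 0) ∧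
    ∀ a : Fin (2 * ℓ), (a : ℕ) = q → g.mulVec v a = g a a * v a := by
  constructor
  · intro a ha
    simp only [Matrix.mulVec, dotProduct]
    apply Finset.sum_eq_zero
    intro b _
    rcases lt_or_ge (b : ℕ) (a : ℕ) with h | h
    · rw [hg.2.1 a b h, zero_mul]
    · rw [hq b (by omega), mul_zero]
  · intro a ha
    simp only [Matrix.mulVec, dotProduct]
    apply Finset.sum_eq_single a
    · intro b _ hb
      rcases lt_or_gt_of_ne hb with h | h
      · rw [hg.2.1 a b h, zero_mul]
      · rw [hq b (by rw [← ha]; exact h), mul_zero]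
    · simp

theorem memBD.diag {ℓ : ℕ} {hl : 1 ≤ ℓ} {g : Matrix (Fin (2 * ℓ)) (Fin (2 * ℓ)) ℂ}
    (hg : memBD ℓ hl g) (a : Fin (2 * ℓ)) : g a a ≠ 0 := by
  have h1 := hg.1.1
  rw [Matrix.det_of_isUpperTriangular (fun i j hij => hg.2.1 i j hij)] at h1
  intro h
  rw [Finset.prod_eq_zero (f := fun i => g i i) (Finset.mem_univ a) h] at h1
  exact zero_ne_one h1

theorem memBD.phi {ℓ : ℕ} {hl : 1 ≤ ℓ} {g : Matrix (Fin (2 * ℓ)) (Fin (2 * ℓ)) ℂ}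
    (hg : memBD ℓ hl g) (v : Fin (2 * ℓ) → ℂ) :
    bl _ (x0 ℓ hl) (g.mulVec v) = bl _ (x0 ℓ hl) v := by
  have h1 : g.mulVec (x0 ℓ hl) = x0 ℓ hl := hg.2.2
  have h2 := hg.1.2 (x0 ℓ hl) v
  rw [h1] at h2
  exact h2

theorem piv_trans {ℓ : ℕ} {hl : 1 ≤ ℓ} {F F' : FlagD ℓ} {c c' : Fin (ℓ - 1) → DKind ℓ}
    (h : StdC ℓ hl F c) (h' : StdC ℓ hl F' c') (hr : flagDRel ℓ hl F F') (i : Fin (ℓ - 1)) :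
    ∃ m, m ≤ i ∧ kpiv (c m) = kpiv (c' i) := by
  obtain ⟨g, hg, h1⟩ := hr
  have h2 : g.mulVec (dvec ℓ (c' i)) ∈ F.V i := by
    rw [← h1 i]; exact ⟨_, h'.mem le_rfl, rfl⟩
  obtain ⟨h3, h4⟩ := hg.lead (h'.lead_zero i)
  have h5 := h4 ⟨kpiv (c' i), h'.piv_lt i⟩ rfl
  rw [h'.lead_one i _ rfl, mul_one] at h5
  obtain ⟨m, hm, hle, hne⟩ := h.elim h2 h3 (LinearMap.proj ⟨kpiv (c' i), h'.piv_lt i⟩)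
    (by rw [LinearMap.proj_apply, h5]; exact hg.diag _)
  refine ⟨m, hm, le_antisymm hle ?_⟩
  by_contra hlt
  exact hne (h.lead_zero m _ (not_le.1 hlt))

theorem phi_trans {ℓ : ℕ} {hl : 1 ≤ ℓ} {F F' : FlagD ℓ} {c c' : Fin (ℓ - 1) → DKind ℓ}
    (h : StdC ℓ hl F c) (h' : StdC ℓ hl F' c') (hr : flagDRel ℓ hl F F') (i : Fin (ℓ - 1))
    (hi : bl _ (x0 ℓ hl) (dvec ℓ (c' i)) ≠ 0) :
    ∃ m, m ≤ i ∧ kpiv (c m) ≤ kpiv (c' i) ∧ bl _ (x0 ℓ hl) (dvec ℓ (c m)) ≠ 0 := by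
  obtain ⟨g, hg, h1⟩ := hr
  have h2 : g.mulVec (dvec ℓ (c' i)) ∈ F.V i := by
    rw [← h1 i]; exact ⟨_, h'.mem le_rfl, rfl⟩
  exact h.elim h2 (hg.lead (h'.lead_zero i)).1 (bl _ (x0 ℓ hl)) (by rw [hg.phi]; exact hi)

theorem piv_eq {ℓ : ℕ} {hl : 1 ≤ ℓ} {F F' : FlagD ℓ} {c c' : Fin (ℓ - 1) → DKind ℓ}
    (h : StdC ℓ hl F c) (h' : StdC ℓ hl F' c') (hr : flagDRel ℓ hl F F') (i : Fin (ℓ - 1)) :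
    kpiv (c i) = kpiv (c' i) := by
  induction i using WellFoundedLT.induction with
  | ind i ih =>
    obtain ⟨m, hm, he⟩ := piv_trans h h' hr i
    rcases lt_or_eq_of_le hm with h1 | h1
    · have h2 := ih m h1
      exact absurd (h'.piv_inj (h2.symm.trans he)) h1.ne
    · rw [← h1]; rw [h1]; rw [h1] at he; exact he

theorem phi_imp {ℓ : ℕ} {hl : 1 ≤ ℓ} {F F' : FlagD ℓ} {c c' : Fin (ℓ - 1) → DKind ℓ}
    (h : StdC ℓ hl F c) (h' : StdC ℓ hl F' c') (hr : flagDRel ℓ hl F F') (i : Fin (ℓ - 1))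
    (hi : bl _ (x0 ℓ hl) (dvec ℓ (c' i)) ≠ 0) : bl _ (x0 ℓ hl) (dvec ℓ (c i)) ≠ 0 := by
  obtain ⟨m, hm, h1, h2⟩ := phi_trans h h' hr i hi
  obtain ⟨k, hk, h3, h4⟩ := phi_trans h' h hr.symm m h2
  rcases lt_or_eq_of_le (hk.trans hm) with h5 | h5
  · have := h'.antichain h5 h4 hi
    omega
  · subst h5
    have := le_antisymm hm hk
    rw [← this]; exact h2

theorem kind_eq {ℓ : ℕ} {hl : 1 ≤ ℓ} {F F' : FlagD ℓ} {c c' : Fin (ℓ - 1) → DKind ℓ}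
    (h : StdC ℓ hl F c) (h' : StdC ℓ hl F' c') (hr : flagDRel ℓ hl F F') (i : Fin (ℓ - 1)) :
    c i = c' i := by
  have hp := piv_eq h h' hr
  have hphi : bl _ (x0 ℓ hl) (dvec ℓ (c i)) ≠ 0 ↔ bl _ (x0 ℓ hl) (dvec ℓ (c' i)) ≠ 0 :=
    ⟨phi_imp h' h hr.symm i, phi_imp h h' hr i⟩
  -- a standard vector with a pivot of a hat or tilde vector is not seen by `φ`
  have hsd : ∀ {F F' : FlagD ℓ} {c c' : Fin (ℓ - 1) → DKind ℓ}, StdC ℓ hl F' c' →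
      kpiv (c i) = kpiv (c' i) →
      (bl _ (x0 ℓ hl) (dvec ℓ (c i)) ≠ 0 ↔ bl _ (x0 ℓ hl) (dvec ℓ (c' i)) ≠ 0) →
      ∀ (j : Fin (2 * ℓ)) (j' : ℕ), c i = DKind.std j →
      (c' i = DKind.hat j' ∨ c' i = DKind.tilde j') → False := by
    intro F F' c c' h' hp hphi j j' h1 h2
    have h3 := hphi.2 (h'.phi_ht h2)
    have h4 := h'.rng i j' h2
    rw [h1, StdC.phi_std] at h3
    have h5 : kpiv (c' i) = 2 * ℓ - j' := by rcases h2 with h2 | h2 <;> rw [h2, kpiv]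
    rw [h1, h5] at hp
    simp only [kpiv] at hp
    rcases h3 with rfl | rfl
    · simp only [iL] at hp; omega
    · simp only [iM] at hp; omega
  have hht : ∀ {F F' : FlagD ℓ} {c c' : Fin (ℓ - 1) → DKind ℓ}, StdC ℓ hl F c →
      StdC ℓ hl F' c' → (∀ i, kpiv (c i) = kpiv (c' i)) →
      ∀ j j' : ℕ, c i = DKind.hat j → c' i = DKind.tilde j' → False := by
    intro F F' c c' h h' hp j j' h1 h2
    obtain ⟨k, hk⟩ := h'.cb i j' h2
    have h3 := hp k
    rw [hk] at h3
    simp only [kpiv] at h3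
    have h4 := h.rng k
    rcases hck : c k with a | a | a
    · rw [hck] at h3
      have : a = iL ℓ hl := Fin.ext h3
      rw [this] at hck
      exact h.not_hat_L h1 hck
    · have h5 := h4 a (Or.inl hck)
      rw [hck] at h3
      simp only [kpiv, iL] at h3
      omega
    · have h5 := h4 a (Or.inr hck)
      rw [hck] at h3
      simp only [kpiv, iL] at h3
      omega
  have hpi := hp i
  have e1 := h.rng i
  have e2 := h'.rng i
  rcases hm : c i with j | j | j <;> rcases hk : c' i with j' | j' | j'
  · rw [hm, hk] at hpi
    rw [Fin.ext hpi]
  · exact (hsd (F := F) h' hpi hphi j j' hm (Or.inl hk)).elim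
  · exact (hsd (F := F) h' hpi hphi j j' hm (Or.inr hk)).elim
  · exact (hsd (F := F') h hpi.symm hphi.symm j' j hk (Or.inl hm)).elim
  · have a1 := e1 j (Or.inl hm)
    have a2 := e2 j' (Or.inl hk)
    rw [hm, hk] at hpi
    simp only [kpiv] at hpi
    have : j = j' := by omega
    rw [this]
  · exact (hht h h' hp j j' hm hk).elim
  · exact (hsd (F := F') h hpi.symm hphi.symm j' j hk (Or.inr hm)).elim
  · exact (hht h' h (fun i => (hp i).symm) j' j hk hm).elim
  · have a1 := e1 j (Or.inr hm)
    have a2 := e2 j' (Or.inr hk)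
    rw [hm, hk] at hpi
    simp only [kpiv] at hpi
    have : j = j' := by omega
    rw [this]

/-- Every isotropic flag of type D in `ℂ^{2ℓ}` lies in the
`B_{SO(2ℓ-1)}`-orbit of a unique `SO(2ℓ)`-flag in standard form. -/
theorem statement18 (ℓ : ℕ) (hl : 1 ≤ ℓ) (F : FlagD ℓ) :
    ∃! F' : FlagD ℓ, IsStdFlagD ℓ F' ∧ flagDRel ℓ hl F F' := by
  obtain ⟨F', h1, h2⟩ := exists_std hl F
  refine ⟨F', ⟨h1, h2⟩, ?_⟩
  rintro F'' ⟨h3, h4⟩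
  obtain ⟨c, hc⟩ := h1.toStdC (hl := hl)
  obtain ⟨c', hc'⟩ := h3.toStdC (hl := hl)
  have hr : flagDRel ℓ hl F'' F' := h4.symm.trans h2
  have hcc : c' = c := funext (kind_eq hc' hc hr)
  subst hcc
  have hV : F''.V = F'.V := funext fun i => by rw [hc.span i, hc'.span i]
  cases F''
  cases F'
  simp only at hV
  subst hV
  rfl

end
end
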